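/- arXiv:2208.01470 — 3 statements merged into one kernel-verified Lean document; each statement's English description precedes it below -/
import Mathlib

section
/- For every integer k ≥ 1 there exists an integer N such that the following holds: for all integers n_1, n_2, n_3, n_4 with N ≤ n_1 ≤ n_2 ≤ n_3 ≤ n_4 and n = n_1 + n_2 + n_3 + n_4, one has ex(K_{n_1,n_2,n_3,n_4}, kK_3) = n_4(n_1+n_2+n_3) + (k−1)(n_2+n_3) if n_4 > n_2 + n_3, and ex(K_{n_1,n_2,n_3,n_4}, kK_3) = (n_1+n_4)(n_2+n_3) + (k−1)n_4 if n_4 ≤ n_2 + n_3. -/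
open SimpleGraph Finset

/-- `F` has a (not necessarily induced) copy in `G`:  there is an injective map of the
vertices of `F` into the vertices of `G` preserving adjacency. -/
def HasCopy {α β : Type*} (G : SimpleGraph α) (F : SimpleGraph β) : Prop :=
  ∃ f : β → α, Function.Injective f ∧ ∀ ⦃a b⦄, F.Adj a b → G.Adj (f a) (f b)

/-- `exNum G F` is the maximum number of edges of a spanning subgraph of `G`
containing no copy of `F`. -/
noncomputable def exNum {α β : Type*} [Fintype α] (G : SimpleGraph α) (F : SimpleGraph β) : ℕ :=
  sSup {m | ∃ H : SimpleGraph α, H ≤ G ∧ ¬ HasCopy H F ∧ m = H.edgeSet.ncard}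

/-- `kCliques k t` is the disjoint union of `k` copies of the complete graph `K_t`. -/
def kCliques (k t : ℕ) : SimpleGraph (Fin k × Fin t) :=
  SimpleGraph.fromRel (fun p q => p.1 = q.1)

/-- The complete multipartite graph with parts of sizes `n 0, …, n (r-1)`. -/
abbrev completeMultipartite {r : ℕ} (n : Fin r → ℕ) : SimpleGraph (Σ i : Fin r, Fin (n i)) :=
  completeMultipartiteGraph (fun i => Fin (n i))

/-- The sum of `x` over the part of the (labelled) partition `g` with label `i`. -/
def partSum {r s : ℕ} (x : Fin r → ℕ) (g : Fin r → Fin s) (i : Fin s) : ℕ :=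
  ∑ a ∈ Finset.univ.filter (fun a => g a = i), x a

/-- The sum, over unordered pairs of distinct parts of the (labelled) partition `g`,
of the products of the part sums of `x`. -/
def pairProdSum {r s : ℕ} (x : Fin r → ℕ) (g : Fin r → Fin s) : ℕ :=
  ∑ p ∈ Finset.univ.filter (fun p : Fin s × Fin s => p.1 < p.2),
    partSum x g p.1 * partSum x g p.2

/-- The function `f_t` : the maximum, over all partitions of `{0, …, r-1}` into `t-1`
nonempty parts (encoded as surjections onto `Fin (t-1)`), of the sum over unordered pairs
of distinct parts of the products of the part sums. -/
def fT {r : ℕ} (t : ℕ) (x : Fin r → ℕ) : ℕ :=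
  (Finset.univ.filter (fun g : Fin r → Fin (t - 1) => Function.Surjective g)).sup
    (fun g => pairProdSum x g)

section HZ
open Classical

def tT (m a b c d : ℕ) : ℕ := d * (b + c) + a * max d (b + c) + m * min d (b + c)

theorem tT_step0 (m a b c d : ℕ) : tT m a b c d + (b + c + d) ≤ tT (m+1) (a+1) b c d := by
  unfold tT
  rcases le_total d (b+c) with h | h
  · simp only [max_eq_right h, min_eq_left h]; nlinarith
  · simp only [max_eq_left h, min_eq_right h]; nlinarith

theorem tT_step1 (m a b c d : ℕ) (h1 : a ≤ b) (_h2 : b + 1 ≤ c) (h3 : c ≤ d) :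
    tT m a b c d + (a + c + d) ≤ tT (m+1) a (b+1) c d := by
  unfold tT
  rcases le_or_gt d (b+c) with h | h
  · have h' : d ≤ b + 1 + c := by omega
    simp only [max_eq_right h, min_eq_left h, max_eq_right h', min_eq_left h']; nlinarith
  · have h' : b + 1 + c ≤ d := by omega
    simp only [max_eq_left h.le, min_eq_right h.le, max_eq_left h', min_eq_right h']; nlinarith

theorem tT_step2 (m a b c d : ℕ) (h1 : a ≤ b) (h2 : b ≤ c) (h3 : c + 1 ≤ d) :
    tT m a b c d + (a + b + d) ≤ tT (m+1) a b (c+1) d := by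
  unfold tT
  rcases le_or_gt d (b+c) with h | h
  · have h' : d ≤ b + (c + 1) := by omega
    simp only [max_eq_right h, min_eq_left h, max_eq_right h', min_eq_left h']; nlinarith
  · have h' : b + (c + 1) ≤ d := by omega
    simp only [max_eq_left h.le, min_eq_right h.le, max_eq_left h', min_eq_right h']; nlinarith

theorem tT_step3 (m a b c d : ℕ) (h1 : a ≤ b) (h2 : b ≤ c) (h3 : c ≤ d) :
    tT m a b c d + (a + b + c) ≤ tT (m+1) a b c (d+1) := by
  unfold tT
  rcases le_or_gt (b+c) d with h | h
  · have h' : b + c ≤ d + 1 := by omega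
    simp only [max_eq_left h, min_eq_right h, max_eq_left h', min_eq_right h']; nlinarith
  · have h' : d + 1 ≤ b + c := by omega
    simp only [max_eq_right h.le, min_eq_left h.le, max_eq_right h', min_eq_left h']; nlinarith

variable {α : Type} [Fintype α]

def TF (H : SimpleGraph α) (k : ℕ) : Prop :=
  ∀ T : Finset (Finset α), (∀ t ∈ T, H.IsNClique 3 t) →
    (∀ s ∈ T, ∀ t ∈ T, s ≠ t → Disjoint s t) → T.card < k

noncomputable def psz (W : Finset α) (c : α → Fin 4) (i : Fin 4) : ℕ := #{u ∈ W | c u = i}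

theorem lin6 (x1 x2 x3 x4 x5 x6 F : ℕ) (e1 : x5 + x6 + x3 ≤ F) (e2 : x5 + x6 + (x1 + x2) ≤ F)
    (k1 : x1 ≤ x5) (k2 : x2 ≤ x6) (k4 : x2 ≤ x3) (k5 : x1 ≤ x2) (k6 : x4 ≤ x5) (k7 : x4 ≤ x6)
    (k8 : x3 + x4 ≤ x5 + x2) (k9 : x2 + x5 ≤ x1 + x6)
    (p q r s t u : Prop) (hpqr : ¬ (p ∧ q ∧ s)) (h4 : ¬ (p ∧ r ∧ t)) (h5 : ¬ (q ∧ r ∧ u))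
    (h6 : ¬ (s ∧ t ∧ u)) :
    x1 * (if p then 1 else 0) + x2 * (if q then 1 else 0) + x3 * (if r then 1 else 0)
     + x4 * (if s then 1 else 0) + x5 * (if t then 1 else 0)
     + x6 * (if u then 1 else 0) ≤ F := by
  split_ifs with hp hq hr hs ht hu <;>
  first
  | omega
  | exact (hpqr ⟨by assumption, by assumption, by assumption⟩).elim
  | exact (h4 ⟨by assumption, by assumption, by assumption⟩).elim
  | exact (h5 ⟨by assumption, by assumption, by assumption⟩).elim
  | exact (h6 ⟨by assumption, by assumption, by assumption⟩).elim

theorem four_ineq (a b c d : ℕ) (h1 : a ≤ b) (h2 : b ≤ c) (h3 : c ≤ d)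
    (p q r s t u : Prop) (hpqr : ¬ (p ∧ q ∧ s)) (h4 : ¬ (p ∧ r ∧ t)) (h5 : ¬ (q ∧ r ∧ u))
    (h6 : ¬ (s ∧ t ∧ u)) :
    (a * b) * (if p then 1 else 0) + (a * c) * (if q then 1 else 0) + (a * d) * (if r then 1 else 0)
     + (b * c) * (if s then 1 else 0) + (b * d) * (if t then 1 else 0)
     + (c * d) * (if u then 1 else 0) ≤ tT 0 a b c d := by
  have e1 : d * (b + c) + a * d ≤ tT 0 a b c d := by
    unfold tT; have := Nat.mul_le_mul_left a (le_max_left d (b+c)); omega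
  have e2 : d * (b + c) + a * (b + c) ≤ tT 0 a b c d := by
    unfold tT; have := Nat.mul_le_mul_left a (le_max_right d (b+c)); omega
  have k1 : a * b ≤ b * d := by nlinarith
  have k2 : a * c ≤ c * d := by nlinarith
  have k4 : a * c ≤ a * d := by nlinarith
  have k5 : a * b ≤ a * c := by nlinarith
  have k6 : b * c ≤ b * d := by nlinarith
  have k7 : b * c ≤ c * d := by nlinarith
  have k8 : a * d + b * c ≤ b * d + a * c := by nlinarith
  have k9 : a * c + b * d ≤ a * b + c * d := by nlinarith
  rw [mul_add, mul_comm d b, mul_comm d c] at e1 e2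
  rw [mul_add] at e2
  exact lin6 _ _ _ _ _ _ _ e1 e2 k1 k2 k4 k5 k6 k7 k8 k9 p q r s t u hpqr h4 h5 h6

theorem sum_edges (H : SimpleGraph α) (W : Finset α) (c : α → Fin 4)
    (hW : ∀ u v, H.Adj u v → u ∈ W) (hc : ∀ u v, H.Adj u v → c u ≠ c v) :
    #H.edgeFinset = ∑ x ∈ W with c x = 0, ∑ y ∈ W with c y = 1, (if H.Adj x y then 1 else 0)
      + ∑ x ∈ W with c x = 0, ∑ y ∈ W with c y = 2, (if H.Adj x y then 1 else 0)
      + ∑ x ∈ W with c x = 0, ∑ y ∈ W with c y = 3, (if H.Adj x y then 1 else 0)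
      + ∑ x ∈ W with c x = 1, ∑ y ∈ W with c y = 2, (if H.Adj x y then 1 else 0)
      + ∑ x ∈ W with c x = 1, ∑ y ∈ W with c y = 3, (if H.Adj x y then 1 else 0)
      + ∑ x ∈ W with c x = 2, ∑ y ∈ W with c y = 3, (if H.Adj x y then 1 else 0) := by
  have hd : ∀ x, H.degree x = ∑ y ∈ W, (if H.Adj x y then 1 else 0) := by
    intro x
    rw [← Finset.card_filter, ← card_neighborFinset_eq_degree]
    congr 1; ext y
    simp only [mem_neighborFinset, mem_filter]
    exact ⟨fun h => ⟨hW _ _ h.symm, h⟩, fun h => h.2⟩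
  have h1 := H.sum_degrees_eq_twice_card_edges
  have h2 : ∑ v, H.degree v = ∑ x ∈ W, ∑ y ∈ W, (if H.Adj x y then 1 else 0) := by
    rw [← Finset.sum_subset (Finset.subset_univ W)]
    · exact Finset.sum_congr rfl fun x _ => hd x
    · intro x _ hx
      rw [hd]; apply Finset.sum_eq_zero; intro y _
      rw [if_neg]; exact fun h => hx (hW _ _ h)
  have h3 : ∀ f : α → ℕ, ∑ x ∈ W, f x = ∑ x ∈ W with c x = 0, f x + ∑ x ∈ W with c x = 1, f x
     + ∑ x ∈ W with c x = 2, f x + ∑ x ∈ W with c x = 3, f x := by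
    intro f
    rw [← Finset.sum_fiberwise W c f, Fin.sum_univ_four]
  have hself : ∀ i : Fin 4, ∑ x ∈ W with c x = i, ∑ y ∈ W with c y = i,
      (if H.Adj x y then 1 else 0) = 0 := by
    intro i
    apply Finset.sum_eq_zero; intro x hx; apply Finset.sum_eq_zero; intro y hy
    rw [if_neg]; intro h
    exact hc _ _ h ((mem_filter.1 hx).2.trans (mem_filter.1 hy).2.symm)
  have hsw : ∀ i j : Fin 4, ∑ x ∈ W with c x = i, ∑ y ∈ W with c y = j,
      (if H.Adj x y then 1 else 0) = ∑ x ∈ W with c x = j, ∑ y ∈ W with c y = i,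
      (if H.Adj x y then 1 else 0) := by
    intro i j
    rw [Finset.sum_comm]; simp only [H.adj_comm]
  rw [h2, h3] at h1
  simp only [h3 (fun y => if H.Adj _ y then 1 else 0), Finset.sum_add_distrib, hself] at h1
  rw [hsw 1 0, hsw 2 0, hsw 3 0, hsw 2 1, hsw 3 1, hsw 3 2] at h1
  omega

theorem base_case (H : SimpleGraph α) (W : Finset α) (c : α → Fin 4)
    (hW : ∀ u v, H.Adj u v → u ∈ W) (hc : ∀ u v, H.Adj u v → c u ≠ c v)
    (hT : ∀ x y z, H.Adj x y → H.Adj x z → H.Adj y z → False)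
    (h0 : 1 ≤ psz W c 0) (h1 : psz W c 0 ≤ psz W c 1) (h2 : psz W c 1 ≤ psz W c 2)
    (h3 : psz W c 2 ≤ psz W c 3) :
    #H.edgeFinset ≤ tT 0 (psz W c 0) (psz W c 1) (psz W c 2) (psz W c 3) := by
  rw [sum_edges H W c hW hc]
  have key : ∑ x ∈ W with c x = 0, ∑ y ∈ W with c y = 1, ∑ z ∈ W with c z = 2,
      ∑ w ∈ W with c w = 3, (
     (psz W c 0 * psz W c 1) * (if H.Adj x y then 1 else 0)
     + (psz W c 0 * psz W c 2) * (if H.Adj x z then 1 else 0)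
     + (psz W c 0 * psz W c 3) * (if H.Adj x w then 1 else 0)
     + (psz W c 1 * psz W c 2) * (if H.Adj y z then 1 else 0)
     + (psz W c 1 * psz W c 3) * (if H.Adj y w then 1 else 0)
     + (psz W c 2 * psz W c 3) * (if H.Adj z w then 1 else 0)) ≤
     ∑ x ∈ W with c x = 0, ∑ y ∈ W with c y = 1, ∑ z ∈ W with c z = 2,
      ∑ w ∈ W with c w = 3, tT 0 (psz W c 0) (psz W c 1) (psz W c 2) (psz W c 3) := by
    refine Finset.sum_le_sum fun x _ => Finset.sum_le_sum fun y _ => Finset.sum_le_sum fun z _ =>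
      Finset.sum_le_sum fun w _ => ?_
    apply four_ineq _ _ _ _ h1 h2 h3
    · exact fun h => hT _ _ _ h.1 h.2.1 h.2.2
    · exact fun h => hT _ _ _ h.1 h.2.1 h.2.2
    · exact fun h => hT _ _ _ h.1 h.2.1 h.2.2
    · exact fun h => hT _ _ _ h.1 h.2.1 h.2.2
  generalize hF : tT 0 (psz W c 0) (psz W c 1) (psz W c 2) (psz W c 3) = F at *
  have hp : ∀ i, #{u ∈ W | c u = i} = psz W c i := fun i => rfl
  simp only [Finset.sum_add_distrib, Finset.sum_const, smul_eq_mul, ← Finset.mul_sum, hp] at key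
  generalize psz W c 0 = n0 at *
  generalize psz W c 1 = n1 at *
  generalize psz W c 2 = n2 at *
  generalize psz W c 3 = n3 at *
  have hpos : 0 < n0 * n1 * n2 * n3 := by
    have : 0 < n1 := by omega
    have : 0 < n2 := by omega
    have : 0 < n3 := by omega
    positivity
  refine Nat.le_of_mul_le_mul_left ?_ hpos
  refine le_trans (le_of_eq ?_) (key.trans (le_of_eq ?_)) <;> ring

theorem nonheavy (H : SimpleGraph α) (W : Finset α) (c : α → Fin 4) (m : ℕ)
    (hW : ∀ u v, H.Adj u v → u ∈ W) (hc : ∀ u v, H.Adj u v → c u ≠ c v)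
    (hT : TF H (m + 1))
    (hnh : ∀ v, ∃ C : Finset α, #C ≤ 3 * m ∧ v ∉ C ∧
      ∀ x y, H.Adj v x → H.Adj v y → H.Adj x y → x ∈ C ∨ y ∈ C)
    (h0 : 1 ≤ psz W c 0) (h1 : psz W c 0 ≤ psz W c 1) (h2 : psz W c 1 ≤ psz W c 2)
    (h3 : psz W c 2 ≤ psz W c 3) :
    #H.edgeFinset ≤ tT 0 (psz W c 0) (psz W c 1) (psz W c 2) (psz W c 3) + 9 * m ^ 2 := by
  -- maximal family
  let P : Finset (Finset α) → Prop := fun T => (∀ t ∈ T, H.IsNClique 3 t) ∧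
    (∀ s ∈ T, ∀ t ∈ T, s ≠ t → Disjoint s t)
  obtain ⟨T, hTP, hmax⟩ := Finset.exists_max_image (Finset.univ.filter P) Finset.card
    ⟨∅, by simp [P]⟩
  have hTP : P T := by simpa using hTP
  have hcard := hT T hTP.1 hTP.2
  let S := T.biUnion id
  have hS : #S ≤ m * 3 := by
    calc #S ≤ #T * 3 := Finset.card_biUnion_le_card_mul _ _ _ (fun t ht => (hTP.1 t ht).2.le)
      _ ≤ m * 3 := by gcongr; omega
  choose C hC1 hC2 hC3 using hnh
  let D : Finset (Sym2 α) := S.biUnion fun v => (C v).image fun x => s(v, x)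
  have hD : #D ≤ 9 * m ^ 2 := by
    calc #D ≤ #S * (3 * m) := Finset.card_biUnion_le_card_mul _ _ _
            (fun t ht => Finset.card_image_le.trans (hC1 t))
      _ ≤ (m * 3) * (3 * m) := by gcongr
      _ = _ := by ring
  obtain ⟨H', hH'⟩ : ∃ H', H' = H.deleteEdges (D : Set (Sym2 α)) := ⟨_, rfl⟩
  have hle : H' ≤ H := hH' ▸ H.deleteEdges_le _
  have hb := base_case H' W c (fun u v h => hW u v (hle h)) (fun u v h => hc u v (hle h)) ?_
    h0 h1 h2 h3
  · have he : #H.edgeFinset ≤ #H'.edgeFinset + #D := by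
      have : H.edgeFinset ⊆ H'.edgeFinset ∪ D := by
        intro e he
        by_cases heD : e ∈ D
        · simp [heD]
        · simp only [mem_union, mem_edgeFinset] at *
          left
          simp [hH', edgeSet_deleteEdges, he, heD]
      exact (Finset.card_le_card this).trans (Finset.card_union_le _ _)
    omega
  · -- triangle free
    have main : ∀ v x y, v ∈ S → H'.Adj v x → H'.Adj v y → H'.Adj x y → False := by
      intro v x y hv hx hy hxy
      have nd : ∀ z, H'.Adj v z → z ∉ C v := by
        intro z hz hzC
        rw [hH'] at hz
        have := (deleteEdges_adj.1 hz).2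
        apply this
        simp only [D, Finset.mem_coe, Finset.mem_biUnion, Finset.mem_image]
        exact ⟨v, hv, z, hzC, rfl⟩
      rcases hC3 v x y (hle hx) (hle hy) (hle hxy) with h | h
      · exact nd _ hx h
      · exact nd _ hy h
    intro x y z hxy hxz hyz
    by_cases hx : x ∈ S
    · exact main x y z hx hxy hxz hyz
    by_cases hy : y ∈ S
    · exact main y x z hy hxy.symm hyz hxz
    by_cases hz : z ∈ S
    · exact main z x y hz hxz.symm hyz.symm hxy
    have hcl : H.IsNClique 3 {x, y, z} := is3Clique_triple_iff.2 ⟨hle hxy, hle hxz, hle hyz⟩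
    have hdis : ∀ t ∈ T, Disjoint ({x, y, z} : Finset α) t := by
      intro t ht
      rw [Finset.disjoint_left]
      intro a ha hat
      have : a ∈ S := Finset.mem_biUnion.2 ⟨t, ht, hat⟩
      simp only [mem_insert, mem_singleton] at ha
      rcases ha with rfl | rfl | rfl <;> contradiction
    have hnot : ({x, y, z} : Finset α) ∉ T := by
      intro h
      have := hdis _ h
      simp at this
    have hP' : P (insert {x, y, z} T) := by
      constructor
      · intro t ht
        rcases mem_insert.1 ht with rfl | ht
        · exact hcl
        · exact hTP.1 t ht
      · intro s hs t ht hst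
        rcases mem_insert.1 hs with rfl | hs <;> rcases mem_insert.1 ht with rfl | ht
        · exact absurd rfl hst
        · exact hdis _ ht
        · exact (hdis _ hs).symm
        · exact hTP.2 s hs t ht hst
    have := hmax _ (mem_filter.2 ⟨mem_univ _, hP'⟩)
    rw [card_insert_of_notMem hnot] at this
    omega

theorem heavy_TF (H : SimpleGraph α) (m : ℕ) (hT : TF H (m + 2)) (v : α)
    (hv : ∀ C : Finset α, #C ≤ 3 * (m + 1) → v ∉ C →
      ∃ x y, H.Adj v x ∧ H.Adj v y ∧ H.Adj x y ∧ x ∉ C ∧ y ∉ C) :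
    TF (H.deleteIncidenceSet v) (m + 1) := by
  intro T hT1 hT2
  by_contra hlt
  obtain ⟨T', hsub, hcard⟩ := Finset.exists_subset_card_eq (not_lt.1 hlt)
  have hle : H.deleteIncidenceSet v ≤ H := H.deleteIncidenceSet_le v
  have hvC : v ∉ T'.biUnion id := by
    intro h
    obtain ⟨t, ht, hvt⟩ := Finset.mem_biUnion.1 h
    have hcl := hT1 t (hsub ht)
    obtain ⟨w, hw, hwv⟩ := Finset.exists_mem_ne (s := t) (by rw [hcl.2]; norm_num) v
    have := hcl.1 (by simpa using hvt) (by simpa using hw) hwv.symm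
    rw [deleteIncidenceSet_adj] at this
    exact this.2.1 rfl
  have hC : #(T'.biUnion id) ≤ 3 * (m + 1) := by
    calc _ ≤ #T' * 3 := Finset.card_biUnion_le_card_mul _ _ _ (fun t ht => (hT1 t (hsub ht)).2.le)
      _ = _ := by rw [hcard]; ring
  obtain ⟨x, y, hvx, hvy, hxy, hx, hy⟩ := hv _ hC hvC
  have hcl : H.IsNClique 3 {v, x, y} := is3Clique_triple_iff.2 ⟨hvx, hvy, hxy⟩
  have hdis : ∀ t ∈ T', Disjoint ({v, x, y} : Finset α) t := by
    intro t ht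
    rw [Finset.disjoint_left]
    intro a ha hat
    have : a ∈ T'.biUnion id := Finset.mem_biUnion.2 ⟨t, ht, hat⟩
    simp only [mem_insert, mem_singleton] at ha
    rcases ha with rfl | rfl | rfl <;> contradiction
  have hnot : ({v, x, y} : Finset α) ∉ T' := by
    intro h
    have := hdis _ h
    simp at this
  have := hT (insert {v, x, y} T') ?_ ?_
  · rw [card_insert_of_notMem hnot] at this
    omega
  · intro t ht
    rcases mem_insert.1 ht with rfl | ht
    · exact hcl
    · exact (hT1 t (hsub ht)).mono hle
  · intro s hs t ht hst
    rcases mem_insert.1 hs with rfl | hs <;> rcases mem_insert.1 ht with rfl | ht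
    · exact absurd rfl hst
    · exact hdis _ ht
    · exact (hdis _ hs).symm
    · exact hT2 s (hsub hs) t (hsub ht) hst

theorem upper (m : ℕ) : ∀ (H : SimpleGraph α) (W : Finset α) (c : α → Fin 4)
    (_ : ∀ u v, H.Adj u v → u ∈ W) (_ : ∀ u v, H.Adj u v → c u ≠ c v)
    (_ : TF H (m + 1))
    (_ : 9 * m ^ 2 + 1 ≤ psz W c 0) (_ : psz W c 0 ≤ psz W c 1) (_ : psz W c 1 ≤ psz W c 2)
    (_ : psz W c 2 ≤ psz W c 3),
    #H.edgeFinset ≤ tT m (psz W c 0) (psz W c 1) (psz W c 2) (psz W c 3) := by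
  induction m with
  | zero =>
    intro H W c hW hc hT h0 h1 h2 h3
    refine base_case H W c hW hc ?_ (by omega) h1 h2 h3
    intro x y z hxy hxz hyz
    have := hT {{x, y, z}} (by
      intro t ht; rw [mem_singleton.1 ht]; exact is3Clique_triple_iff.2 ⟨hxy, hxz, hyz⟩)
      (by simp)
    simp at this
  | succ m ih =>
    intro H W c hW hc hT h0 h1 h2 h3
    by_cases hh : ∀ v, ∃ C : Finset α, #C ≤ 3 * (m + 1) ∧ v ∉ C ∧
      ∀ x y, H.Adj v x → H.Adj v y → H.Adj x y → x ∈ C ∨ y ∈ C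
    · have := nonheavy H W c (m+1) hW hc hT hh (by omega) h1 h2 h3
      refine this.trans ?_
      unfold tT
      have hmin : 9 * (m+1)^2 ≤ min (psz W c 3) (psz W c 1 + psz W c 2) :=
        le_min (by omega) (by omega)
      nlinarith
    push Not at hh
    obtain ⟨v, hv⟩ := hh
    have hTF := heavy_TF H m hT v hv
    have hvW : v ∈ W := by
      obtain ⟨x, y, hx, -⟩ := hv ∅ (by simp) (by simp)
      exact hW _ _ hx
    -- relabel
    obtain ⟨c', hc', hsz, hmin⟩ : ∃ c' : α → Fin 4, (∀ u w, c u ≠ c w → c' u ≠ c' w) ∧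
        (∀ i, psz W c' i = psz W c i) ∧ ∀ l < c' v, psz W c l < psz W c (c' v) := by
      obtain ⟨j, hj, hjm⟩ := Finset.exists_min_image
        (Finset.univ.filter fun j => psz W c j = psz W c (c v)) id ⟨c v, by simp⟩
      simp only [mem_filter, mem_univ, true_and, id] at hj hjm
      have hmono : ∀ a b : Fin 4, a ≤ b → psz W c a ≤ psz W c b := by
        intro a b hab
        fin_cases a <;> fin_cases b <;> simp at hab ⊢ <;> omega
      refine ⟨fun u => Equiv.swap (c v) j (c u), ?_, ?_, ?_⟩
      · intro u w h h'
        exact h ((Equiv.swap (c v) j).injective h')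
      · intro i
        have : psz W (fun u => Equiv.swap (c v) j (c u)) i = psz W c (Equiv.swap (c v) j i) := by
          unfold psz; congr 1; ext u
          simp only [mem_filter, and_congr_right_iff]
          intro _
          rw [← Equiv.apply_eq_iff_eq (Equiv.swap (c v) j), Equiv.swap_apply_self]
        rw [this]
        rw [Equiv.swap_apply_def]
        split_ifs with h h'
        · rw [h]; exact hj
        · rw [h']; exact hj.symm
        · rfl
      · intro l hl
        simp only [Equiv.swap_apply_left] at hl ⊢
        refine lt_of_le_of_ne (hmono _ _ hl.le) fun h => ?_
        exact absurd (hjm l (h.trans hj)) (not_le.2 hl)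
    have herase : ∀ i, psz (W.erase v) c' i + (if c' v = i then 1 else 0) = psz W c' i := by
      intro i
      unfold psz
      rw [Finset.filter_erase]
      split_ifs with h
      · rw [Finset.card_erase_add_one]; simp [hvW, h]
      · rw [Finset.erase_eq_of_notMem]; · rfl
        simp [h]
    have hdeg : H.degree v + psz W c' (c' v) ≤ psz W c' 0 + psz W c' 1 + psz W c' 2 + psz W c' 3 := by
      have e1 : #W = psz W c' 0 + psz W c' 1 + psz W c' 2 + psz W c' 3 := by
        rw [Finset.card_eq_sum_card_fiberwise (f := c') (t := Finset.univ) (by simp),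
          Fin.sum_univ_four]; rfl
      rw [← e1, ← card_neighborFinset_eq_degree]
      unfold psz
      rw [← Finset.card_union_of_disjoint]
      · apply Finset.card_le_card
        intro u hu
        rcases mem_union.1 hu with h | h
        · exact hW _ _ ((H.mem_neighborFinset v u).1 h).symm
        · exact (mem_filter.1 h).1
      · rw [Finset.disjoint_left]
        intro u hu hu'
        exact hc' _ _ (hc _ _ ((H.mem_neighborFinset v u).1 hu)) (mem_filter.1 hu').2.symm
    have hedge : #H.edgeFinset ≤ #(H.deleteIncidenceSet v).edgeFinset + H.degree v := by
      have := H.card_edgeFinset_deleteIncidenceSet v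
      omega
    have hih := ih (H.deleteIncidenceSet v) (W.erase v) c' 
      (by
        intro u w h
        rw [deleteIncidenceSet_adj] at h
        exact Finset.mem_erase.2 ⟨h.2.1, hW _ _ h.1⟩)
      (by
        intro u w h
        exact hc' _ _ (hc _ _ (H.deleteIncidenceSet_le v h))) hTF
    simp only [← hsz] at hmin h0 h1 h2 h3 ⊢
    have g0 := herase 0
    have g1 := herase 1
    have g2 := herase 2
    have g3 := herase 3
    have hN : 9 * m ^ 2 + 1 ≤ 9 * (m + 1)^2 := by ring_nf; omega
    have m0 := hmin 0
    have m1 := hmin 1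
    have m2 := hmin 2
    clear hmin herase ih hsz hTF hv hc' hc hW hT
    have hih2 : 9 * m ^ 2 + 1 ≤ psz (W.erase v) c' 0 →
      psz (W.erase v) c' 0 ≤ psz (W.erase v) c' 1 →
      psz (W.erase v) c' 1 ≤ psz (W.erase v) c' 2 →
      psz (W.erase v) c' 2 ≤ psz (W.erase v) c' 3 → #H.edgeFinset ≤
        tT m (psz (W.erase v) c' 0) (psz (W.erase v) c' 1) (psz (W.erase v) c' 2)
          (psz (W.erase v) c' 3) + H.degree v := by
      intro a b c d
      refine hedge.trans (Nat.add_le_add_right ?_ _)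
      convert hih a b c d
    clear hih hedge
    generalize c' v = j at *
    generalize psz (W.erase v) c' 0 = p0 at *
    generalize psz (W.erase v) c' 1 = p1 at *
    generalize psz (W.erase v) c' 2 = p2 at *
    generalize psz (W.erase v) c' 3 = p3 at *
    generalize 9 * m ^ 2 = K at *
    generalize 9 * (m + 1) ^ 2 = K' at *
    generalize H.degree v = dg at *
    generalize #H.edgeFinset = E at *
    rcases (by clear * -; fin_cases j <;> simp : j = 0 ∨ j = 1 ∨ j = 2 ∨ j = 3) with rfl | rfl | rfl | rfl
    · simp at g0 g1 g2 g3
      rw [← g0, ← g1, ← g2, ← g3]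
      refine (hih2 (by omega) (by omega) (by omega) (by omega)).trans ?_
      refine le_trans ?_ (tT_step0 _ _ _ _ _); omega
    · simp at g0 g1 g2 g3 m0
      rw [← g0, ← g1, ← g2, ← g3]
      refine (hih2 (by omega) (by omega) (by omega) (by omega)).trans ?_
      refine le_trans ?_ (tT_step1 _ _ _ _ _ (by omega) (by omega) (by omega)); omega
    · simp at g0 g1 g2 g3 m0 m1
      rw [← g0, ← g1, ← g2, ← g3]
      refine (hih2 (by omega) (by omega) (by omega) (by omega)).trans ?_
      refine le_trans ?_ (tT_step2 _ _ _ _ _ (by omega) (by omega) (by omega)); omega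
    · simp at g0 g1 g2 g3 m0 m1 m2
      rw [← g0, ← g1, ← g2, ← g3]
      refine (hih2 (by omega) (by omega) (by omega) (by omega)).trans ?_
      refine le_trans ?_ (tT_step3 _ _ _ _ _ (by omega) (by omega) (by omega)); omega

theorem TF_of_not_copy (H : SimpleGraph α) (k : ℕ) (h : ¬ HasCopy H (kCliques k 3)) : TF H k := by
  intro T hT1 hT2
  by_contra hlt
  obtain ⟨T', hsub, hcard⟩ := Finset.exists_subset_card_eq (not_lt.1 hlt)
  apply h
  let e := (Finset.equivFinOfCardEq hcard).symm
  have hcl : ∀ i, H.IsNClique 3 (e i).1 := fun i => hT1 _ (hsub (e i).2)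
  let g : ∀ i, Fin 3 ≃ (e i).1 := fun i => (Finset.equivFinOfCardEq (hcl i).2).symm
  refine ⟨fun p => (g p.1 p.2).1, ?_, ?_⟩
  · rintro ⟨i, a⟩ ⟨j, b⟩ hij
    simp only at hij
    have hij' : i = j := by
      by_contra hne
      have hne' : (e i).1 ≠ (e j).1 := fun h => hne (e.injective (Subtype.ext h))
      have := hT2 _ (hsub (e i).2) _ (hsub (e j).2) hne'
      exact Finset.disjoint_left.1 this (g i a).2 (hij ▸ (g j b).2)
    subst hij'
    have := (g i).injective (Subtype.ext hij)
    rw [this]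
  · rintro ⟨i, a⟩ ⟨j, b⟩ hij
    simp only [kCliques, fromRel_adj] at hij
    obtain ⟨hne, hij⟩ := hij
    have hij' : i = j := by rcases hij with h | h; exacts [h, h.symm]
    subst hij'
    apply (hcl i).1 (g i a).2 (g i b).2
    intro hh
    apply hne
    rw [(g i).injective (Subtype.ext hh)]

theorem sum_part (n : Fin 4 → ℕ) (i : Fin 4) (f : (Σ i : Fin 4, Fin (n i)) → ℕ) :
    ∑ x ∈ (Finset.univ : Finset (Σ i : Fin 4, Fin (n i))) with x.1 = i, f x
      = ∑ y : Fin (n i), f ⟨i, y⟩ := by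
  rw [Finset.sum_filter, Fintype.sum_sigma, Finset.sum_eq_single i]
  · simp
  · intro j _ hj; simp [hj]
  · simp

theorem psz_part (n : Fin 4 → ℕ) (i : Fin 4) :
    psz (Finset.univ : Finset (Σ i : Fin 4, Fin (n i))) Sigma.fst i = n i := by
  have := sum_part n i (fun _ => 1)
  simpa [psz] using this

theorem sum_sp (a b m : ℕ) (hm : m ≤ a) (P : Prop) :
    ∑ x : Fin a, ∑ _y : Fin b, (if P ∨ x.1 < m then 1 else 0) = if P then a * b else m * b := by
  by_cases hP : P
  · simp [hP]
  · simp only [hP, false_or, if_false, Finset.sum_const, Finset.card_univ, Fintype.card_fin,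
      smul_eq_mul, ← Finset.mul_sum]
    rw [Fin.sum_univ_eq_sum_range (fun x => if x < m then 1 else 0) a, ← Finset.card_filter]
    have : (Finset.range a).filter (fun x => x < m) = Finset.range m := by
      ext x; simp; omega
    rw [this, Finset.card_range, mul_comm]

def cH (n : Fin 4 → ℕ) (m : ℕ) (χ : Fin 4 → Bool) : SimpleGraph (Σ i : Fin 4, Fin (n i)) where
  Adj p q := p.1 ≠ q.1 ∧ (χ p.1 ≠ χ q.1 ∨ (p.1 = 0 ∧ p.2.1 < m) ∨ (q.1 = 0 ∧ q.2.1 < m))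
  symm := ⟨fun p q h => ⟨h.1.symm, by rcases h.2 with h | h | h; exacts [Or.inl h.symm, Or.inr (Or.inr h), Or.inr (Or.inl h)]⟩⟩
  loopless := ⟨fun p h => h.1 rfl⟩

theorem cH_free (n : Fin 4 → ℕ) (m : ℕ) (χ : Fin 4 → Bool) :
    ¬ HasCopy (cH n m χ) (kCliques (m + 1) 3) := by
  rintro ⟨f, hf, hadj⟩
  have hsp : ∀ i : Fin (m + 1), ∃ a : Fin 3, (f (i, a)).1 = 0 ∧ (f (i, a)).2.1 < m := by
    intro i
    by_contra hno
    push Not at hno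
    have hA : ∀ a b : Fin 3, a ≠ b → χ (f (i, a)).1 ≠ χ (f (i, b)).1 := by
      intro a b hab
      have : (cH n m χ).Adj (f (i, a)) (f (i, b)) := hadj (by
        simp [kCliques, hab])
      rcases this.2 with h | h | h
      · exact h
      · exact absurd h.2 (not_lt.2 (hno a h.1))
      · exact absurd h.2 (not_lt.2 (hno b h.1))
    have a1 := hA 0 1 (by simp)
    have a2 := hA 0 2 (by simp)
    have a3 := hA 1 2 (by simp)
    revert a1 a2 a3
    cases χ (f (i, 0)).1 <;> cases χ (f (i, 1)).1 <;> cases χ (f (i, 2)).1 <;> simp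
  choose a h0 hlt using hsp
  have hinj : Function.Injective (fun i : Fin (m + 1) => (⟨(f (i, a i)).2.1, hlt i⟩ : Fin m)) := by
    intro i j hij
    simp only [Fin.mk.injEq] at hij
    have : f (i, a i) = f (j, a j) := by
      have e1 := h0 i
      have e2 := h0 j
      generalize f (i, a i) = p at *
      generalize f (j, a j) = q at *
      obtain ⟨p1, p2⟩ := p
      obtain ⟨q1, q2⟩ := q
      simp only at e1 e2
      subst e1; subst e2
      have : p2 = q2 := Fin.ext hij
      rw [this]
    exact (Prod.mk.inj (hf this)).1
  have := Fintype.card_le_of_injective _ hinj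
  simp at this

theorem cH_edges (n : Fin 4 → ℕ) (m : ℕ) (χ : Fin 4 → Bool) (hm : m ≤ n 0) :
    (cH n m χ).edgeSet.ncard = (if χ 0 ≠ χ 1 then n 0 * n 1 else m * n 1)
     + (if χ 0 ≠ χ 2 then n 0 * n 2 else m * n 2) + (if χ 0 ≠ χ 3 then n 0 * n 3 else m * n 3)
     + (if χ 1 ≠ χ 2 then n 1 * n 2 else 0) + (if χ 1 ≠ χ 3 then n 1 * n 3 else 0)
     + (if χ 2 ≠ χ 3 then n 2 * n 3 else 0) := by
  rw [Set.ncard_eq_toFinset_card']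
  have := sum_edges (cH n m χ) Finset.univ Sigma.fst (by simp) (fun u v h => h.1)
  unfold SimpleGraph.edgeFinset at this
  rw [this]
  simp only [sum_part]
  have h0 : ∀ j : Fin 4, j ≠ 0 → ∑ x : Fin (n 0), ∑ y : Fin (n j),
      (if (cH n m χ).Adj ⟨0, x⟩ ⟨j, y⟩ then 1 else 0) =
      if χ 0 ≠ χ j then n 0 * n j else m * n j := by
    intro j hj
    refine Eq.trans ?_ ((sum_sp (n 0) (n j) m hm (χ 0 ≠ χ j)).trans ?_)
    swap
    · congr
    refine Finset.sum_congr rfl fun x _ => Finset.sum_congr rfl fun y _ => ?_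
    congr 1
    simp [cH, hj, hj.symm]
  have h1 : ∀ i j : Fin 4, i ≠ 0 → j ≠ 0 → i ≠ j → ∑ x : Fin (n i), ∑ y : Fin (n j),
      (if (cH n m χ).Adj ⟨i, x⟩ ⟨j, y⟩ then 1 else 0) =
      if χ i ≠ χ j then n i * n j else 0 := by
    intro i j hi hj hij
    simp only [cH, hi, hj]
    by_cases h : χ i = χ j <;> simp [h, hij]
  rw [h0 1 (by simp), h0 2 (by simp), h0 3 (by simp), h1 1 2 (by simp) (by simp) (by simp),
    h1 1 3 (by simp) (by simp) (by simp), h1 2 3 (by simp) (by simp) (by simp)]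

theorem ex_eq (n : Fin 4 → ℕ) (m : ℕ) (χ : Fin 4 → Bool) (h0 : 9 * m ^ 2 + 1 ≤ n 0)
    (h1 : n 0 ≤ n 1) (h2 : n 1 ≤ n 2) (h3 : n 2 ≤ n 3)
    (hχ : (cH n m χ).edgeSet.ncard = tT m (n 0) (n 1) (n 2) (n 3)) :
    exNum (completeMultipartite n) (kCliques (m + 1) 3) = tT m (n 0) (n 1) (n 2) (n 3) := by
  unfold exNum
  apply IsGreatest.csSup_eq
  constructor
  · refine ⟨cH n m χ, ?_, cH_free n m χ, hχ.symm⟩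
    intro p q h
    exact h.1
  · rintro e ⟨H, hle, hfree, rfl⟩
    have := upper m H Finset.univ Sigma.fst (by simp) (fun u v h => hle h)
      (TF_of_not_copy H _ hfree)
    simp only [psz_part] at this
    rw [Set.ncard_eq_toFinset_card']
    exact this h0 h1 h2 h3

end HZ

/-- Han–Zhao: for every `k ≥ 1` there is `N` such that for all
`N ≤ n_1 ≤ n_2 ≤ n_3 ≤ n_4`, `ex(K_{n_1,n_2,n_3,n_4}, kK_3)` equals
`n_4(n_1+n_2+n_3) + (k−1)(n_2+n_3)` if `n_4 > n_2+n_3` and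
`(n_1+n_4)(n_2+n_3) + (k−1)n_4` if `n_4 ≤ n_2+n_3`. -/
theorem stmt_3 (k : ℕ) (hk : 1 ≤ k) :
    ∃ N : ℕ, ∀ n1 n2 n3 n4 : ℕ, N ≤ n1 → n1 ≤ n2 → n2 ≤ n3 → n3 ≤ n4 →
      (n2 + n3 < n4 →
        exNum (completeMultipartite ![n1, n2, n3, n4]) (kCliques k 3) =
          n4 * (n1 + n2 + n3) + (k - 1) * (n2 + n3)) ∧
      (n4 ≤ n2 + n3 →
        exNum (completeMultipartite ![n1, n2, n3, n4]) (kCliques k 3) =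
          (n1 + n4) * (n2 + n3) + (k - 1) * n4) := by
  obtain ⟨m, rfl⟩ : ∃ m, k = m + 1 := ⟨k - 1, by omega⟩
  refine ⟨9 * m ^ 2 + 1, fun n1 n2 n3 n4 h0 h1 h2 h3 => ⟨fun h => ?_, fun h => ?_⟩⟩
  all_goals have hm : m ≤ n1 := by nlinarith
  · refine (ex_eq ![n1, n2, n3, n4] m ![false, false, false, true] h0 h1 h2 h3 ?_).trans ?_
    · rw [cH_edges _ _ _ hm]
      simp [tT, max_eq_left h.le, min_eq_right h.le]
      ring
    · simp [tT, max_eq_left h.le, min_eq_right h.le]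
      ring
  · refine (ex_eq ![n1, n2, n3, n4] m ![false, true, true, false] h0 h1 h2 h3 ?_).trans ?_
    · rw [cH_edges _ _ _ hm]
      simp [tT, max_eq_right h, min_eq_left h]
      ring
    · simp [tT, max_eq_right h, min_eq_left h]
      ring
end

section
/- Let k ≥ 1 and r, n_1, n_2, ..., n_r be integers with r ≥ 4, 10k−4 ≤ n_1 + 4k, n_1 + 4k ≤ n_i for every i with 2 ≤ i ≤ r, and n = Σ_{i=1}^r n_i. Then ex(K_{n_1,...,n_r}, kK_3) = (k−1)(n − n_1) + f_3(n_1−(k−1), n_2, ..., n_r). -/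
open SimpleGraph Finset

namespace TriPack

set_option linter.unusedSectionVars false

section arith
variable {ι : Type*} [Fintype ι] [DecidableEq ι]

def FF (x : ι → ℤ) (z : ι) (m : ℤ) (A : Finset ι) : ℤ :=
  (x z + ∑ i ∈ A, x i) * (∑ i ∈ (univ.erase z) \ A, x i) + m * ∑ i ∈ A, x i

lemma FF_opt (x : ι → ℤ) (z : ι) (m : ℤ) (A0 : Finset ι) (hA0 : A0 ⊆ univ.erase z)
    (hm0 : 0 ≤ m) (hm : m < x z) (hx : ∀ i, i ≠ z → x z < x i) :
    ∃ A ⊆ univ.erase z, FF x z m A0 ≤ FF x z m A ∧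
      ∑ i ∈ A, x i ≤ ∑ i ∈ (univ.erase z) \ A, x i ∧
      ∀ i ∈ (univ.erase z) \ A, ∑ j ∈ (univ.erase z) \ A, x j ≤ ∑ j ∈ A, x j + x i := by
  obtain ⟨A, hA, hmax⟩ := Finset.exists_max_image (univ.erase z).powerset (FF x z m)
    ⟨A0, by simpa using hA0⟩
  have hA' : A ⊆ univ.erase z := by simpa using hA
  refine ⟨A, hA', hmax A0 (by simpa using hA0), ?_, ?_⟩
  · have h := hmax (univ.erase z \ A) (by simp)
    unfold FF at h
    rw [Finset.sdiff_sdiff_eq_self hA'] at h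
    by_contra hc
    push Not at hc
    nlinarith [mul_pos (sub_pos.2 hm) (sub_pos.2 hc)]
  · intro i hi
    set B := univ.erase z \ A with hB
    have hiz : i ≠ z := by simp [hB] at hi; tauto
    have hiA : i ∉ A := by simp [hB] at hi; tauto
    have h := hmax (B.erase i) (by
      simp only [Finset.mem_powerset]
      exact (Finset.erase_subset _ _).trans Finset.sdiff_subset)
    unfold FF at h
    have e1 : univ.erase z \ B.erase i = insert i A := by
      ext j
      have := @hA' j
      by_cases hj : j = i <;> by_cases hj2 : j = z <;> by_cases hj3 : j ∈ A <;>
        simp_all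
    rw [e1, Finset.sum_insert hiA, ← hB] at h
    have e2 : ∑ j ∈ B.erase i, x j = ∑ j ∈ B, x j - x i := by
      rw [← Finset.sum_erase_add _ _ hi]; ring
    rw [e2] at h
    by_contra hc
    push Not at hc
    have := hx i hiz
    have h3 : 0 < x i - x z + m := by linarith
    have h4 : 0 < ∑ j ∈ B, x j - (∑ j ∈ A, x j + x i) := by linarith
    nlinarith [mul_pos h3 h4]

lemma sum_single (A : Finset ι) (p : ι) :
    ∑ i ∈ A, (if i = p then (1:ℤ) else 0) = if p ∈ A then 1 else 0 := by
  simp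

/-- vertex deletion arithmetic -/
lemma vertex_arith (x : ι → ℤ) (z p : ι) (m : ℤ) (A : Finset ι) (hA : A ⊆ univ.erase z)
    (hm0 : 0 ≤ m) (hx : ∀ i, i ≠ z → x z < x i)
    (x' : ι → ℤ) (hx' : ∀ i, x i = x' i + (if i = p then 1 else 0))
    (O2 : ∀ i ∈ (univ.erase z) \ A, ∑ j ∈ (univ.erase z) \ A, x' j ≤ ∑ j ∈ A, x' j + x' i) :
    FF x' z m A + (∑ i, x i - x p) ≤ FF x z (m+1) A := by
  have hzA : z ∉ A := fun h => by simpa using hA h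
  set B := univ.erase z \ A with hB
  have hzB : z ∉ B := by simp [hB]
  have htot : ∑ i, x i = x z + ∑ i ∈ A, x i + ∑ i ∈ B, x i := by
    rw [← Finset.add_sum_erase univ x (Finset.mem_univ z), ← Finset.sum_sdiff hA]; ring
  have hsA : ∑ i ∈ A, x i = ∑ i ∈ A, x' i + if p ∈ A then 1 else 0 := by
    rw [← sum_single, ← Finset.sum_add_distrib]; exact Finset.sum_congr rfl fun i _ => hx' i
  have hsB : ∑ i ∈ B, x i = ∑ i ∈ B, x' i + if p ∈ B then 1 else 0 := by
    rw [← sum_single, ← Finset.sum_add_distrib]; exact Finset.sum_congr rfl fun i _ => hx' i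
  have hz := hx' z
  unfold FF
  rw [htot, ← hB]
  set a := ∑ i ∈ A, x i
  set b := ∑ i ∈ B, x i
  have hp := hx' p
  by_cases hpz : p = z
  · subst hpz
    simp only [hzA, hzB, if_true, if_false] at *
    rw [show ∑ i ∈ A, x' i = a by linarith, show ∑ i ∈ B, x' i = b by linarith,
      show x' p = x p - 1 by linarith]
    linarith
  by_cases hpA : p ∈ A
  · have hpB : p ∉ B := by simp [hB, hpA]
    have := hx p hpz
    simp only [hpA, hpB, if_true, if_false, Ne.symm hpz] at *
    rw [show ∑ i ∈ A, x' i = a - 1 by linarith, show ∑ i ∈ B, x' i = b by linarith,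
      show x' z = x z by linarith]
    nlinarith
  · have hpB : p ∈ B := by simp [hB, hpA, hpz]
    have := O2 p hpB
    simp only [hpA, hpB, if_true, if_false, Ne.symm hpz] at *
    have hb1 : ∑ i ∈ B, x' i = b - 1 := by linarith
    have ha1 : ∑ i ∈ A, x' i = a := by linarith
    have hz1 : x' z = x z := by linarith
    rw [hb1, ha1] at this
    rw [hb1, ha1, hz1]
    linarith

lemma sum_three_le (x : ι → ℤ) (hx : ∀ i, 0 ≤ x i) (A : Finset ι) {p q s : ι} (hpq : p ≠ q)
    (hps : p ≠ s) (hqs : q ≠ s) :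
    (if p ∈ A then x p else 0) + (if q ∈ A then x q else 0) + (if s ∈ A then x s else 0)
      ≤ ∑ i ∈ A, x i := by
  have h1 : ∑ i ∈ ({p, q, s} : Finset ι).filter (· ∈ A), x i ≤ ∑ i ∈ A, x i := by
    apply Finset.sum_le_sum_of_subset_of_nonneg
    · intro i hi; simp at hi; tauto
    · intros; exact hx _
  rw [Finset.sum_filter, Finset.sum_insert (by simp [hpq, hps]),
    Finset.sum_insert (by simp [hqs]), Finset.sum_singleton] at h1
  linarith

lemma tri_core (n1 a b m np nq ns zp ap bp zq aq bq zs as bs : ℤ) (hm0 : 0 ≤ m)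
    (h1 : 6 * m + 8 ≤ n1) (hab : 3 * (n1 + 4 * m + 8) ≤ a + b)
    (hz : zp + zq + zs ≤ 1)
    (O1 : a - (ap + aq + as) ≤ b - (bp + bq + bs))
    (hlA : ap * np + aq * nq + as * ns ≤ a) (hlB : bp * np + bq * nq + bs * ns ≤ b)
    (Hp : (zp = 1 ∧ ap = 0 ∧ bp = 0 ∧ np = n1) ∨
      (zp = 0 ∧ ap = 1 ∧ bp = 0 ∧ n1 + 4 * m + 8 ≤ np) ∨
      (zp = 0 ∧ ap = 0 ∧ bp = 1 ∧ n1 + 4 * m + 8 ≤ np ∧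
        b - (bp + bq + bs) ≤ a - (ap + aq + as) + (np - 1)))
    (Hq : (zq = 1 ∧ aq = 0 ∧ bq = 0 ∧ nq = n1) ∨
      (zq = 0 ∧ aq = 1 ∧ bq = 0 ∧ n1 + 4 * m + 8 ≤ nq) ∨
      (zq = 0 ∧ aq = 0 ∧ bq = 1 ∧ n1 + 4 * m + 8 ≤ nq ∧
        b - (bp + bq + bs) ≤ a - (ap + aq + as) + (nq - 1)))
    (Hs : (zs = 1 ∧ as = 0 ∧ bs = 0 ∧ ns = n1) ∨
      (zs = 0 ∧ as = 1 ∧ bs = 0 ∧ n1 + 4 * m + 8 ≤ ns) ∨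
      (zs = 0 ∧ as = 0 ∧ bs = 1 ∧ n1 + 4 * m + 8 ≤ ns ∧
        b - (bp + bq + bs) ≤ a - (ap + aq + as) + (ns - 1))) :
    ((n1 - (zp + zq + zs)) + (a - (ap + aq + as))) * (b - (bp + bq + bs))
      + m * (a - (ap + aq + as)) + (n1 + a + b + 18 * (m + 1)) - 3
      ≤ (n1 + a) * b + (m + 1) * a ∧
    ((n1 - (zp + zq + zs)) + (a - (ap + aq + as))) * (b - (bp + bq + bs))
      + m * (a - (ap + aq + as)) + (2 * (n1 + a + b) - np - nq + 6 * (m + 1)) - 3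
      ≤ (n1 + a) * b + (m + 1) * a := by
  rcases Hp with ⟨rfl, rfl, rfl, hp⟩ | ⟨rfl, rfl, rfl, hp⟩ | ⟨rfl, rfl, rfl, hp, hp'⟩ <;>
  rcases Hq with ⟨rfl, rfl, rfl, hq⟩ | ⟨rfl, rfl, rfl, hq⟩ | ⟨rfl, rfl, rfl, hq, hq'⟩ <;>
  rcases Hs with ⟨rfl, rfl, rfl, hs⟩ | ⟨rfl, rfl, rfl, hs⟩ | ⟨rfl, rfl, rfl, hs, hs'⟩ <;>
  first
  | (exfalso; linarith)
  | (constructor <;> linarith)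

lemma tri_arith (x : ι → ℤ) (z p q s : ι) (hpq : p ≠ q) (hps : p ≠ s) (hqs : q ≠ s)
    (m : ℤ) (A : Finset ι) (hA : A ⊆ univ.erase z) (hc : 4 ≤ Fintype.card ι)
    (hm0 : 0 ≤ m) (h1 : 6 * m + 8 ≤ x z) (h2 : ∀ i, i ≠ z → x z + 4 * m + 8 ≤ x i)
    (x' : ι → ℤ) (hx' : ∀ i, x i = x' i + (if i = p then 1 else 0) + (if i = q then 1 else 0)
      + (if i = s then 1 else 0))
    (O1 : ∑ i ∈ A, x' i ≤ ∑ i ∈ (univ.erase z) \ A, x' i)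
    (O2 : ∀ i ∈ (univ.erase z) \ A, ∑ j ∈ (univ.erase z) \ A, x' j ≤ ∑ j ∈ A, x' j + x' i) :
    FF x' z m A + (∑ i, x i + 18 * (m + 1)) - 3 ≤ FF x z (m+1) A ∧
    FF x' z m A + (2 * ∑ i, x i - x p - x q + 6 * (m + 1)) - 3 ≤ FF x z (m+1) A := by
  have hzA : z ∉ A := fun h => by simpa using hA h
  set B := univ.erase z \ A with hB
  have hzB : z ∉ B := by simp [hB]
  have htot : ∑ i, x i = x z + ∑ i ∈ A, x i + ∑ i ∈ B, x i := by
    rw [← Finset.add_sum_erase univ x (Finset.mem_univ z), ← Finset.sum_sdiff hA]; ring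
  have hab : 3 * (x z + 4 * m + 8) ≤ ∑ i ∈ A, x i + ∑ i ∈ B, x i := by
    have e : ∑ i ∈ A, x i + ∑ i ∈ B, x i = ∑ i ∈ univ.erase z, x i := by
      rw [← Finset.sum_sdiff hA]; ring
    rw [e]
    have h := Finset.card_nsmul_le_sum (univ.erase z) x (x z + 4 * m + 8)
      (fun i hi => h2 i (by simpa using hi))
    have hcard : 3 ≤ (univ.erase z).card := by
      rw [Finset.card_erase_of_mem (Finset.mem_univ z), Finset.card_univ]; omega
    have hcard' : (3:ℤ) ≤ ((univ.erase z).card : ℤ) := by exact_mod_cast hcard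
    rw [nsmul_eq_mul] at h
    nlinarith
  have hS : ∀ C : Finset ι, ∑ i ∈ C, x i = ∑ i ∈ C, x' i + (if p ∈ C then 1 else 0)
      + (if q ∈ C then 1 else 0) + (if s ∈ C then 1 else 0) := by
    intro C
    rw [← sum_single, ← sum_single, ← sum_single, ← Finset.sum_add_distrib,
      ← Finset.sum_add_distrib, ← Finset.sum_add_distrib]
    exact Finset.sum_congr rfl fun i _ => hx' i
  have hsA := hS A
  have hsB := hS B
  have hz := hx' z
  have hnn : ∀ i, 0 ≤ x i := by
    intro i
    by_cases hi : i = z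
    · subst hi; linarith
    · linarith [h2 i hi]
  have hlA := sum_three_le x hnn A hpq hps hqs
  have hlB := sum_three_le x hnn B hpq hps hqs
  have memB : ∀ i, i ∈ B ↔ i ≠ z ∧ i ∉ A := by intro i; simp [hB]
  have key : ∀ i, x i = x' i + 1 → 
      ((if z = i then (1:ℤ) else 0) = 1 ∧ (if i ∈ A then (1:ℤ) else 0) = 0 ∧
        (if i ∈ B then (1:ℤ) else 0) = 0 ∧ x i = x z) ∨
      ((if z = i then (1:ℤ) else 0) = 0 ∧ (if i ∈ A then (1:ℤ) else 0) = 1 ∧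
        (if i ∈ B then (1:ℤ) else 0) = 0 ∧ x z + 4 * m + 8 ≤ x i) ∨
      ((if z = i then (1:ℤ) else 0) = 0 ∧ (if i ∈ A then (1:ℤ) else 0) = 0 ∧
        (if i ∈ B then (1:ℤ) else 0) = 1 ∧ x z + 4 * m + 8 ≤ x i ∧
        ∑ j ∈ B, x' j ≤ ∑ j ∈ A, x' j + (x i - 1)) := by
    intro i hi
    by_cases hiz : z = i
    · left; subst hiz; simp [hzA, hzB]
    by_cases hiA : i ∈ A
    · right; left
      refine ⟨by simp [hiz], by simp [hiA], by simp [memB, hiA], h2 i (Ne.symm hiz)⟩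
    · right; right
      have hiB : i ∈ B := (memB i).2 ⟨Ne.symm hiz, hiA⟩
      refine ⟨by simp [hiz], by simp [hiA], by simp [hiB], h2 i (Ne.symm hiz), ?_⟩
      have := O2 i hiB
      linarith
  have hp := key p (by rw [hx' p]; simp [hpq, hps])
  have hq := key q (by rw [hx' q]; simp [hpq.symm, hqs])
  have hs := key s (by rw [hx' s]; simp [hps.symm, hqs.symm])
  have hzz : (if z = p then (1:ℤ) else 0) + (if z = q then 1 else 0) + (if z = s then 1 else 0)
      ≤ 1 := by
    split_ifs <;> simp_all
  have ea : ∑ i ∈ A, x' i = ∑ i ∈ A, x i - ((if p ∈ A then 1 else 0)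
      + (if q ∈ A then 1 else 0) + (if s ∈ A then 1 else 0)) := by linarith
  have eb : ∑ i ∈ B, x' i = ∑ i ∈ B, x i - ((if p ∈ B then 1 else 0)
      + (if q ∈ B then 1 else 0) + (if s ∈ B then 1 else 0)) := by linarith
  have ez : x' z = x z - ((if z = p then (1:ℤ) else 0) + (if z = q then 1 else 0)
      + (if z = s then 1 else 0)) := by linarith
  rw [ea, eb] at hp hq hs O1
  unfold FF
  rw [htot, ← hB, ea, eb, ez]
  refine tri_core (x z) _ _ m (x p) (x q) (x s) _ _ _ _ _ _ _ _ _ hm0 h1 hab hzz O1 ?_ ?_ hp hq hs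
  · simpa only [ite_mul, one_mul, zero_mul] using hlA
  · simpa only [ite_mul, one_mul, zero_mul] using hlB

end arith


section graph
variable {ι V : Type*} [Fintype ι] [DecidableEq ι] [Fintype V] [DecidableEq V]

open Classical in
noncomputable def dg (G : SimpleGraph V) (W : Finset V) (u : V) : ℕ := #(W.filter (G.Adj u))

noncomputable def EE (G : SimpleGraph V) (W : Finset V) : ℕ := ∑ u ∈ W, dg G W u

def sz (c : V → ι) (W : Finset V) (i : ι) : ℕ := #(W.filter (fun v => c v = i))

def HasK (G : SimpleGraph V) : ℕ → Finset V → Prop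
  | 0, _ => True
  | k + 1, W => ∃ x ∈ W, ∃ y ∈ W, ∃ w ∈ W, G.Adj x y ∧ G.Adj x w ∧ G.Adj y w ∧
      HasK G k (((W.erase x).erase y).erase w)

lemma HasK_mono (G : SimpleGraph V) (k : ℕ) : ∀ {W W' : Finset V}, W ⊆ W' → HasK G k W →
    HasK G k W' := by
  induction k with
  | zero => intros; trivial
  | succ k ih =>
    rintro W W' h ⟨x, hx, y, hy, w, hw, h1, h2, h3, h4⟩
    exact ⟨x, h hx, y, h hy, w, h hw, h1, h2, h3, ih (by gcongr) h4⟩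

lemma HasK_support (G : SimpleGraph V) (k : ℕ) : ∀ {W : Finset V}, HasK G k W →
    ∃ S ⊆ W, #S = 3 * k ∧ HasK G k S := by
  induction k with
  | zero => intro W _; exact ⟨∅, by simp, by simp, trivial⟩
  | succ k ih =>
    rintro W ⟨x, hx, y, hy, w, hw, h1, h2, h3, h4⟩
    obtain ⟨S, hS, hc, hk⟩ := ih h4
    have hxS : x ∉ S := fun h => by simpa using hS h
    have hyS : y ∉ S := fun h => by simpa using hS h
    have hwS : w ∉ S := fun h => by simpa using hS h
    have hSW : S ⊆ W := fun v hv => by have := hS hv; simp at this; tauto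
    refine ⟨insert x (insert y (insert w S)), ?_, ?_, ?_⟩
    · intro v hv
      simp only [Finset.mem_insert] at hv
      rcases hv with rfl | rfl | rfl | hv
      · exact hx
      · exact hy
      · exact hw
      · exact hSW hv
    · rw [Finset.card_insert_of_notMem, Finset.card_insert_of_notMem,
        Finset.card_insert_of_notMem hwS, hc]
      · ring
      · simp [h3.ne, hyS]
      · simp [h1.ne, h2.ne, hxS]
    · refine ⟨x, by simp, y, by simp, w, by simp, h1, h2, h3, HasK_mono G k ?_ hk⟩
      intro v hv
      have := hS hv
      simp at this ⊢
      tauto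

lemma HasK_succ_of (G : SimpleGraph V) (k : ℕ) {W S : Finset V} {x y w : V} (hS : S ⊆ W)
    (hk : HasK G k S) (hx : x ∈ W) (hy : y ∈ W) (hw : w ∈ W) (hx' : x ∉ S) (hy' : y ∉ S)
    (hw' : w ∉ S) (h1 : G.Adj x y) (h2 : G.Adj x w) (h3 : G.Adj y w) : HasK G (k+1) W := by
  refine ⟨x, hx, y, hy, w, hw, h1, h2, h3, HasK_mono G k ?_ hk⟩
  intro v hv
  have h1 := hS hv
  have : v ≠ x := fun h => hx' (h ▸ hv)
  have : v ≠ y := fun h => hy' (h ▸ hv)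
  have : v ≠ w := fun h => hw' (h ▸ hv)
  simp; tauto

lemma dg_erase (G : SimpleGraph V) (W : Finset V) (u v : V) (hv : v ∈ W) :
    dg G W u = dg G (W.erase v) u + (by classical exact if G.Adj u v then 1 else 0) := by
  classical
  unfold dg
  rw [Finset.filter_erase]
  by_cases h : G.Adj u v
  · rw [if_pos h, Finset.card_erase_add_one]; simp [hv, h]
  · rw [if_neg h, Finset.erase_eq_of_notMem (by simp [h])]; rfl

lemma EE_erase (G : SimpleGraph V) (W : Finset V) (v : V) (hv : v ∈ W) :
    EE G W = EE G (W.erase v) + 2 * dg G W v := by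
  classical
  unfold EE
  rw [← Finset.sum_erase_add _ _ hv]
  have : ∑ u ∈ W.erase v, dg G W u = ∑ u ∈ W.erase v, dg G (W.erase v) u + dg G W v := by
    rw [Finset.sum_congr rfl fun u _ => dg_erase G W u v hv, Finset.sum_add_distrib]
    congr 1
    rw [dg_erase G W v v hv]
    simp only [SimpleGraph.irrefl, if_false, add_zero]
    unfold dg
    rw [Finset.card_filter]
    refine Finset.sum_congr rfl fun u _ => ?_
    simp [G.adj_comm]
  omega

lemma EE_tri (G : SimpleGraph V) (W : Finset V) (x y w : V) (hx : x ∈ W) (hy : y ∈ W)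
    (hw : w ∈ W) (h1 : G.Adj x y) (h2 : G.Adj x w) (h3 : G.Adj y w) :
    EE G W + 6 = EE G (((W.erase x).erase y).erase w) + 2 * (dg G W x + dg G W y + dg G W w) := by
  classical
  have hy' : y ∈ W.erase x := by simp [hy, h1.ne']
  have hw' : w ∈ (W.erase x).erase y := by simp [hw, h2.ne', h3.ne']
  have a1 := EE_erase G W x hx
  have a2 := EE_erase G _ y hy'
  have a3 := EE_erase G _ w hw'
  have b1 := dg_erase G W y x hx
  have b2 := dg_erase G W w x hx
  have b3 := dg_erase G _ w y hy'
  rw [if_pos h1.symm] at b1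
  rw [if_pos h2.symm] at b2
  rw [if_pos h3.symm] at b3
  omega

lemma sz_erase (c : V → ι) (W : Finset V) (v : V) (hv : v ∈ W) (i : ι) :
    sz c W i = sz c (W.erase v) i + if i = c v then 1 else 0 := by
  unfold sz
  rw [Finset.filter_erase]
  by_cases h : i = c v
  · rw [if_pos h, Finset.card_erase_add_one]; simp [hv, h]
  · rw [if_neg h, Finset.erase_eq_of_notMem (by simp [Ne.symm h])]; rfl

lemma sz_sum (c : V → ι) (W : Finset V) : ∑ i, sz c W i = #W := by
  unfold sz
  exact (Finset.card_eq_sum_card_fiberwise (fun x _ => Finset.mem_univ (c x))).symm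

lemma dg_le (G : SimpleGraph V) (c : V → ι) (hc : ∀ u v, G.Adj u v → c u ≠ c v) (W : Finset V)
    (v : V) : dg G W v + sz c W (c v) ≤ #W := by
  classical
  unfold dg sz
  rw [← Finset.card_union_of_disjoint]
  · apply Finset.card_le_card
    intro u; simp; tauto
  · rw [Finset.disjoint_left]
    intro u; simp only [Finset.mem_filter]
    rintro ⟨_, h⟩ ⟨_, h'⟩
    exact hc _ _ h h'.symm

open Classical in
/-- the neighbourhood bound used for the second triangle -/
lemma second_tri (G : SimpleGraph V) (c : V → ι) (hc : ∀ u v, G.Adj u v → c u ≠ c v)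
    (W S1 S2 : Finset V) (K : ℕ) (hS1 : #S1 = K) (hS2 : #S2 = K) (v1 v2 w : V)
    (h12 : c v1 ≠ c v2)
    (hI1 : ∀ x ∈ W, ∀ y ∈ W, x ∉ S1 → y ∉ S1 → G.Adj v1 x → G.Adj v1 y → ¬ G.Adj x y)
    (hI2 : ∀ x ∈ W, ∀ y ∈ W, x ∉ S2 → y ∉ S2 → G.Adj v2 x → G.Adj v2 y → ¬ G.Adj x y)
    (hw : w ∈ W) (hw1 : w ∉ S1) (hw2 : w ∉ S2) (ha1 : G.Adj v1 w) (ha2 : G.Adj v2 w) :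
    dg G W v1 + dg G W v2 + dg G W w + sz c W (c v1) + sz c W (c v2) ≤ 2 * #W + 2 * K := by
  set I1 := W.filter (G.Adj v1) \ S1 with hI1d
  set I2 := W.filter (G.Adj v2) \ S2 with hI2d
  have d1 : dg G W v1 ≤ #I1 + K := by
    have : #(W.filter (G.Adj v1)) - #S1 ≤ #I1 := Finset.le_card_sdiff S1 (W.filter (G.Adj v1))
    unfold dg; omega
  have d2 : dg G W v2 ≤ #I2 + K := by
    have : #(W.filter (G.Adj v2)) - #S2 ≤ #I2 := Finset.le_card_sdiff S2 (W.filter (G.Adj v2))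
    unfold dg; omega
  have d3 : dg G W w + #(I1 ∪ I2) ≤ #W := by
    unfold dg
    rw [← Finset.card_union_of_disjoint]
    · apply Finset.card_le_card
      intro u; simp [hI1d, hI2d]; tauto
    · rw [Finset.disjoint_left]
      intro u hu hu'
      simp only [Finset.mem_filter] at hu
      simp only [hI1d, hI2d, Finset.mem_union, Finset.mem_sdiff, Finset.mem_filter] at hu'
      rcases hu' with ⟨⟨_, h⟩, h'⟩ | ⟨⟨_, h⟩, h'⟩
      · exact hI1 w hw u hu.1 hw1 h' ha1 h hu.2
      · exact hI2 w hw u hu.1 hw2 h' ha2 h hu.2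
  have d4 : #(I1 ∩ I2) + (sz c W (c v1) + sz c W (c v2)) ≤ #W := by
    unfold sz
    rw [← Finset.card_union_of_disjoint, ← Finset.card_union_of_disjoint]
    · apply Finset.card_le_card
      intro u; simp [hI1d, hI2d]; tauto
    · rw [Finset.disjoint_left]
      intro u hu hu'
      simp only [hI1d, hI2d, Finset.mem_inter, Finset.mem_union, Finset.mem_sdiff,
        Finset.mem_filter] at hu hu'
      rcases hu' with h | h
      · exact hc _ _ hu.1.1.2 h.2.symm
      · exact hc _ _ hu.2.1.2 h.2.symm
    · rw [Finset.disjoint_left]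
      intro u hu hu'
      simp only [Finset.mem_filter] at hu hu'
      exact h12 (hu.2.symm.trans hu'.2)
  have := Finset.card_union_add_card_inter I1 I2
  omega

open Classical in
lemma first_tri (G : SimpleGraph V) (W S1 S2 S3 : Finset V) (K : ℕ) (hS1 : #S1 = K)
    (hS2 : #S2 = K) (hS3 : #S3 = K) (v1 v2 v3 : V)
    (h12 : ∀ w ∈ W, G.Adj v1 w → G.Adj v2 w → w ∈ S1 ∪ S2)
    (h13 : ∀ w ∈ W, G.Adj v1 w → G.Adj v3 w → w ∈ S1 ∪ S3)
    (h23 : ∀ w ∈ W, G.Adj v2 w → G.Adj v3 w → w ∈ S2 ∪ S3) :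
    dg G W v1 + dg G W v2 + dg G W v3 ≤ #W + 6 * K := by
  have hU : #(S1 ∪ S2 ∪ S3) ≤ 3 * K := by
    have a := Finset.card_union_le (S1 ∪ S2) S3
    have b := Finset.card_union_le S1 S2
    omega
  have hW : #(W.filter (· ∈ S1 ∪ S2 ∪ S3)) ≤ 3 * K :=
    (Finset.card_le_card (by intro u; simp)).trans hU
  have : dg G W v1 + dg G W v2 + dg G W v3 ≤ ∑ w ∈ W, (1 + 2 * if w ∈ S1 ∪ S2 ∪ S3 then 1 else 0) := by
    unfold dg
    rw [Finset.card_filter, Finset.card_filter, Finset.card_filter, ← Finset.sum_add_distrib,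
      ← Finset.sum_add_distrib]
    refine Finset.sum_le_sum fun w hw => ?_
    have h12 := h12 w hw
    have h13 := h13 w hw
    have h23 := h23 w hw
    simp only [Finset.mem_union] at h12 h13 h23 ⊢
    clear hU hW
    by_cases a : G.Adj v1 w <;> by_cases b : G.Adj v2 w <;> by_cases d : G.Adj v3 w <;>
      by_cases e : (w ∈ S1 ∨ w ∈ S2) ∨ w ∈ S3 <;> simp [a, b, d] at h12 h13 h23 <;> simp [a, b, d, e] <;> tauto
  rw [Finset.sum_add_distrib, ← Finset.mul_sum, ← Finset.card_filter] at this
  simp only [Finset.sum_const, smul_eq_mul, mul_one] at this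
  omega

end graph


section base
variable {ι V : Type*} [Fintype ι] [DecidableEq ι] [Fintype V] [DecidableEq V]

open Classical in
lemma weighted_mantel [Nonempty ι] (n : ι → ℕ) (R : ι → ι → Prop) (hsym : ∀ i j, R i j → R j i)
    (htf : ∀ i j l, R i j → R i l → R j l → False) :
    ∃ C : Finset ι, ∑ i, ∑ j, n i * n j * (if R i j then 1 else 0) ≤
      2 * ((∑ i ∈ C, n i) * ∑ i ∈ Cᶜ, n i) := by
  set D : ι → ℕ := fun i => ∑ j, n j * (if R i j then 1 else 0) with hD
  obtain ⟨i0, -, hmax⟩ := Finset.exists_max_image univ D Finset.univ_nonempty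
  set B : Finset ι := univ.filter (R i0) with hB
  have hDB : D i0 = ∑ i ∈ B, n i := by
    simp [hD, hB, Finset.sum_filter]
  refine ⟨Bᶜ, ?_⟩
  rw [compl_compl]
  have h1 : ∑ i, ∑ j, n i * n j * (if R i j then 1 else 0) ≤
      ∑ i, ∑ j, ((if i ∈ Bᶜ then n i * (n j * (if R i j then 1 else 0)) else 0) +
        (if j ∈ Bᶜ then n j * (n i * (if R j i then 1 else 0)) else 0)) := by
    refine Finset.sum_le_sum fun i _ => Finset.sum_le_sum fun j _ => ?_
    by_cases h : R i j
    · have h' := hsym i j h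
      have : i ∈ Bᶜ ∨ j ∈ Bᶜ := by
        by_contra hcon
        simp [hB] at hcon
        exact htf i0 i j hcon.1 hcon.2 h
      rcases this with hi | hj
      · rw [if_pos hi, if_pos h, if_pos h']
        refine le_trans (le_of_eq ?_) (Nat.le_add_right _ _); ring
      · rw [if_pos hj, if_pos h, if_pos h']
        refine le_trans (le_of_eq ?_) (Nat.le_add_left _ _); ring
    · simp [h]
  have h2 : ∑ i, ∑ j, (if i ∈ Bᶜ then n i * (n j * (if R i j then 1 else 0)) else 0)
      = ∑ i ∈ Bᶜ, n i * D i := by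
    have : Bᶜ = univ.filter (· ∈ Bᶜ) := by ext; simp
    conv_rhs => rw [this]
    rw [Finset.sum_filter]
    refine Finset.sum_congr rfl fun i _ => ?_
    by_cases hi : i ∈ Bᶜ
    · simp only [if_pos hi, hD, Finset.mul_sum]
    · simp only [if_neg hi, Finset.sum_const_zero]
  have h3 : ∑ i ∈ Bᶜ, n i * D i ≤ (∑ i ∈ Bᶜ, n i) * ∑ i ∈ B, n i := by
    rw [Finset.sum_mul, ← hDB]
    exact Finset.sum_le_sum fun i _ => Nat.mul_le_mul_left _ (hmax i (Finset.mem_univ i))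
  simp only [Finset.sum_add_distrib] at h1
  have h4 : ∑ i, ∑ j, (if j ∈ Bᶜ then n j * (n i * (if R j i then 1 else 0)) else 0)
      = ∑ i ∈ Bᶜ, n i * D i := by
    rw [Finset.sum_comm, h2]
  rw [h2, h4] at h1
  omega

lemma count_pi (t : ι → Finset V) (i j : ι) (hij : i ≠ j) (u v : V) (hu : u ∈ t i)
    (hv : v ∈ t j) :
    #((Fintype.piFinset t).filter (fun φ => φ i = u ∧ φ j = v)) * (#(t i) * #(t j)) =
      ∏ l, #(t l) := by
  have e : (Fintype.piFinset t).filter (fun φ => φ i = u ∧ φ j = v) =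
      Fintype.piFinset (fun l => if l = i then {u} else if l = j then {v} else t l) := by
    ext φ
    simp only [Finset.mem_filter, Fintype.mem_piFinset]
    constructor
    · rintro ⟨h, h1, h2⟩ l
      split_ifs with a b
      · subst a; simp [h1]
      · subst b; simp [h2]
      · exact h l
    · intro h
      have hi := h i
      have hj := h j
      simp only [if_true, hij.symm, if_false, Finset.mem_singleton] at hi hj
      refine ⟨fun l => ?_, hi, hj⟩
      have := h l
      split_ifs at this with a b
      · subst a; rw [hi]; exact hu
      · subst b; rw [hj]; exact hv
      · exact this
  rw [e, Fintype.card_piFinset]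
  have hi := Finset.mul_prod_erase univ (fun l => #(t l)) (Finset.mem_univ i)
  have hjm : j ∈ univ.erase i := by simp [hij.symm]
  have hj := Finset.mul_prod_erase (univ.erase i) (fun l => #(t l)) hjm
  have hi' := Finset.mul_prod_erase univ
    (fun l => #(if l = i then {u} else if l = j then {v} else t l)) (Finset.mem_univ i)
  have hj' := Finset.mul_prod_erase (univ.erase i)
    (fun l => #(if l = i then {u} else if l = j then {v} else t l)) hjm
  have hr : ∏ l ∈ (univ.erase i).erase j, #(if l = i then {u} else if l = j then {v} else t l)
      = ∏ l ∈ (univ.erase i).erase j, #(t l) := by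
    refine Finset.prod_congr rfl fun l hl => ?_
    simp only [Finset.mem_erase] at hl
    rw [if_neg hl.2.1, if_neg hl.1]
  rw [← hi', ← hj', hr, ← hi, ← hj]
  simp [hij.symm]
  ring

open Classical in
lemma base_case (G : SimpleGraph V) (c : V → ι) (hc : ∀ u v, G.Adj u v → c u ≠ c v)
    (W : Finset V) (hpos : ∀ i, 0 < sz c W i) (hfree : ¬ HasK G 1 W) (z : ι) :
    ∃ A ⊆ univ.erase z, (EE G W : ℤ) ≤ 2 * FF (fun i => (sz c W i : ℤ)) z 0 A := by
  set t : ι → Finset V := fun i => W.filter (fun v => c v = i) with ht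
  have hsz : ∀ i, sz c W i = #(t i) := fun i => rfl
  set P := Fintype.piFinset t with hP
  set N := ∏ l, #(t l) with hN
  have hPc : #P = N := Fintype.card_piFinset t
  have hNpos : 0 < N := Finset.prod_pos fun i _ => hpos i
  have hE : EE G W = ∑ i, ∑ j, ∑ u ∈ t i, ∑ v ∈ t j, (if G.Adj u v then 1 else 0) := by
    have h1 : ∀ f : V → ℕ, ∑ v ∈ W, f v = ∑ i, ∑ v ∈ t i, f v := fun f =>
      (Finset.sum_fiberwise W c f).symm
    unfold EE dg
    rw [h1]
    refine Finset.sum_congr rfl fun i _ => ?_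
    rw [Finset.sum_comm]
    refine Finset.sum_congr rfl fun u _ => ?_
    rw [Finset.card_filter, h1]
  have key : ∀ i j, ∑ φ ∈ P, #(t i) * #(t j) * (if G.Adj (φ i) (φ j) then 1 else 0) =
      N * ∑ u ∈ t i, ∑ v ∈ t j, (if G.Adj u v then 1 else 0) := by
    intro i j
    by_cases hij : i = j
    · subst hij
      have h1 : ∀ φ ∈ P, ¬ G.Adj (φ i) (φ i) := fun φ _ => G.irrefl
      have h2 : ∀ u ∈ t i, ∀ v ∈ t i, ¬ G.Adj u v := by
        intro u hu v hv h
        simp only [ht, Finset.mem_filter] at hu hv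
        exact hc u v h (hu.2.trans hv.2.symm)
      rw [Finset.sum_eq_zero (fun φ hφ => by simp),
        Finset.sum_eq_zero (fun u hu => Finset.sum_eq_zero fun v hv => by simp [h2 u hu v hv])]
      simp
    · have h1 : ∀ φ ∈ P, (if G.Adj (φ i) (φ j) then 1 else 0) =
          ∑ u ∈ t i, ∑ v ∈ t j, (if φ i = u ∧ φ j = v then 1 else 0) *
            (if G.Adj u v then 1 else 0) := by
        intro φ hφ
        have hφ' := Fintype.mem_piFinset.1 hφ
        rw [Finset.sum_eq_single_of_mem (φ i) (hφ' i), Finset.sum_eq_single_of_mem (φ j) (hφ' j)]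
        · simp
        · intro v _ hv; simp [hv.symm]
        · intro u _ hu; simp [hu.symm]
      rw [Finset.sum_congr rfl fun φ hφ => by rw [h1 φ hφ], ← Finset.mul_sum, Finset.sum_comm,
        Finset.mul_sum, Finset.mul_sum]
      refine Finset.sum_congr rfl fun u hu => ?_
      rw [Finset.sum_comm, Finset.mul_sum, Finset.mul_sum]
      refine Finset.sum_congr rfl fun v hv => ?_
      rw [← Finset.sum_mul, ← Finset.card_filter, hN, ← count_pi t i j hij u v hu hv]
      ring
  obtain ⟨φ, hφ, hle⟩ : ∃ φ ∈ P, EE G W ≤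
      ∑ i, ∑ j, #(t i) * #(t j) * (if G.Adj (φ i) (φ j) then 1 else 0) := by
    apply Finset.exists_le_of_sum_le (Finset.card_pos.1 (hPc ▸ hNpos))
    rw [Finset.sum_const, hPc, smul_eq_mul, Finset.sum_comm, hE, Finset.mul_sum]
    refine Finset.sum_le_sum fun i _ => ?_
    rw [Finset.mul_sum, Finset.sum_comm]
    refine Finset.sum_le_sum fun j _ => ?_
    rw [key]
  have hφ' := Fintype.mem_piFinset.1 hφ
  have hφW : ∀ i, φ i ∈ W := fun i => (Finset.mem_filter.1 (hφ' i)).1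
  have : Nonempty ι := ⟨z⟩
  obtain ⟨C, hC⟩ := weighted_mantel (fun i => #(t i)) (fun i j => G.Adj (φ i) (φ j))
    (fun i j h => h.symm) (fun i j l h1 h2 h3 => hfree
      ⟨φ i, hφW i, φ j, hφW j, φ l, hφW l, h1, h2, h3, trivial⟩)
  have hEC := hle.trans hC
  have main : ∀ C : Finset ι, z ∈ C → EE G W ≤ 2 * ((∑ i ∈ C, #(t i)) * ∑ i ∈ Cᶜ, #(t i)) →
      ∃ A ⊆ univ.erase z, (EE G W : ℤ) ≤ 2 * FF (fun i => (sz c W i : ℤ)) z 0 A := by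
    intro C hz h
    refine ⟨C.erase z, Finset.erase_subset_erase _ (Finset.subset_univ _), ?_⟩
    unfold FF
    have e1 : univ.erase z \ C.erase z = Cᶜ := by
      ext j; by_cases hj : j = z <;> simp [hj, hz]
    rw [e1, Finset.add_sum_erase C (fun i => (sz c W i : ℤ)) hz]
    simp only [hsz]
    have : (EE G W : ℤ) ≤ 2 * ((∑ i ∈ C, #(t i)) * ∑ i ∈ Cᶜ, #(t i) : ℕ) := by exact_mod_cast h
    push_cast at this
    linarith
  by_cases hz : z ∈ C
  · exact main C hz hEC
  · refine main Cᶜ (by simpa using hz) ?_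
    rw [compl_compl, mul_comm (∑ i ∈ Cᶜ, _)]
    exact hEC

end base


section mainind
variable {ι V : Type*} [Fintype ι] [DecidableEq ι] [Fintype V] [DecidableEq V]

lemma main_bound (G : SimpleGraph V) (c : V → ι) (hc : ∀ u v, G.Adj u v → c u ≠ c v)
    (hcard : 4 ≤ Fintype.card ι) (z : ι) (m : ℕ) : ∀ W : Finset V, 6 * m + 2 ≤ sz c W z →
    (∀ i, i ≠ z → sz c W z + 4 * m + 4 ≤ sz c W i) → ¬ HasK G (m+1) W →
    ∃ A ⊆ univ.erase z, (EE G W : ℤ) ≤ 2 * FF (fun i => (sz c W i : ℤ)) z m A := by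
  induction m with
  | zero =>
    intro W h1 h2 h3
    refine base_case G c hc W (fun i => ?_) h3 z
    by_cases hi : i = z
    · subst hi; omega
    · have := h2 i hi; omega
  | succ m ih =>
    intro W h1 h2 hfree
    have hsum : (∑ i, (sz c W i : ℤ)) = #W := by exact_mod_cast sz_sum c W
    by_cases hv : ∃ v ∈ W, ¬ HasK G (m+1) (W.erase v)
    · obtain ⟨v, hvW, hvK⟩ := hv
      have hs : ∀ i, sz c W i = sz c (W.erase v) i + if i = c v then 1 else 0 :=
        sz_erase c W v hvW
      have hz := hs z
      have hle : ∀ i, sz c (W.erase v) i ≤ sz c W i ∧ sz c W i ≤ sz c (W.erase v) i + 1 := by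
        intro i; rw [hs i]; split_ifs <;> omega
      have hzl := hle z
      obtain ⟨A0, hA0, hE0⟩ := ih (W.erase v) (by omega) (fun i hi => by
        have := h2 i hi
        have := hle i
        omega) hvK
      obtain ⟨A, hA, hmax, -, O2⟩ := FF_opt (fun i => (sz c (W.erase v) i : ℤ)) z m A0 hA0
        (by positivity) (by
          show (m:ℤ) < (sz c (W.erase v) z : ℤ)
          have : m < sz c (W.erase v) z := by omega
          exact_mod_cast this) (fun i hi => by
          show (sz c (W.erase v) z : ℤ) < (sz c (W.erase v) i : ℤ)
          have := h2 i hi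
          have := hle i
          have : sz c (W.erase v) z < sz c (W.erase v) i := by omega
          exact_mod_cast this)
      refine ⟨A, hA, ?_⟩
      have key := vertex_arith (fun i => (sz c W i : ℤ)) z (c v) m A hA (by positivity)
        (fun i hi => by
          show (sz c W z : ℤ) < (sz c W i : ℤ)
          have := h2 i hi
          have : sz c W z < sz c W i := by omega
          exact_mod_cast this)
        (fun i => (sz c (W.erase v) i : ℤ)) (fun i => by
          show (sz c W i : ℤ) = _
          rw [hs i]; push_cast; rfl) O2
      have hd := dg_le G c hc W v
      have hd' : (dg G W v : ℤ) + sz c W (c v) ≤ #W := by exact_mod_cast hd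
      have hEE : (EE G W : ℤ) = EE G (W.erase v) + 2 * dg G W v := by
        exact_mod_cast EE_erase G W v hvW
      push_cast
      simp only [hsum] at key
      linarith
    push Not at hv
    have step : ∀ x ∈ W, ∀ y ∈ W, ∀ w ∈ W, G.Adj x y → G.Adj x w → G.Adj y w →
        (dg G W x + dg G W y + dg G W w ≤ #W + 18 * (m + 1) ∨
          dg G W x + dg G W y + dg G W w + sz c W (c x) + sz c W (c y) ≤
            2 * #W + 6 * (m + 1)) →
        ∃ A ⊆ univ.erase z,
          (EE G W : ℤ) ≤ 2 * FF (fun i => (sz c W i : ℤ)) z ((m + 1 : ℕ) : ℤ) A := by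
      intro x hx y hy w hw hxy hxw hyw hor
      set W' := ((W.erase x).erase y).erase w with hW'
      have hy' : y ∈ W.erase x := by simp [hy, hxy.ne']
      have hw' : w ∈ (W.erase x).erase y := by simp [hw, hxw.ne', hyw.ne']
      have hs : ∀ i, sz c W i = sz c W' i + (if i = c x then 1 else 0) +
          (if i = c y then 1 else 0) + (if i = c w then 1 else 0) := by
        intro i
        rw [sz_erase c W x hx, sz_erase c _ y hy', sz_erase c _ w hw']
        ring
      have hcxy := hc x y hxy
      have hcxw := hc x w hxw
      have hcyw := hc y w hyw
      have hle : ∀ i, sz c W' i ≤ sz c W i ∧ sz c W i ≤ sz c W' i + 1 := by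
        intro i; rw [hs i]
        by_cases a : i = c x
        · subst a; simp [hcxy, hcxw]
        · by_cases b : i = c y
          · subst b; simp [a, hcyw]
          · simp only [a, b, if_false]; split_ifs <;> omega
      have hzl := hle z
      have hK' : ¬ HasK G (m+1) W' := fun h =>
        hfree ⟨x, hx, y, hy, w, hw, hxy, hxw, hyw, h⟩
      obtain ⟨A0, hA0, hE0⟩ := ih W' (by omega) (fun i hi => by
        have := h2 i hi
        have := hle i
        omega) hK'
      obtain ⟨A, hA, hmax, O1, O2⟩ := FF_opt (fun i => (sz c W' i : ℤ)) z m A0 hA0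
        (by positivity) (by
          show (m:ℤ) < (sz c W' z : ℤ)
          have : m < sz c W' z := by omega
          exact_mod_cast this) (fun i hi => by
          show (sz c W' z : ℤ) < (sz c W' i : ℤ)
          have := h2 i hi
          have := hle i
          have : sz c W' z < sz c W' i := by omega
          exact_mod_cast this)
      refine ⟨A, hA, ?_⟩
      have key := tri_arith (fun i => (sz c W i : ℤ)) z (c x) (c y) (c w) hcxy hcxw hcyw m A hA
        hcard (by positivity) (by
          show 6 * (m:ℤ) + 8 ≤ (sz c W z : ℤ)
          have : 6 * m + 8 ≤ sz c W z := by omega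
          exact_mod_cast this)
        (fun i hi => by
          show (sz c W z : ℤ) + 4 * m + 8 ≤ (sz c W i : ℤ)
          have := h2 i hi
          have : sz c W z + 4 * m + 8 ≤ sz c W i := by omega
          exact_mod_cast this)
        (fun i => (sz c W' i : ℤ)) (fun i => by
          show (sz c W i : ℤ) = _
          rw [hs i]; push_cast; rfl) O1 O2
      have hEE : (EE G W : ℤ) + 6 = EE G W' + 2 * (dg G W x + dg G W y + dg G W w) := by
        exact_mod_cast EE_tri G W x y w hx hy hw hxy hxw hyw
      push_cast
      simp only [hsum] at key
      rcases hor with hor | hor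
      · have : (dg G W x : ℤ) + dg G W y + dg G W w ≤ #W + 18 * (m + 1) := by exact_mod_cast hor
        linarith [key.1]
      · have : (dg G W x : ℤ) + dg G W y + dg G W w + sz c W (c x) + sz c W (c y) ≤
            2 * #W + 6 * (m + 1) := by exact_mod_cast hor
        linarith [key.2]
    -- supports
    have hS : ∀ v ∈ W, ∃ S : Finset V, #S = 3 * (m + 1) ∧
        ∀ x ∈ W, ∀ y ∈ W, x ∉ S → y ∉ S → G.Adj v x → G.Adj v y → ¬ G.Adj x y := by
      intro v hvW
      obtain ⟨S, hSW, hSc, hSK⟩ := HasK_support G (m+1) (hv v hvW)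
      refine ⟨S, hSc, fun x hx y hy hxS hyS h1 h2 h3 => hfree ?_⟩
      exact HasK_succ_of G (m+1) (hSW.trans (Finset.erase_subset _ _)) hSK hvW hx hy
        (fun h => by simpa using hSW h) hxS hyS h1 h2 h3
    have hWne : W.Nonempty := by
      have : 0 < sz c W z := by omega
      unfold sz at this
      exact (Finset.card_pos.1 this).mono (Finset.filter_subset _ _)
    obtain ⟨v0, hv0⟩ := hWne
    obtain ⟨x, hx, y, hy, w, hw, hxy, hxw, hyw, -⟩ := hv v0 hv0
    replace hx := Finset.mem_of_mem_erase hx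
    replace hy := Finset.mem_of_mem_erase hy
    replace hw := Finset.mem_of_mem_erase hw
    have pair : ∀ v1 ∈ W, ∀ v2 ∈ W, G.Adj v1 v2 → ∀ S1 S2 : Finset V, #S1 = 3 * (m + 1) →
        #S2 = 3 * (m + 1) →
        (∀ x ∈ W, ∀ y ∈ W, x ∉ S1 → y ∉ S1 → G.Adj v1 x → G.Adj v1 y → ¬ G.Adj x y) →
        (∀ x ∈ W, ∀ y ∈ W, x ∉ S2 → y ∉ S2 → G.Adj v2 x → G.Adj v2 y → ¬ G.Adj x y) →
        (¬ ∀ w ∈ W, G.Adj v1 w → G.Adj v2 w → w ∈ S1 ∪ S2) →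
        ∃ A ⊆ univ.erase z,
          (EE G W : ℤ) ≤ 2 * FF (fun i => (sz c W i : ℤ)) z ((m + 1 : ℕ) : ℤ) A := by
      intro v1 hv1 v2 hv2 h12 S1 S2 hS1 hS2 hI1 hI2 hn
      push Not at hn
      obtain ⟨u, hu, hu1, hu2, huS⟩ := hn
      simp only [Finset.mem_union, not_or] at huS
      refine step v1 hv1 v2 hv2 u hu h12 hu1 hu2 (Or.inr ?_)
      have := second_tri G c hc W S1 S2 _ hS1 hS2 v1 v2 u (hc _ _ h12) hI1 hI2 hu huS.1 huS.2
        hu1 hu2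
      omega
    obtain ⟨S1, hS1, hI1⟩ := hS x hx
    obtain ⟨S2, hS2, hI2⟩ := hS y hy
    obtain ⟨S3, hS3, hI3⟩ := hS w hw
    by_cases c12 : ∀ w ∈ W, G.Adj x w → G.Adj y w → w ∈ S1 ∪ S2
    swap
    · exact pair x hx y hy hxy S1 S2 hS1 hS2 hI1 hI2 c12
    by_cases c13 : ∀ u ∈ W, G.Adj x u → G.Adj w u → u ∈ S1 ∪ S3
    swap
    · exact pair x hx w hw hxw S1 S3 hS1 hS3 hI1 hI3 c13
    by_cases c23 : ∀ u ∈ W, G.Adj y u → G.Adj w u → u ∈ S2 ∪ S3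
    swap
    · exact pair y hy w hw hyw S2 S3 hS2 hS3 hI2 hI3 c23
    refine step x hx y hy w hw hxy hxw hyw (Or.inl ?_)
    have := first_tri G W S1 S2 S3 _ hS1 hS2 hS3 x y w c12 c13 c23
    omega

lemma HasK_copy (G : SimpleGraph V) (k : ℕ) : ∀ W : Finset V, HasK G k W →
    ∃ f : Fin k → Fin 3 → V, (∀ i a, f i a ∈ W) ∧
      (∀ i a j b, f i a = f j b → i = j ∧ a = b) ∧ ∀ i a b, a ≠ b → G.Adj (f i a) (f i b) := by
  induction k with
  | zero => intro W _; exact ⟨fun i => i.elim0, fun i => i.elim0, fun i => i.elim0, fun i => i.elim0⟩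
  | succ k ih =>
    rintro W ⟨x, hx, y, hy, w, hw, h1, h2, h3, h4⟩
    obtain ⟨f, hf, hinj, hadj⟩ := ih _ h4
    simp only [Finset.mem_erase] at hf
    have ht : ∀ a, ![x, y, w] a ∈ W := by intro a; fin_cases a <;> simp [hx, hy, hw]
    have hne : ∀ a i b, ![x, y, w] a ≠ f i b := by
      intro a i b h
      have := hf i b
      rw [← h] at this
      fin_cases a <;> simp at this
    have hti : ∀ a b, ![x, y, w] a = ![x, y, w] b → a = b := by
      intro a b
      fin_cases a <;> fin_cases b <;> simp [h1.ne, h2.ne, h3.ne, h1.ne', h2.ne', h3.ne']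
    refine ⟨Fin.cons ![x, y, w] f, ?_, ?_, ?_⟩
    · intro i a
      refine Fin.cases ?_ (fun i => ?_) i
      · exact ht a
      · exact (hf i a).2.2.2
    · intro i a j b
      refine Fin.cases ?_ (fun i => ?_) i <;> refine Fin.cases ?_ (fun j => ?_) j
      · intro h; exact ⟨rfl, hti a b h⟩
      · intro h; exact absurd h (hne a j b)
      · intro h; exact absurd h.symm (hne b i a)
      · intro h
        obtain ⟨p, q⟩ := hinj i a j b h
        exact ⟨by rw [p], q⟩
    · intro i a b hab
      refine Fin.cases ?_ (fun i => ?_) i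
      · simp only [Fin.cons_zero]
        revert hab
        fin_cases a <;> fin_cases b <;> simp [h1, h2, h3, h1.symm, h2.symm, h3.symm]
      · exact hadj i a b hab

lemma hasCopy_of_HasK (G : SimpleGraph V) (k : ℕ) (W : Finset V) (h : HasK G k W) :
    HasCopy G (kCliques k 3) := by
  obtain ⟨f, -, hinj, hadj⟩ := HasK_copy G k W h
  refine ⟨fun p => f p.1 p.2, ?_, ?_⟩
  · rintro ⟨i, a⟩ ⟨j, b⟩ h
    obtain ⟨p, q⟩ := hinj i a j b h
    exact Prod.ext p q
  · rintro ⟨i, a⟩ ⟨j, b⟩ h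
    simp only [kCliques, SimpleGraph.fromRel_adj, ne_eq, Prod.mk.injEq] at h
    have hij : i = j := by rcases h.2 with h | h <;> simp_all
    subst hij
    exact hadj i a b (by tauto)

lemma EE_univ (G : SimpleGraph V) : EE G univ = 2 * G.edgeSet.ncard := by
  classical
  rw [← SimpleGraph.coe_edgeFinset, Set.ncard_coe_finset, ← G.sum_degrees_eq_twice_card_edges]
  unfold EE dg
  refine Finset.sum_congr rfl fun u _ => ?_
  rw [← SimpleGraph.card_neighborFinset_eq_degree]
  congr 1
  ext v; simp

end mainind


section final

lemma pairProdSum_two {r : ℕ} (x : Fin r → ℕ) (g : Fin r → Fin 2) :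
    pairProdSum x g = partSum x g 0 * partSum x g 1 := by
  unfold pairProdSum
  have : (Finset.univ.filter (fun p : Fin 2 × Fin 2 => p.1 < p.2)) = {(0, 1)} := by decide
  rw [this, Finset.sum_singleton]

lemma le_fT {r : ℕ} (x : Fin r → ℕ) (z : Fin r) (A : Finset (Fin r)) (hA : A ⊆ univ.erase z)
    (hB : (univ.erase z \ A).Nonempty) :
    (x z + ∑ i ∈ A, x i) * (∑ i ∈ univ.erase z \ A, x i) ≤ fT 3 x := by
  set B := univ.erase z \ A with hBd
  have hzA : z ∉ A := fun h => by simpa using hA h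
  set g : Fin r → Fin 2 := fun i => if i ∈ B then 1 else 0 with hg
  have hsurj : Function.Surjective g := by
    intro j
    obtain ⟨b, hb⟩ := hB
    fin_cases j
    · exact ⟨z, by simp [hg, hBd]⟩
    · exact ⟨b, by simp [hg, hb]⟩
  have h1 : partSum x g 1 = ∑ i ∈ B, x i := by
    unfold partSum
    congr 1
    ext i; simp [hg]
  have h0 : partSum x g 0 = x z + ∑ i ∈ A, x i := by
    unfold partSum
    rw [← Finset.sum_insert hzA]
    congr 1
    ext i
    by_cases hi : i = z <;> simp [hg, hBd, hi]
  have : pairProdSum x g ≤ fT 3 x := by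
    unfold fT
    exact Finset.le_sup (f := fun g : Fin r → Fin (3 - 1) => pairProdSum x g)
      (Finset.mem_filter.2 ⟨Finset.mem_univ _, hsurj⟩)
  rwa [pairProdSum_two, h0, h1] at this

lemma fT_attained {r : ℕ} (hr : 2 ≤ r) (x : Fin r → ℕ) :
    ∃ g : Fin r → Fin 2, fT 3 x = partSum x g 0 * partSum x g 1 := by
  have hne : (Finset.univ.filter (fun g : Fin r → Fin (3 - 1) => Function.Surjective g)).Nonempty := by
    refine ⟨fun i => if i.val = 0 then (0 : Fin 2) else (1 : Fin 2), ?_⟩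
    simp only [Finset.mem_filter, Finset.mem_univ, true_and]
    intro j
    have hj : j = (0 : Fin 2) ∨ j = (1 : Fin 2) := by
      revert j; show ∀ j : Fin 2, _; decide
    rcases hj with rfl | rfl
    · exact ⟨⟨0, by omega⟩, by simp⟩
    · exact ⟨⟨1, by omega⟩, by simp⟩
  obtain ⟨g, -, hg⟩ := Finset.exists_mem_eq_sup _ hne (fun g => pairProdSum x g)
  exact ⟨g, by unfold fT; rw [hg]; exact pairProdSum_two x g⟩

lemma card_filter_sigma {r : ℕ} (n : Fin r → ℕ) (p : (Σ i : Fin r, Fin (n i)) → Prop)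
    [DecidablePred p] : #(univ.filter p) = ∑ i, #(univ.filter (fun a : Fin (n i) => p ⟨i, a⟩)) := by
  simp only [Finset.card_filter]
  exact Fintype.sum_sigma _

lemma sz_fst {r : ℕ} (n : Fin r → ℕ) (i : Fin r) :
    sz (fun v : (Σ i : Fin r, Fin (n i)) => v.1) univ i = n i := by
  unfold sz
  rw [card_filter_sigma, Finset.sum_eq_single i]
  · simp
  · intro j _ hj; simp [hj]
  · simp

lemma upper {r : ℕ} (k : ℕ) (hk : 1 ≤ k) (hr : 4 ≤ r) (n : Fin r → ℕ) (z : Fin r)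
    (h1 : 10 * k - 4 ≤ n z + 4 * k) (h2 : ∀ i : Fin r, i ≠ z → n z + 4 * k ≤ n i)
    (H : SimpleGraph (Σ i : Fin r, Fin (n i))) (hH : H ≤ completeMultipartite n)
    (hfree : ¬ HasCopy H (kCliques k 3)) :
    H.edgeSet.ncard ≤ (k - 1) * ((∑ i, n i) - n z) +
        fT 3 (Function.update n z (n z - (k - 1))) := by
  obtain ⟨m, rfl⟩ : ∃ m, k = m + 1 := ⟨k - 1, by omega⟩
  have hc : ∀ u v : (Σ i : Fin r, Fin (n i)), H.Adj u v → u.1 ≠ v.1 := by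
    intro u v h
    have := hH h
    simpa [completeMultipartite, SimpleGraph.completeMultipartiteGraph] using this
  obtain ⟨A0, hA0, hE⟩ := main_bound H (fun v => v.1) hc (by simpa using hr) z m univ
    (by rw [sz_fst]; omega) (fun i hi => by
      rw [sz_fst, sz_fst]; have := h2 i hi; omega)
    (fun h => hfree (hasCopy_of_HasK H _ _ h))
  simp only [sz_fst] at hE
  obtain ⟨A, hA, hmax, O1, -⟩ := FF_opt (fun i => (n i : ℤ)) z m A0 hA0 (by positivity)
    (by show (m : ℤ) < n z; have : m < n z := by omega
        exact_mod_cast this)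
    (fun i hi => by
      show (n z : ℤ) < n i
      have := h2 i hi
      have : n z < n i := by omega
      exact_mod_cast this)
  have hzA : z ∉ A := fun h => by simpa using hA h
  set B := univ.erase z \ A with hBd
  have hzB : z ∉ B := by simp [hBd]
  have hB : B.Nonempty := by
    by_contra hcon
    rw [Finset.not_nonempty_iff_eq_empty] at hcon
    rw [hcon, Finset.sum_empty] at O1
    have hAe : A = univ.erase z := by
      apply Finset.Subset.antisymm hA
      rw [← Finset.sdiff_eq_empty_iff_subset]; exact hcon
    have hcard : 0 < #(univ.erase z) := by
      rw [Finset.card_erase_of_mem (Finset.mem_univ z), Finset.card_univ, Fintype.card_fin]; omega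
    have : 0 < ∑ i ∈ A, (n i : ℤ) := by
      rw [hAe]
      apply Finset.sum_pos
      · intro i hi
        have := h2 i (by simpa using hi)
        have : 0 < n i := by omega
        exact_mod_cast this
      · exact Finset.card_pos.1 hcard
    linarith
  have hfT := le_fT (Function.update n z (n z - m)) z A hA hB
  have eA : ∑ i ∈ A, Function.update n z (n z - m) i = ∑ i ∈ A, n i :=
    Finset.sum_congr rfl (fun i hi => Function.update_of_ne (by rintro rfl; exact hzA hi) _ n)
  have eB : ∑ i ∈ B, Function.update n z (n z - m) i = ∑ i ∈ B, n i :=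
    Finset.sum_congr rfl (fun i hi => Function.update_of_ne (by rintro rfl; exact hzB hi) _ n)
  rw [← hBd, Function.update_self, eA, eB] at hfT
  have htot : ∑ i, n i - n z = ∑ i ∈ A, n i + ∑ i ∈ B, n i := by
    rw [← Finset.add_sum_erase univ n (Finset.mem_univ z), ← Finset.sum_sdiff hA]
    rw [← hBd]; omega
  rw [Nat.add_sub_cancel, htot]
  have hmz : m ≤ n z := by omega
  refine le_trans ?_ (Nat.add_le_add_left hfT _)
  have h2E : (2 * H.edgeSet.ncard : ℤ) = EE H univ := by
    rw [EE_univ]; push_cast; ring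
  have hfin : (2 * H.edgeSet.ncard : ℤ) ≤ 2 * FF (fun i => (n i : ℤ)) z m A := by
    rw [h2E]; linarith
  unfold FF at hfin
  rw [← hBd] at hfin
  zify [hmz]
  nlinarith

lemma lower {r : ℕ} (k : ℕ) (hk : 1 ≤ k) (hr : 4 ≤ r) (n : Fin r → ℕ) (z : Fin r)
    (h1 : k - 1 ≤ n z) :
    ∃ H : SimpleGraph (Σ i : Fin r, Fin (n i)), H ≤ completeMultipartite n ∧
      ¬ HasCopy H (kCliques k 3) ∧
      (k - 1) * ((∑ i, n i) - n z) + fT 3 (Function.update n z (n z - (k - 1)))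
        ≤ H.edgeSet.ncard := by
  classical
  obtain ⟨g, hg⟩ := fT_attained (by omega) (Function.update n z (n z - (k - 1)))
  set sp : (Σ i : Fin r, Fin (n i)) → Prop := fun u => u.1 = z ∧ u.2.val < k - 1 with hsp
  let H : SimpleGraph (Σ i : Fin r, Fin (n i)) :=
    { Adj := fun u v => u.1 ≠ v.1 ∧ (sp u ∨ sp v ∨ g u.1 ≠ g v.1)
      symm := ⟨fun u v h => ⟨h.1.symm, by
        rcases h.2 with h | h | h
        · exact Or.inr (Or.inl h)
        · exact Or.inl h
        · exact Or.inr (Or.inr h.symm)⟩⟩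
      loopless := ⟨fun u h => h.1 rfl⟩ }
  have hadj : ∀ u v, H.Adj u v ↔ u.1 ≠ v.1 ∧ (sp u ∨ sp v ∨ g u.1 ≠ g v.1) := fun u v => Iff.rfl
  refine ⟨H, ?_, ?_, ?_⟩
  · intro u v h
    simpa [completeMultipartite, SimpleGraph.completeMultipartiteGraph] using h.1
  · rintro ⟨f, hinj, hf⟩
    have hex : ∀ i : Fin k, ∃ a : Fin 3, sp (f (i, a)) := by
      intro i
      by_contra hcon
      push Not at hcon
      have hh : ∀ a b : Fin 3, a ≠ b → g (f (i, a)).1 ≠ g (f (i, b)).1 := by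
        intro a b hab
        have := hf (a := (i, a)) (b := (i, b)) (by
          simp [kCliques, SimpleGraph.fromRel_adj, hab])
        rw [hadj] at this
        have := this.2
        have := hcon a
        have := hcon b
        tauto
      have a := hh 0 1 (by decide)
      have b := hh 0 2 (by decide)
      have d := hh 1 2 (by decide)
      revert a b d
      generalize g (f (i, 0)).1 = p
      generalize g (f (i, 1)).1 = q
      generalize g (f (i, 2)).1 = s
      revert p q s
      decide
    choose a ha using hex
    have hinj2 : Function.Injective (fun i : Fin k => (⟨(f (i, a i)).2.val, (ha i).2⟩ : Fin (k - 1))) := by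
      intro i j hij
      simp only [Fin.mk.injEq] at hij
      have h1 := (ha i).1
      have h2 := (ha j).1
      have : f (i, a i) = f (j, a j) := by
        revert hij h1 h2
        generalize f (i, a i) = u
        generalize f (j, a j) = v
        rcases u with ⟨u1, u2⟩
        rcases v with ⟨v1, v2⟩
        intro h h1 h2
        simp only at h h1 h2
        subst h1
        subst h2
        rw [Fin.ext h]
      exact (Prod.mk.inj (hinj this)).1
    have := Fintype.card_le_of_injective _ hinj2
    simp at this
    omega
  · set S := univ.filter sp with hS
    set O := univ.filter (fun u : (Σ i : Fin r, Fin (n i)) => u.1 ≠ z) with hO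
    set P : Fin 2 → Finset (Σ i : Fin r, Fin (n i)) := fun j =>
      univ.filter (fun u => ¬ sp u ∧ g u.1 = j) with hP
    have cS : #S = k - 1 := by
      rw [hS, card_filter_sigma, Finset.sum_eq_single z]
      · simp only [hsp, true_and]
        rw [Fin.card_filter_val_lt]; omega
      · intro i _ hi; simp [hsp, hi]
      · simp
    have cO : #O = (∑ i, n i) - n z := by
      rw [hO, card_filter_sigma, ← Finset.add_sum_erase univ n (Finset.mem_univ z),
        ← Finset.add_sum_erase univ _ (Finset.mem_univ z)]
      simp only [ne_eq, not_true, Finset.filter_false, Finset.card_empty]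
      rw [Finset.sum_congr rfl (g := fun i => n i)]
      · omega
      · intro i hi
        simp only [Finset.mem_erase] at hi
        simp [hi.1]
    have cP : ∀ j, #(P j) = partSum (Function.update n z (n z - (k - 1))) g j := by
      intro j
      rw [hP, card_filter_sigma]
      unfold partSum
      rw [Finset.sum_filter]
      refine Finset.sum_congr rfl fun i _ => ?_
      by_cases hgi : g i = j
      · simp only [hgi, and_true, if_true]
        by_cases hi : i = z
        · subst hi
          simp only [hsp, true_and, Function.update_self]
          have e := Finset.card_filter_add_card_filter_not (s := (univ : Finset (Fin (n i))))
            (fun a => a.val < k - 1)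
          rw [Fin.card_filter_val_lt, Finset.card_univ, Fintype.card_fin] at e
          omega
        · simp [hsp, hi]
      · simp [hgi]
    rw [hg, ← cP, ← cP, ← cS, ← cO, ← Finset.card_product, ← Finset.card_product,
      ← Finset.card_union_of_disjoint, ← SimpleGraph.coe_edgeFinset, Set.ncard_coe_finset]
    · apply Finset.card_le_card_of_injOn (fun p => s(p.1, p.2))
      · rintro ⟨u, v⟩ h
        simp only [Finset.coe_union, Set.mem_union, Finset.mem_coe, Finset.mem_product, hS, hO, hP,
          Finset.mem_filter, Finset.mem_univ, true_and] at h
        simp only [SimpleGraph.coe_edgeFinset, SimpleGraph.mem_edgeSet]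
        rw [hadj]
        rcases h with ⟨h1, h2⟩ | ⟨h1, h2⟩
        · exact ⟨fun h => h2 (h ▸ h1.1), Or.inl h1⟩
        · have hne : g u.1 ≠ g v.1 := by rw [h1.2, h2.2]; decide
          exact ⟨fun h => hne (by rw [h]), Or.inr (Or.inr hne)⟩
      · rintro ⟨u, v⟩ h ⟨u', v'⟩ h' heq
        simp only [Sym2.eq_iff] at heq
        rcases heq with ⟨rfl, rfl⟩ | ⟨rfl, rfl⟩
        · rfl
        · exfalso
          simp only [Finset.coe_union, Set.mem_union, Finset.mem_coe, Finset.mem_product, hS, hO,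
            hP, Finset.mem_filter, Finset.mem_univ, true_and] at h h'
          rcases h with ⟨h1, h2⟩ | ⟨h1, h2⟩ <;> rcases h' with ⟨h3, h4⟩ | ⟨h3, h4⟩
          · exact h2 h3.1
          · exact h4.1 h1
          · exact h2.1 h3
          · have := h1.2.symm.trans h4.2
            exact absurd this (by decide)
    · rw [Finset.disjoint_left]
      rintro ⟨u, v⟩ h h'
      simp only [Finset.mem_product, hS, hP, Finset.mem_filter, Finset.mem_univ, true_and] at h h'
      exact h'.1.1 h.1

end final

end TriPack

/-- Main theorem: for `r ≥ 4` and `10k−4 ≤ n_1+4k ≤ n_i` for all `i ≥ 2`, with `n = Σ n_i`,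
`ex(K_{n_1,…,n_r}, kK_3) = (k−1)(n − n_1) + f_3(n_1−(k−1), n_2, …, n_r)`. -/
theorem stmt_5 (k r : ℕ) (hk : 1 ≤ k) (hr : 4 ≤ r) (n : Fin r → ℕ)
    (h1 : 10 * k - 4 ≤ n ⟨0, by omega⟩ + 4 * k)
    (h2 : ∀ i : Fin r, i ≠ ⟨0, by omega⟩ → n ⟨0, by omega⟩ + 4 * k ≤ n i) :
    exNum (completeMultipartite n) (kCliques k 3) =
      (k - 1) * ((∑ i, n i) - n ⟨0, by omega⟩) +
        fT 3 (Function.update n ⟨0, by omega⟩ (n ⟨0, by omega⟩ - (k - 1))) := by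
  classical
  obtain ⟨H, hH, hfree, hle⟩ := TriPack.lower k hk hr n ⟨0, by omega⟩ (by omega)
  have hub := fun H hH hf => TriPack.upper k hk hr n ⟨0, by omega⟩ h1 h2 H hH hf
  unfold exNum
  apply IsGreatest.csSup_eq
  exact ⟨⟨H, hH, hfree, le_antisymm hle (hub H hH hfree)⟩,
    by rintro m ⟨H', a, b, rfl⟩; exact hub H' a b⟩
end

section
/- Let k ≥ 1 and n be integers with n > 9k/2 + 4. Then ex(K_n, kK_3) = C(k−1, 2) + (k−1)(n−k+1) + ⌊(n−k+1)²/4⌋, i.e., the number of edges of the join of K_{k−1} with the balanced complete bipartite graph T_2(n−k+1) on n−k+1 vertices. -/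
open SimpleGraph Finset

set_option linter.unusedSectionVars false

namespace Moon

open Classical in
noncomputable def ad {V : Type} (G : SimpleGraph V) (x y : V) : ℤ := if G.Adj x y then 1 else 0

noncomputable def E {V : Type} (G : SimpleGraph V) (S T : Finset V) : ℤ :=
  ∑ x ∈ S, ∑ y ∈ T, ad G x y

def IsPack {V : Type} (G : SimpleGraph V) (q : ℕ) (P : Finset (Finset V)) (W : Finset V) : Prop :=
  (∀ t ∈ P, G.IsNClique q t ∧ t ⊆ W) ∧ ∀ t ∈ P, ∀ t' ∈ P, t ≠ t' → Disjoint t t'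

def HasPack {V : Type} (G : SimpleGraph V) (q : ℕ) (W : Finset V) (k : ℕ) : Prop :=
  ∃ P, IsPack G q P W ∧ P.card = k

section basic
variable {V : Type} [DecidableEq V] {G : SimpleGraph V}

lemma ad_nonneg (x y : V) : 0 ≤ ad G x y := by unfold ad; split_ifs <;> norm_num
lemma ad_le (x y : V) : ad G x y ≤ 1 := by unfold ad; split_ifs <;> norm_num
lemma ad_self (x : V) : ad G x x = 0 := by simp [ad]
lemma ad_comm (x y : V) : ad G x y = ad G y x := by
  by_cases h : G.Adj x y
  · simp [ad, h, h.symm]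
  · have h' : ¬ G.Adj y x := fun h' => h h'.symm
    simp [ad, h, h']
lemma ad_adj {x y : V} (h : G.Adj x y) : ad G x y = 1 := by simp [ad, h]
lemma ad_not {x y : V} (h : ¬ G.Adj x y) : ad G x y = 0 := by simp [ad, h]

lemma E_nonneg (S T : Finset V) : 0 ≤ E G S T :=
  Finset.sum_nonneg fun _ _ => Finset.sum_nonneg fun _ _ => ad_nonneg _ _

lemma E_comm (S T : Finset V) : E G S T = E G T S := by
  unfold E; rw [Finset.sum_comm]
  exact Finset.sum_congr rfl fun x _ => Finset.sum_congr rfl fun y _ => ad_comm _ _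

lemma E_empty_left (T : Finset V) : E G ∅ T = 0 := by simp [E]
lemma E_empty_right (T : Finset V) : E G T ∅ = 0 := by simp [E]

lemma E_union_left {S S' : Finset V} (h : Disjoint S S') (T : Finset V) :
    E G (S ∪ S') T = E G S T + E G S' T := by
  unfold E; rw [Finset.sum_union h]

lemma E_union_right {S S' : Finset V} (h : Disjoint S S') (T : Finset V) :
    E G T (S ∪ S') = E G T S + E G T S' := by
  rw [E_comm, E_union_left h, E_comm S, E_comm S']

lemma E_split_left {S S' : Finset V} (h : S' ⊆ S) (T : Finset V) :
    E G S T = E G S' T + E G (S \ S') T := by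
  rw [← E_union_left Finset.disjoint_sdiff, Finset.union_sdiff_of_subset h]

lemma E_split_right {S S' : Finset V} (h : S' ⊆ S) (T : Finset V) :
    E G T S = E G T S' + E G T (S \ S') := by
  rw [← E_union_right Finset.disjoint_sdiff, Finset.union_sdiff_of_subset h]

lemma E_sum_left (S T : Finset V) : E G S T = ∑ x ∈ S, E G {x} T := by
  simp [E]

lemma E_sum_right (S T : Finset V) : E G S T = ∑ y ∈ T, E G S {y} := by
  rw [E_comm, E_sum_left]; simp only [E_comm S]

lemma E_biUnion_left (P : Finset (Finset V)) (h : ∀ t ∈ P, ∀ t' ∈ P, t ≠ t' → Disjoint t t')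
    (T : Finset V) : E G (P.biUnion id) T = ∑ t ∈ P, E G t T := by
  unfold E; rw [Finset.sum_biUnion (by intro a ha b hb hab; exact h a ha b hb hab)]; rfl

lemma E_biUnion_right (P : Finset (Finset V)) (h : ∀ t ∈ P, ∀ t' ∈ P, t ≠ t' → Disjoint t t')
    (T : Finset V) : E G T (P.biUnion id) = ∑ t ∈ P, E G T t := by
  rw [E_comm, E_biUnion_left P h]; simp only [E_comm T]

lemma E_le (S T : Finset V) : E G S T ≤ S.card * T.card := by
  unfold E
  calc _ ≤ ∑ x ∈ S, ∑ y ∈ T, (1 : ℤ) :=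
        Finset.sum_le_sum fun _ _ => Finset.sum_le_sum fun _ _ => ad_le _ _
    _ = _ := by simp

lemma E_single (x y : V) : E G {x} {y} = ad G x y := by simp [E]

/-- pairwise disjoint neighbourhoods -/
lemma E_disj (C X : Finset V)
    (h : ∀ c ∈ X, ∀ p ∈ C, ∀ p' ∈ C, p ≠ p' → G.Adj p c → G.Adj p' c → False) :
    E G C X ≤ X.card := by
  rw [E_sum_right]
  calc _ ≤ ∑ y ∈ X, (1 : ℤ) := by
        apply Finset.sum_le_sum
        intro c hc
        by_cases hex : ∃ p ∈ C, G.Adj p c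
        · obtain ⟨p, hp, hpc⟩ := hex
          have : E G C {c} = ad G p c := by
            unfold E; simp only [Finset.sum_singleton]
            apply Finset.sum_eq_single p
            · intro b hb hbp
              exact ad_not fun hbc => h c hc p hp b hb (Ne.symm hbp) hpc hbc
            · intro h; exact absurd hp h
          rw [this]; exact ad_le _ _
        · push Not at hex
          have : E G C {c} = 0 := by
            unfold E; simp only [Finset.sum_singleton]
            exact Finset.sum_eq_zero fun b hb => ad_not (hex b hb)
          rw [this]; norm_num
    _ = _ := by simp

lemma E_full_lt {S T : Finset V} {x y : V} (hx : x ∈ S) (hy : y ∈ T) (h : ¬ G.Adj x y) :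
    E G S T ≤ S.card * T.card - 1 := by
  have h1 : ({x} : Finset V) ⊆ S := by simpa using hx
  have h2 : ({y} : Finset V) ⊆ T := by simpa using hy
  have e1 := E_split_left (G := G) h1 T
  have e2 := E_split_right (G := G) h2 {x}
  have e3 := E_le (G := G) (S \ {x}) T
  have e4 := E_le (G := G) {x} (T \ {y})
  rw [E_single, ad_not h] at e2
  rw [Finset.card_sdiff_of_subset h1, Nat.cast_sub (Finset.card_le_card h1)] at e3
  rw [Finset.card_sdiff_of_subset h2, Nat.cast_sub (Finset.card_le_card h2)] at e4
  simp only [Finset.card_singleton, Nat.cast_one] at e3 e4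
  nlinarith

lemma IsPack.card_biUnion {q : ℕ} {P : Finset (Finset V)} {W : Finset V} (h : IsPack G q P W) :
    (P.biUnion id).card = q * P.card := by
  rw [Finset.card_biUnion (by intro a ha b hb hab; exact h.2 a ha b hb hab)]
  rw [Finset.sum_congr rfl (fun t ht => (show (id t).card = q from (h.1 t ht).1.2))]
  simp [mul_comm]

lemma IsPack.biUnion_subset {q : ℕ} {P : Finset (Finset V)} {W : Finset V} (h : IsPack G q P W) :
    P.biUnion id ⊆ W := by
  intro x hx
  simp only [Finset.mem_biUnion, id] at hx
  obtain ⟨t, ht, hx⟩ := hx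
  exact (h.1 t ht).2 hx

lemma HasPack.mono {q k : ℕ} {W W' : Finset V} (h : HasPack G q W k) (hW : W ⊆ W') :
    HasPack G q W' k := by
  obtain ⟨P, hP, hc⟩ := h
  exact ⟨P, ⟨fun t ht => ⟨(hP.1 t ht).1, (hP.1 t ht).2.trans hW⟩, hP.2⟩, hc⟩

lemma HasPack.union {q k l : ℕ} (hq : 0 < q) {W W' : Finset V} (h : HasPack G q W k)
    (h' : HasPack G q W' l) (hd : Disjoint W W') : HasPack G q (W ∪ W') (k + l) := by
  obtain ⟨P, hP, hc⟩ := h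
  obtain ⟨P', hP', hc'⟩ := h'
  have key : ∀ t ∈ P, ∀ t' ∈ P', Disjoint t t' := fun t ht t' ht' =>
    Finset.disjoint_of_subset_left (hP.1 t ht).2
      (Finset.disjoint_of_subset_right (hP'.1 t' ht').2 hd)
  refine ⟨P ∪ P', ⟨?_, ?_⟩, ?_⟩
  · intro t ht
    rcases Finset.mem_union.1 ht with ht | ht
    · exact ⟨(hP.1 t ht).1, (hP.1 t ht).2.trans Finset.subset_union_left⟩
    · exact ⟨(hP'.1 t ht).1, (hP'.1 t ht).2.trans Finset.subset_union_right⟩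
  · intro t ht t' ht' hne
    rcases Finset.mem_union.1 ht with ht | ht <;> rcases Finset.mem_union.1 ht' with ht' | ht'
    · exact hP.2 t ht t' ht' hne
    · exact key t ht t' ht'
    · exact (key t' ht' t ht).symm
    · exact hP'.2 t ht t' ht' hne
  · rw [Finset.card_union_of_disjoint, hc, hc']
    rw [Finset.disjoint_left]
    intro t ht ht'
    have := key t ht t ht'
    rw [disjoint_self, Finset.bot_eq_empty] at this
    have h3 := (hP.1 t ht).1.2
    rw [this] at h3; simp at h3; omega

lemma HasPack.zero {q : ℕ} (W : Finset V) : HasPack G q W 0 :=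
  ⟨∅, ⟨by simp, by simp⟩, rfl⟩

lemma HasPack.single {q : ℕ} {t : Finset V} (h : G.IsNClique q t) : HasPack G q t 1 :=
  ⟨{t}, ⟨by simp [h], by simp +contextual⟩, by simp⟩

lemma HasPack.tri {x y z : V} (h1 : G.Adj x y) (h2 : G.Adj x z) (h3 : G.Adj y z) :
    HasPack G 3 {x, y, z} 1 :=
  HasPack.single (SimpleGraph.is3Clique_triple_iff.2 ⟨h1, h2, h3⟩)

lemma HasPack.clique {U : Finset V} (h : G.IsClique U) (k : ℕ) (hk : 3 * k ≤ U.card) :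
    HasPack G 3 U k := by
  induction k generalizing U with
  | zero => exact HasPack.zero _
  | succ k ih =>
    obtain ⟨t, htU, htc⟩ := Finset.exists_subset_card_eq (show 3 ≤ U.card by omega)
    have h1 : HasPack G 3 t 1 := HasPack.single ⟨h.subset (by exact_mod_cast htU), htc⟩
    have h2 : HasPack G 3 (U \ t) k := by
      apply ih (h.subset (by exact_mod_cast Finset.sdiff_subset))
      rw [Finset.card_sdiff_of_subset htU]; omega
    have := h2.union (by norm_num) h1 Finset.sdiff_disjoint
    rwa [Finset.sdiff_union_of_subset htU] at this

lemma IsPack.sub {q : ℕ} {P Q : Finset (Finset V)} {W : Finset V} (h : IsPack G q P W)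
    (hQ : Q ⊆ P) : IsPack G q Q (Q.biUnion id) :=
  ⟨fun t ht => ⟨(h.1 t (hQ ht)).1, Finset.subset_biUnion_of_mem id ht⟩,
    fun t ht t' ht' => h.2 t (hQ ht) t' (hQ ht')⟩

lemma IsPack.disj_biUnion {q : ℕ} {P Q Q' : Finset (Finset V)} {W : Finset V} (h : IsPack G q P W)
    (hQ : Q ⊆ P) (hQ' : Q' ⊆ P) (hd : Disjoint Q Q') :
    Disjoint (Q.biUnion id) (Q'.biUnion id) := by
  rw [Finset.disjoint_biUnion_left]
  intro t ht
  rw [Finset.disjoint_biUnion_right]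
  intro t' ht'
  exact h.2 t (hQ ht) t' (hQ' ht') (fun e => Finset.disjoint_left.1 hd ht (e ▸ ht'))

/-- exchange lemma -/
lemma exch {P Q : Finset (Finset V)} {W X : Finset V} (hP : IsPack G 3 P W) (hQ : Q ⊆ P) {k : ℕ}
    (h : HasPack G 3 X k) (hX : Disjoint ((P \ Q).biUnion id) X) :
    HasPack G 3 ((P \ Q).biUnion id ∪ X) (P.card - Q.card + k) := by
  have h1 : HasPack G 3 ((P \ Q).biUnion id) (P.card - Q.card) :=
    ⟨P \ Q, hP.sub Finset.sdiff_subset, Finset.card_sdiff_of_subset hQ⟩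
  exact h1.union (by norm_num) h hX

end basic

lemma weights {α : Type} [DecidableEq α] (K : α → α → Prop) [DecidableRel K]
    (hsymm : ∀ x y, K x y → K y x) (hirr : ∀ x, ¬ K x x) (F : Finset α) (lam : α → ℤ) (i s : ℤ)
    (h0 : ∀ x ∈ F, 0 ≤ lam x) (h2 : ∀ x ∈ F, ∀ y ∈ F, K x y → i ≤ lam x + lam y)
    (h3 : ∀ x ∈ F, ∀ y ∈ F, ∀ z ∈ F, K x y → K y z → K x z →
      3 * s + 3 * i ≤ 2 * (lam x + lam y + lam z)) :
    ∀ S ⊆ F, (S.card : ℤ) ≤ s →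
      2 * ∑ x ∈ S, ∑ y ∈ S, (if K x y then (1 : ℤ) else 0) ≤
        4 * ∑ x ∈ S, lam x + (S.card - i) ^ 2 := by
  intro S
  induction S using Finset.strongInduction with
  | H S ih =>
  intro hSF hSs
  -- general erase step
  have er : ∀ (A : Finset α) (x : α), x ∈ A →
      ∑ a ∈ A, ∑ b ∈ A, (if K a b then (1 : ℤ) else 0) =
        ∑ a ∈ A.erase x, ∑ b ∈ A.erase x, (if K a b then (1 : ℤ) else 0)
          + 2 * ∑ b ∈ A.erase x, (if K x b then (1 : ℤ) else 0) := by
    intro A x hx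
    rw [← Finset.add_sum_erase _ _ hx]
    have : ∀ a ∈ A.erase x, ∑ b ∈ A, (if K a b then (1 : ℤ) else 0) =
        (if K x a then (1 : ℤ) else 0) + ∑ b ∈ A.erase x, (if K a b then (1 : ℤ) else 0) := by
      intro a _
      rw [← Finset.add_sum_erase _ _ hx]
      congr 1
      by_cases h : K a x
      · simp [h, hsymm _ _ h]
      · have h' : ¬ K x a := fun h' => h (hsymm _ _ h')
        simp [h, h']
    rw [Finset.sum_congr rfl this, Finset.sum_add_distrib, ← Finset.add_sum_erase _ _ hx]
    simp [hirr x]; ring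
  have le1 : ∀ (A : Finset α) (x : α), ∑ b ∈ A, (if K x b then (1 : ℤ) else 0) ≤ A.card := by
    intro A x
    calc _ ≤ ∑ b ∈ A, (1 : ℤ) := Finset.sum_le_sum fun b _ => by split_ifs <;> norm_num
      _ = _ := by simp
  by_cases hbig : ∃ x ∈ S, 2 * (S.card : ℤ) + 2 * i - 3 ≤ 4 * lam x
  · obtain ⟨x, hx, hl⟩ := hbig
    have := ih (S.erase x) (Finset.erase_ssubset hx) ((Finset.erase_subset _ _).trans hSF)
      (le_trans (by exact_mod_cast Finset.card_le_card (Finset.erase_subset _ _)) hSs)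
    have e1 := er S x hx
    have e2 := le1 (S.erase x) x
    have e3 := Finset.add_sum_erase S lam hx
    have e4 : ((S.erase x).card : ℤ) = S.card - 1 := by
      have := Finset.card_erase_add_one hx; omega
    rw [e4] at this e2
    nlinarith
  · push Not at hbig
    have notri : ∀ x ∈ S, ∀ y ∈ S, ∀ z ∈ S, K x y → K y z → K x z → False := by
      intro x hx y hy z hz h h' h''
      have := h3 x (hSF hx) y (hSF hy) z (hSF hz) h h' h''
      have a := hbig x hx
      have b := hbig y hy
      have c := hbig z hz
      omega
    by_cases hed : ∃ x ∈ S, ∃ y ∈ S, K x y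
    · obtain ⟨x, hx, y, hy, hxy⟩ := hed
      have hne : x ≠ y := fun e => hirr x (by rw [← e] at hxy; exact hxy)
      have hy' : y ∈ S.erase x := Finset.mem_erase.2 ⟨hne.symm, hy⟩
      have hc : (((S.erase x).erase y).card : ℤ) ≤ S.card := by
        exact_mod_cast Finset.card_le_card ((Finset.erase_subset y _).trans (Finset.erase_subset x S))
      have := ih ((S.erase x).erase y)
        ((Finset.erase_ssubset hy').trans_subset (Finset.erase_subset _ _))
        (((Finset.erase_subset _ _).trans (Finset.erase_subset _ _)).trans hSF)
        (hc.trans hSs)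
      have e1 := er S x hx
      have e2 := er (S.erase x) y hy'
      have e3 := Finset.add_sum_erase S lam hx
      have e3' := Finset.add_sum_erase (S.erase x) lam hy'
      have e4 : ((S.erase x).card : ℤ) = S.card - 1 := by
        have := Finset.card_erase_add_one hx; omega
      have e5 : (((S.erase x).erase y).card : ℤ) = S.card - 2 := by
        have := Finset.card_erase_add_one hy'; omega
      have e6 := Finset.add_sum_erase (S.erase x) (fun b => if K x b then (1 : ℤ) else 0) hy'
      simp only [hxy, if_true] at e6
      have e7 : ∑ b ∈ (S.erase x).erase y, (if K x b then (1 : ℤ) else 0) +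
          ∑ b ∈ (S.erase x).erase y, (if K y b then (1 : ℤ) else 0) ≤
          ((S.erase x).erase y).card := by
        rw [← Finset.sum_add_distrib]
        calc _ ≤ ∑ b ∈ (S.erase x).erase y, (1 : ℤ) := by
              apply Finset.sum_le_sum
              intro b hb
              have hbS : b ∈ S := Finset.mem_of_mem_erase (Finset.mem_of_mem_erase hb)
              by_cases h : K x b
              · by_cases h' : K y b
                · exact (notri x hx y hy b hbS hxy h' h).elim
                · simp [h, h']
              · simp only [h, if_false]; split_ifs <;> norm_num
          _ = _ := by simp
      have e8 := h2 x (hSF hx) y (hSF hy) hxy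
      rw [e5] at this e7
      nlinarith
    · push Not at hed
      have z : ∑ x ∈ S, ∑ y ∈ S, (if K x y then (1 : ℤ) else 0) = 0 :=
        Finset.sum_eq_zero fun x hx => Finset.sum_eq_zero fun y hy => by simp [hed x hx y hy]
      rw [z]
      have := Finset.sum_nonneg fun x hx => h0 x (hSF hx)
      nlinarith [sq_nonneg ((S.card : ℤ) - i)]

def Full {V : Type} (G : SimpleGraph V) (y : V) (e : Finset V) : Prop := ∀ a ∈ e, G.Adj y a

def Head {V : Type} (G : SimpleGraph V) (M : Finset (Finset V)) (y : V) : Prop :=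
  ∃ e ∈ M, ∃ e' ∈ M, e ≠ e' ∧ Full G y e ∧ Full G y e'

section two
variable {V : Type} [DecidableEq V] {G : SimpleGraph V}

lemma two_clique {a b : V} (hab : G.Adj a b) : G.IsNClique 2 ({a, b} : Finset V) :=
  ⟨by rw [Finset.coe_pair]; exact SimpleGraph.isClique_pair.2 fun _ => hab, Finset.card_pair hab.ne⟩

lemma not_full_le {y : V} {e : Finset V} (he : e.card = 2) (h : ¬ Full G y e) :
    E G {y} e ≤ 1 := by
  unfold Full at h
  push Not at h
  obtain ⟨a, ha, hya⟩ := h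
  have := E_full_lt (Finset.mem_singleton_self y) ha hya
  rw [he] at this; simpa using this

lemma full_tri {y : V} {e : Finset V} (he : G.IsNClique 2 e) (h : Full G y e) :
    HasPack G 3 (insert y e) 1 := HasPack.single (he.insert h)

lemma HasPack.union' {q k l : ℕ} (hq : 0 < q) {W W' X : Finset V} (h : HasPack G q W k)
    (h' : HasPack G q W' l) (hd : Disjoint W W') (hX : W ∪ W' ⊆ X) : HasPack G q X (k + l) :=
  (h.union hq h' hd).mono hX

lemma mant_full {R : Finset V} {M : Finset (Finset V)} (hM : IsPack G 2 M R)
    (hno : ¬ HasPack G 3 R 1) {w : V} (hw : w ∈ R) {e : Finset V} (he : e ∈ M) :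
    E G {w} e ≤ 1 := by
  apply not_full_le (hM.1 e he).1.2
  intro h
  exact hno ((full_tri (hM.1 e he).1 h).mono (Finset.insert_subset hw (hM.1 e he).2))

lemma mant_ind {R : Finset V} {M : Finset (Finset V)} (hM : IsPack G 2 M R)
    (hmx : ¬ HasPack G 2 R (M.card + 1)) (a b : V) (ha : a ∈ R \ M.biUnion id)
    (hb : b ∈ R \ M.biUnion id) : ¬ G.Adj a b := by
  intro hab
  apply hmx
  have h1 : HasPack G 2 (M.biUnion id) M.card := ⟨M, hM.sub (Finset.Subset.refl _), rfl⟩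
  have h2 : HasPack G 2 ({a, b} : Finset V) 1 := by
    apply HasPack.single
    exact two_clique hab
  rw [Finset.mem_sdiff] at ha hb
  apply h1.union' (by norm_num) h2
  · rw [Finset.disjoint_right]
    intro x hx
    simp only [Finset.mem_insert, Finset.mem_singleton] at hx
    rcases hx with rfl | rfl
    · exact ha.2
    · exact hb.2
  · apply Finset.union_subset hM.biUnion_subset
    intro x hx
    simp only [Finset.mem_insert, Finset.mem_singleton] at hx
    rcases hx with rfl | rfl
    · exact ha.1
    · exact hb.1

lemma mant_M {R : Finset V} {M : Finset (Finset V)} (hM : IsPack G 2 M R) (X : Finset V)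
    (h : ∀ w ∈ X, ∀ e ∈ M, E G {w} e ≤ 1) :
    E G X (M.biUnion id) ≤ X.card * M.card := by
  rw [E_sum_left]
  calc _ ≤ ∑ x ∈ X, (M.card : ℤ) := by
        apply Finset.sum_le_sum
        intro x hx
        rw [E_biUnion_right M hM.2]
        calc _ ≤ ∑ e ∈ M, (1 : ℤ) := Finset.sum_le_sum fun e he => h x hx e he
          _ = _ := by simp
    _ = _ := by simp

lemma mant_card {R : Finset V} {M : Finset (Finset V)} (hM : IsPack G 2 M R) :
    (R.card : ℤ) = 2 * M.card + (R \ M.biUnion id).card := by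
  have := Finset.card_sdiff_add_card_eq_card hM.biUnion_subset
  rw [hM.card_biUnion] at this
  push_cast [← this]; ring

lemma mant_RR {R : Finset V} {M : Finset (Finset V)} (hM : IsPack G 2 M R)
    (hno : ¬ HasPack G 3 R 1) (hmx : ¬ HasPack G 2 R (M.card + 1)) :
    E G R R ≤ 2 * M.card * (M.card + (R \ M.biUnion id).card) := by
  have h1 := mant_M hM R fun w hw e he => mant_full hM hno hw he
  have h2 := mant_M hM (R \ M.biUnion id)
    fun w hw e he => mant_full hM hno (Finset.mem_sdiff.1 hw).1 he
  have h3 : E G (R \ M.biUnion id) (R \ M.biUnion id) = 0 :=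
    Finset.sum_eq_zero fun x hx => Finset.sum_eq_zero fun y hy => ad_not (mant_ind hM hmx x y hx hy)
  have h4 := E_split_right (G := G) hM.biUnion_subset R
  have h5 := E_split_left (G := G) hM.biUnion_subset (R \ M.biUnion id)
  rw [E_comm] at h2
  have h6 := mant_card hM
  rw [h6] at h1
  nlinarith

lemma mant_v {R : Finset V} {M : Finset (Finset V)} (hM : IsPack G 2 M R)
    (hno : ¬ HasPack G 3 R 1) {w : V} (hw : w ∈ R) :
    E G {w} R ≤ M.card + (R \ M.biUnion id).card := by
  have h1 := mant_M hM {w} fun w' hw' e he => mant_full hM hno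
    (by rw [Finset.mem_singleton.1 hw']; exact hw) he
  have h4 := E_split_right (G := G) hM.biUnion_subset {w}
  have h5 := E_le (G := G) {w} (R \ M.biUnion id)
  simp at h1 h5
  linarith

lemma clique_tri {C : Finset V} (hC : G.IsClique C) {p p' c : V} (hp : p ∈ C) (hp' : p' ∈ C)
    (hne : p ≠ p') (hc : c ∉ C) (h : G.Adj p c) (h' : G.Adj p' c) {k : ℕ}
    (hk : 3 * k + 2 ≤ C.card) : HasPack G 3 (insert c C) (k + 1) := by
  have h1 : HasPack G 3 (C \ {p, p'}) k := by
    apply HasPack.clique (hC.subset (by exact_mod_cast Finset.sdiff_subset))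
    rw [Finset.card_sdiff_of_subset, Finset.card_pair hne]
    · omega
    · intro x hx
      simp only [Finset.mem_insert, Finset.mem_singleton] at hx
      rcases hx with rfl | rfl <;> assumption
  have h2 : HasPack G 3 {p, p', c} 1 := HasPack.tri (hC hp hp' hne) h h'
  apply h1.union' (by norm_num) h2
  · rw [Finset.disjoint_left]
    intro x hx hx'
    simp only [Finset.mem_sdiff, Finset.mem_insert, Finset.mem_singleton, not_or] at hx hx'
    rcases hx' with rfl | rfl | rfl
    · exact hx.2.1 rfl
    · exact hx.2.2 rfl
    · exact hc hx.1
  · intro x hx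
    simp only [Finset.mem_union, Finset.mem_sdiff, Finset.mem_insert, Finset.mem_singleton] at hx ⊢
    rcases hx with hx | rfl | rfl | rfl
    · exact Or.inr hx.1
    · exact Or.inr hp
    · exact Or.inr hp'
    · exact Or.inl rfl

lemma clique_of_E {S T : Finset V} (hS : G.IsClique S) (hT : G.IsClique T)
    (h : (S.card : ℤ) * T.card ≤ E G S T) : G.IsClique (S ∪ T : Finset V) := by
  have key : ∀ x ∈ S, ∀ y ∈ T, G.Adj x y := by
    intro x hx y hy
    by_contra hn
    have := E_full_lt hx hy hn
    omega
  intro x hx y hy hne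
  rcases Finset.mem_union.1 (Finset.mem_coe.1 hx) with hx | hx <;>
    rcases Finset.mem_union.1 (Finset.mem_coe.1 hy) with hy | hy
  · exact hS hx hy hne
  · exact key x hx y hy
  · exact (key y hy x hx).symm
  · exact hT hx hy hne

end two

structure Cfg {V : Type} [DecidableEq V] (G : SimpleGraph V) (W : Finset V)
    (P M : Finset (Finset V)) (v : V) : Prop where
  hP : IsPack G 3 P W
  hM : IsPack G 2 M (W \ P.biUnion id)
  hv : v ∈ W
  hvP : v ∉ P.biUnion id
  nop : ¬ HasPack G 3 W (P.card + 1)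
  hmax : ∀ X ⊆ W, HasPack G 3 X P.card → v ∉ X → ¬ HasPack G 2 (W \ X) (M.card + 1)
  hdeg : ∀ u ∈ W, E G {u} W ≤ E G {v} W

section cfg
variable {V : Type} [DecidableEq V] {G : SimpleGraph V} {W : Finset V}
  {P M : Finset (Finset V)} {v : V}

lemma Cfg.L0 (h : Cfg G W P M v) {Q : Finset (Finset V)} (hQ : Q ⊆ P) {X : Finset V}
    (hX : X ⊆ Q.biUnion id ∪ (W \ P.biUnion id)) {k : ℕ} (hk : k = Q.card + 1) :
    ¬ HasPack G 3 X k := by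
  intro hp
  have hd : Disjoint ((P \ Q).biUnion id) X := by
    apply Finset.disjoint_of_subset_right hX
    rw [Finset.disjoint_union_right]
    refine ⟨h.hP.disj_biUnion Finset.sdiff_subset hQ Finset.sdiff_disjoint, ?_⟩
    exact Finset.disjoint_of_subset_left
      (Finset.biUnion_subset_biUnion_of_subset_left id Finset.sdiff_subset) Finset.disjoint_sdiff
  have := exch h.hP hQ hp hd
  have hc := Finset.card_le_card hQ
  rw [show P.card - Q.card + k = P.card + 1 by omega] at this
  apply h.nop
  apply this.mono
  apply Finset.union_subset
  · exact (Finset.biUnion_subset_biUnion_of_subset_left id Finset.sdiff_subset).trans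
      h.hP.biUnion_subset
  · apply hX.trans
    apply Finset.union_subset _ Finset.sdiff_subset
    exact (Finset.biUnion_subset_biUnion_of_subset_left id hQ).trans h.hP.biUnion_subset

lemma Cfg.noR (h : Cfg G W P M v) : ¬ HasPack G 3 (W \ P.biUnion id) 1 :=
  h.L0 (Finset.empty_subset P) Finset.subset_union_right (by simp)

lemma Cfg.hmx (h : Cfg G W P M v) : ¬ HasPack G 2 (W \ P.biUnion id) (M.card + 1) :=
  h.hmax _ h.hP.biUnion_subset ⟨P, h.hP.sub (Finset.Subset.refl _), rfl⟩ h.hvP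

lemma Cfg.vR (h : Cfg G W P M v) : v ∈ W \ P.biUnion id := Finset.mem_sdiff.2 ⟨h.hv, h.hvP⟩

lemma Cfg.core (h : Cfg G W P M v) {Q : Finset (Finset V)} (hQ : Q ⊆ P) {C : Finset V}
    (hCQ : C ⊆ Q.biUnion id) (hC : G.IsClique C) {y : V} (hy : y ∈ Q.biUnion id) (hyC : y ∉ C)
    {k : ℕ} (hk : 3 * k + 2 ≤ C.card) (hQk : Q.card = k + 1) {e : Finset V} (he : e ∈ M)
    (hf : Full G y e) {c : V} (hc : c ∈ W \ P.biUnion id) (hce : c ∉ e) {p p' : V}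
    (hp : p ∈ C) (hp' : p' ∈ C) (hne : p ≠ p') (h1 : G.Adj p c) (h2 : G.Adj p' c) : False := by
  have hQP : Q.biUnion id ⊆ P.biUnion id := Finset.biUnion_subset_biUnion_of_subset_left id hQ
  have hcP := (Finset.mem_sdiff.1 hc).2
  have hcC : c ∉ C := fun hh => hcP (hQP (hCQ hh))
  have t1 := clique_tri hC hp hp' hne hcC h1 h2 hk
  have t2 := full_tri (h.hM.1 e he).1 hf
  have hd : Disjoint (insert c C) (insert y e) := by
    rw [Finset.disjoint_left]
    intro x hx hx'
    rcases Finset.mem_insert.1 hx with rfl | hx <;> rcases Finset.mem_insert.1 hx' with rfl | hx'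
    · exact hcP (hQP hy)
    · exact hce hx'
    · exact hyC hx
    · exact (Finset.mem_sdiff.1 ((h.hM.1 e he).2 hx')).2 (hQP (hCQ hx))
  refine h.L0 hQ ?_ (k := k + 1 + 1) (by omega) (t1.union (by norm_num) t2 hd)
  apply Finset.union_subset
  · exact Finset.insert_subset (Finset.mem_union_right _ hc) (hCQ.trans Finset.subset_union_left)
  · exact Finset.insert_subset (Finset.mem_union_left _ hy)
      ((h.hM.1 e he).2.trans Finset.subset_union_right)

lemma Cfg.L4 (h : Cfg G W P M v) {Q : Finset (Finset V)} (hQ : Q ⊆ P) {C : Finset V}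
    (hCQ : C ⊆ Q.biUnion id) (hC : G.IsClique C) {y : V} (hy : y ∈ Q.biUnion id) (hyC : y ∉ C)
    {k : ℕ} (hk : 3 * k + 2 ≤ C.card) (hQk : Q.card = k + 1) (hh : Head G M y) :
    E G C (W \ P.biUnion id) ≤ (W \ P.biUnion id).card := by
  apply E_disj
  intro c hc p hp p' hp' hne h1 h2
  obtain ⟨e, he, e', he', hee, hf, hf'⟩ := hh
  by_cases hce : c ∈ e
  · have hce' : c ∉ e' := fun hx => Finset.disjoint_left.1 (h.hM.2 e he e' he' hee) hce hx
    exact h.core hQ hCQ hC hy hyC hk hQk he' hf' hc hce' hp hp' hne h1 h2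
  · exact h.core hQ hCQ hC hy hyC hk hQk he hf hc hce hp hp' hne h1 h2

end cfg

section cfg3
variable {V : Type} [DecidableEq V] {G : SimpleGraph V} {W : Finset V}
  {P M : Finset (Finset V)} {v : V}

lemma Cfg.cardU (h : Cfg G W P M v) {Q : Finset (Finset V)} (hQ : Q ⊆ P) :
    (Q.biUnion id).card = 3 * Q.card := (h.hP.sub hQ).card_biUnion

lemma Cfg.L5 (h : Cfg G W P M v) {Q : Finset (Finset V)} (hQ : Q ⊆ P)
    (hC : G.IsClique (Q.biUnion id : Finset V)) {k : ℕ} (hk : Q.card = k + 1) {u : V}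
    (hu : u ∈ Q.biUnion id) (hH : ¬ Head G M u) {e : Finset V} (he : e ∈ M) (hf : Full G u e) :
    E G (Q.biUnion id) (W \ P.biUnion id) ≤
      3 * M.card + 2 * ((W \ P.biUnion id) \ M.biUnion id).card + 6 * k + 3 := by
  have hUc := h.cardU hQ
  set U := Q.biUnion id with hU
  set R := W \ P.biUnion id with hR
  have hu1 : ({u} : Finset V) ⊆ U := by simpa using hu
  have heR : e ⊆ R := (h.hM.1 e he).2
  have hec : e.card = 2 := (h.hM.1 e he).1.2
  have c1 : (U \ {u}).card = 3 * k + 2 := by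
    rw [Finset.card_sdiff_of_subset hu1, hUc, hk, Finset.card_singleton]; omega
  have a1 : E G (U \ {u}) (R \ e) ≤ (R \ e).card := by
    apply E_disj
    intro c hc p hp p' hp' hne h1 h2
    rw [Finset.mem_sdiff] at hc
    exact h.core hQ (C := U \ {u}) Finset.sdiff_subset
      (hC.subset (by exact_mod_cast Finset.sdiff_subset)) hu (by simp) c1.ge hk he hf hc.1 hc.2
      hp hp' hne h1 h2
  have a2 := E_le (G := G) (U \ {u}) e
  have a3 := E_split_right (G := G) heR (U \ {u})
  have a4 := E_split_left (G := G) hu1 R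
  have hMR : M.biUnion id ⊆ R := h.hM.biUnion_subset
  have a5 := E_split_right (G := G) hMR {u}
  have a6 := E_le (G := G) {u} (R \ M.biUnion id)
  have a7 : E G {u} (M.biUnion id) ≤ M.card + 1 := by
    rw [E_biUnion_right M h.hM.2, ← Finset.add_sum_erase _ _ he]
    have b1 := E_le (G := G) {u} e
    have b2 : ∑ e' ∈ M.erase e, E G {u} e' ≤ ∑ e' ∈ M.erase e, (1 : ℤ) := by
      apply Finset.sum_le_sum
      intro e' he'
      rw [Finset.mem_erase] at he'
      apply not_full_le (h.hM.1 e' he'.2).1.2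
      intro hf'
      exact hH ⟨e, he, e', he'.2, he'.1.symm, hf, hf'⟩
    have b3 := Finset.card_erase_add_one he
    rw [Finset.sum_const] at b2
    rw [hec] at b1
    simp at b1 b2
    omega
  have a8 : (R.card : ℤ) = 2 * M.card + (R \ M.biUnion id).card := mant_card h.hM
  have a9 := Finset.card_sdiff_add_card_eq_card heR
  rw [c1, hec] at a2
  rw [hec] at a9
  simp only [Finset.card_singleton] at a6
  push_cast at a2 a6
  omega

lemma Cfg.L6x (h : Cfg G W P M v) {Q : Finset (Finset V)} (hQ : Q ⊆ P)
    (hC : G.IsClique (Q.biUnion id : Finset V)) {k : ℕ} (hk : Q.card = k + 1) {a u u' w b : V}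
    (ha : a ∈ (W \ P.biUnion id) \ M.biUnion id) (hav : a ≠ v)
    (hb : b ∈ (W \ P.biUnion id) \ M.biUnion id) (hba : b ≠ a)
    (hu : u ∈ Q.biUnion id) (hu' : u' ∈ Q.biUnion id) (hw : w ∈ Q.biUnion id)
    (huu' : u ≠ u') (hwu : w ≠ u) (hwu' : w ≠ u') (h1 : G.Adj u a) (h2 : G.Adj u' a)
    (h3 : G.Adj w b) : False := by
  have hUc := h.cardU hQ
  have hQP : Q.biUnion id ⊆ P.biUnion id := Finset.biUnion_subset_biUnion_of_subset_left id hQ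
  have hQP' : (P \ Q).biUnion id ⊆ P.biUnion id :=
    Finset.biUnion_subset_biUnion_of_subset_left id Finset.sdiff_subset
  have hPW := h.hP.biUnion_subset
  have hdQ := h.hP.disj_biUnion Finset.sdiff_subset hQ Finset.sdiff_disjoint
  have hvP := h.hvP
  have hMR := h.hM.biUnion_subset
  have hvM := h.hM
  set U := Q.biUnion id with hU
  set D := (P \ Q).biUnion id with hD
  set B := P.biUnion id with hB
  simp only [Finset.mem_sdiff] at ha hb
  have hsub : ({u, u', w} : Finset V) ⊆ U := by
    intro x hx
    simp only [Finset.mem_insert, Finset.mem_singleton] at hx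
    rcases hx with rfl | rfl | rfl <;> assumption
  have hc3 : ({u, u', w} : Finset V).card = 3 := by
    rw [Finset.card_eq_three]; exact ⟨u, u', w, huu', hwu.symm, hwu'.symm, rfl⟩
  have p1 : HasPack G 3 (U \ {u, u', w}) k := by
    apply HasPack.clique (hC.subset (by exact_mod_cast Finset.sdiff_subset))
    rw [Finset.card_sdiff_of_subset hsub, hc3]; omega
  have p2 : HasPack G 3 {u, u', a} 1 := HasPack.tri (hC hu hu' huu') h1 h2
  have haU : a ∉ U := fun hx => ha.1.2 (hQP hx)
  have d12 : Disjoint (U \ {u, u', w}) {u, u', a} := by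
    rw [Finset.disjoint_right]
    intro x hx
    simp only [Finset.mem_insert, Finset.mem_singleton] at hx
    rcases hx with rfl | rfl | rfl
    · simp
    · simp
    · simp [haU]
  have p3 := p1.union (by norm_num) p2 d12
  have hX1 : U \ {u, u', w} ∪ {u, u', a} ⊆ insert a (U.erase w) := by
    intro x hx
    simp only [Finset.mem_union, Finset.mem_sdiff, Finset.mem_insert, Finset.mem_singleton,
      Finset.mem_erase, not_or] at hx ⊢
    rcases hx with hx | rfl | rfl | rfl
    · exact Or.inr ⟨hx.2.2.2, hx.1⟩
    · exact Or.inr ⟨hwu.symm, hu⟩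
    · exact Or.inr ⟨hwu'.symm, hu'⟩
    · exact Or.inl rfl
  have p4 := p3.mono hX1
  have hd : Disjoint D (insert a (U.erase w)) := by
    rw [Finset.disjoint_right]
    intro x hx hxD
    rcases Finset.mem_insert.1 hx with rfl | hx
    · exact ha.1.2 (hQP' hxD)
    · exact Finset.disjoint_left.1 hdQ hxD (Finset.mem_of_mem_erase hx)
  have p5 := exch h.hP hQ p4 hd
  have hcc := Finset.card_le_card hQ
  rw [show P.card - Q.card + (k + 1) = P.card by omega] at p5
  rw [← hD] at p5
  have hmem : ∀ x, x ∈ D ∪ insert a (U.erase w) → x ∈ B ∧ x ≠ w ∨ x = a := by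
    intro x hx
    rcases Finset.mem_union.1 hx with hxD | hx
    · left
      refine ⟨hQP' hxD, ?_⟩
      rintro rfl
      exact Finset.disjoint_left.1 hdQ hxD hw
    · rcases Finset.mem_insert.1 hx with rfl | hx
      · right; rfl
      · left; rw [Finset.mem_erase] at hx; exact ⟨hQP hx.2, hx.1⟩
  refine h.hmax _ ?_ p5 ?_ ?_
  · intro x hx
    rcases hmem x hx with hx | rfl
    · exact hPW hx.1
    · exact ha.1.1
  · intro hx
    rcases hmem v hx with hx | hx
    · exact hvP hx.1
    · exact hav hx.symm
  · have q1 : HasPack G 2 (M.biUnion id) M.card := ⟨M, hvM.sub (Finset.Subset.refl _), rfl⟩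
    have q2 : HasPack G 2 ({w, b} : Finset V) 1 := HasPack.single (two_clique h3)
    apply q1.union' (by norm_num) q2
    · rw [Finset.disjoint_right]
      intro x hx hxM
      simp only [Finset.mem_insert, Finset.mem_singleton] at hx
      rcases hx with rfl | rfl
      · exact (Finset.mem_sdiff.1 (hMR hxM)).2 (hQP hw)
      · exact hb.2 hxM
    · intro x hx
      rw [Finset.mem_sdiff]
      rcases Finset.mem_union.1 hx with hx | hx
      · have := Finset.mem_sdiff.1 (hMR hx)
        refine ⟨this.1, fun hx' => ?_⟩
        rcases hmem x hx' with hx' | rfl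
        · exact this.2 hx'.1
        · exact ha.2 hx
      · simp only [Finset.mem_insert, Finset.mem_singleton] at hx
        rcases hx with rfl | rfl
        · refine ⟨hPW (hQP hw), fun hx' => ?_⟩
          rcases hmem x hx' with hx' | rfl
          · exact hx'.2 rfl
          · exact haU hw
        · refine ⟨hb.1.1, fun hx' => ?_⟩
          rcases hmem x hx' with hx' | rfl
          · exact hb.1.2 hx'.1
          · exact hba rfl

lemma Cfg.L6 (h : Cfg G W P M v) {Q : Finset (Finset V)} (hQ : Q ⊆ P)
    (hC : G.IsClique (Q.biUnion id : Finset V)) {k : ℕ} (hk : Q.card = k + 1) :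
    E G (Q.biUnion id) ((W \ P.biUnion id) \ M.biUnion id) ≤
      2 * ((W \ P.biUnion id) \ M.biUnion id).card + 3 * k + 1 := by
  have hUc := h.cardU hQ
  by_cases hex : ∃ a ∈ (W \ P.biUnion id) \ M.biUnion id, a ≠ v ∧ ∃ u ∈ Q.biUnion id,
      ∃ u' ∈ Q.biUnion id, u ≠ u' ∧ G.Adj u a ∧ G.Adj u' a
  · obtain ⟨a, ha, hav, u, hu, u', hu', hne, h1, h2⟩ := hex
    have key : ∀ w ∈ Q.biUnion id \ {u, u'}, ∀ b ∈ (W \ P.biUnion id) \ M.biUnion id, b ≠ a →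
        ¬ G.Adj w b := by
      intro w hw b hb hba h3
      simp only [Finset.mem_sdiff, Finset.mem_insert, Finset.mem_singleton, not_or] at hw
      exact h.L6x hQ hC hk ha hav hb hba hu hu' hw.1 hne hw.2.1 hw.2.2 h1 h2 h3
    set U := Q.biUnion id
    set I := (W \ P.biUnion id) \ M.biUnion id
    have hs : ({u, u'} : Finset V) ⊆ U := by
      intro x hx
      simp only [Finset.mem_insert, Finset.mem_singleton] at hx
      rcases hx with rfl | rfl <;> assumption
    have e1 := E_split_left (G := G) hs I
    have e2 := E_le (G := G) {u, u'} I
    have hsa : ({a} : Finset V) ⊆ I := by simpa using ha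
    have e3 := E_split_right (G := G) hsa (U \ {u, u'})
    have e4 := E_le (G := G) (U \ {u, u'}) {a}
    have e5 : E G (U \ {u, u'}) (I \ {a}) = 0 :=
      Finset.sum_eq_zero fun x hx => Finset.sum_eq_zero fun y hy => ad_not (by
        simp only [Finset.mem_sdiff, Finset.mem_singleton] at hy
        exact key x hx y hy.1 hy.2)
    rw [Finset.card_pair hne] at e2
    rw [Finset.card_sdiff_of_subset hs, hUc, Finset.card_pair hne, hk] at e4
    simp only [Finset.card_singleton] at e4
    push_cast at e2 e4
    omega
  · push Not at hex
    set U := Q.biUnion id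
    set I := (W \ P.biUnion id) \ M.biUnion id
    have dis : E G U (I.erase v) ≤ (I.erase v).card := by
      apply E_disj
      intro c hc p hp p' hp' hne h1 h2
      rw [Finset.mem_erase] at hc
      exact hex c hc.2 hc.1 p hp p' hp' hne h1 h2
    by_cases hvI : v ∈ I
    · have hsv : ({v} : Finset V) ⊆ I := by simpa using hvI
      have e3 := E_split_right (G := G) hsv U
      have e4 := E_le (G := G) U {v}
      have e5 := Finset.card_erase_add_one hvI
      rw [Finset.sdiff_singleton_eq_erase] at e3
      rw [hUc, hk] at e4
      simp only [Finset.card_singleton] at e4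
      push_cast at e4
      omega
    · rw [Finset.erase_eq_of_notMem hvI] at dis
      omega

lemma Cfg.nofullM (h : Cfg G W P M v) {X : Finset V} (hn : ∀ u ∈ X, ∀ e ∈ M, ¬ Full G u e) :
    E G X (M.biUnion id) ≤ X.card * M.card :=
  mant_M h.hM X fun w hw e he => not_full_le (h.hM.1 e he).1.2 (hn w hw e he)

lemma Cfg.L7 (h : Cfg G W P M v) {Q : Finset (Finset V)} (hQ : Q ⊆ P)
    (hC : G.IsClique (Q.biUnion id : Finset V)) (hk : Q.card = 3)
    (hn : ∀ u ∈ Q.biUnion id, ∀ e ∈ M, ¬ Full G u e) :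
    E G (Q.biUnion id) (M.biUnion id) ≤ 6 * M.card + 8 := by
  have hUc := h.cardU hQ
  have hQP : Q.biUnion id ⊆ P.biUnion id := Finset.biUnion_subset_biUnion_of_subset_left id hQ
  have hXc := h.hM.card_biUnion
  have hXR := h.hM.biUnion_subset
  have hno := fun (Y : Finset V) hY => h.L0 hQ (X := Y) hY (k := 4) (by omega)
  have hXU : ∀ x ∈ M.biUnion id, x ∉ Q.biUnion id := fun x hx hx' =>
    (Finset.mem_sdiff.1 (hXR hx)).2 (hQP hx')
  set U := Q.biUnion id
  set X := M.biUnion id with hX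
  have pairs : ∀ (U' : Finset V), U' ⊆ U → ∀ p ∈ U', ∀ p' ∈ U', p ≠ p' →
      ({p, p'} : Finset V) ⊆ U' ∧ (U' \ {p, p'}).card + 2 = U'.card ∧ U' \ {p, p'} ⊆ U ∧
        E G {p, p'} X ≤ 2 * M.card := by
    intro U' hU' p hp p' hp' hne
    have hs : ({p, p'} : Finset V) ⊆ U' := by
      intro x hx
      simp only [Finset.mem_insert, Finset.mem_singleton] at hx
      rcases hx with rfl | rfl <;> assumption
    have := Finset.card_sdiff_add_card_eq_card hs
    rw [Finset.card_pair hne] at this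
    refine ⟨hs, this, Finset.sdiff_subset.trans hU', ?_⟩
    have := h.nofullM (X := {p, p'}) fun u hu => hn u (hU' (hs hu))
    rw [Finset.card_pair hne] at this
    exact_mod_cast this
  by_cases h1 : ∃ c ∈ X, ∃ p ∈ U, ∃ p' ∈ U, p ≠ p' ∧ G.Adj p c ∧ G.Adj p' c
  swap
  · push Not at h1
    have := E_disj (G := G) U X fun c hc p hp p' hp' hne a b => h1 c hc p hp p' hp' hne a b
    rw [hXc] at this; push_cast at this; omega
  obtain ⟨c1, hc1, p1, hp1, p1', hp1', hne1, ha1, hb1⟩ := h1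
  obtain ⟨s1, n1, u1, e1⟩ := pairs U (Finset.Subset.refl _) p1 hp1 p1' hp1' hne1
  have x1 : ({c1} : Finset V) ⊆ X := by simpa using hc1
  have y1 := Finset.card_sdiff_add_card_eq_card x1
  rw [Finset.card_singleton] at y1
  have z1 := E_split_left (G := G) s1 X
  have w1 := E_split_right (G := G) x1 (U \ {p1, p1'})
  have v1 := E_le (G := G) (U \ {p1, p1'}) {c1}
  rw [Finset.card_singleton] at v1
  set U1 := U \ {p1, p1'} with hU1
  set X1 := X \ {c1} with hX1
  by_cases h2 : ∃ c ∈ X1, ∃ p ∈ U1, ∃ p' ∈ U1, p ≠ p' ∧ G.Adj p c ∧ G.Adj p' c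
  swap
  · push Not at h2
    have := E_disj (G := G) U1 X1 fun c hc p hp p' hp' hne a b => h2 c hc p hp p' hp' hne a b
    push_cast at v1
    omega
  obtain ⟨c2, hc2, p2, hp2, p2', hp2', hne2, ha2, hb2⟩ := h2
  obtain ⟨s2, n2, u2, e2⟩ := pairs U1 u1 p2 hp2 p2' hp2' hne2
  have x2 : ({c2} : Finset V) ⊆ X1 := by simpa using hc2
  have y2 := Finset.card_sdiff_add_card_eq_card x2
  rw [Finset.card_singleton] at y2
  have z2 := E_split_left (G := G) s2 X
  have w2 := E_split_right (G := G) x1 (U1 \ {p2, p2'})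
  rw [← hX1] at w2
  have w2' := E_split_right (G := G) x2 (U1 \ {p2, p2'})
  have v2 := E_le (G := G) (U1 \ {p2, p2'}) {c1}
  have v2' := E_le (G := G) (U1 \ {p2, p2'}) {c2}
  rw [Finset.card_singleton] at v2 v2'
  set U2 := U1 \ {p2, p2'} with hU2
  set X2 := X1 \ {c2} with hX2
  by_cases h3 : ∃ c ∈ X2, ∃ p ∈ U2, ∃ p' ∈ U2, p ≠ p' ∧ G.Adj p c ∧ G.Adj p' c
  swap
  · push Not at h3
    have := E_disj (G := G) U2 X2 fun c hc p hp p' hp' hne a b => h3 c hc p hp p' hp' hne a b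
    push_cast at v1 v2 v2'
    omega
  exfalso
  obtain ⟨c3, hc3, p3, hp3, p3', hp3', hne3, ha3, hb3⟩ := h3
  have hp2U := u1 hp2
  have hp2U' := u1 hp2'
  have hp3U := u2 hp3
  have hp3U' := u2 hp3'
  have k1 : HasPack G 3 (insert c3 U2) (1 + 1) :=
    clique_tri (hC.subset (by exact_mod_cast u2)) hp3 hp3' hne3
      (fun hx => hXU c3 (by
        simp only [hX2, hX1, Finset.mem_sdiff] at hc3; exact hc3.1.1) (u2 hx)) ha3 hb3 (by omega)
  have k2 : HasPack G 3 {p2, p2', c2} 1 := HasPack.tri (hC hp2U hp2U' hne2) ha2 hb2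
  have k3 : HasPack G 3 {p1, p1', c1} 1 := HasPack.tri (hC hp1 hp1' hne1) ha1 hb1
  simp only [hX2, hX1, Finset.mem_sdiff, Finset.mem_singleton] at hc3 hc2
  have g1 := hXU c1 hc1
  have g2 := hXU c2 hc2.1
  have g3 := hXU c3 hc3.1.1
  have d1 : Disjoint (insert c3 U2) {p2, p2', c2} := by
    rw [Finset.disjoint_right]
    intro x hx
    simp only [Finset.mem_insert, Finset.mem_singleton] at hx
    rw [Finset.mem_insert, not_or]
    rcases hx with rfl | rfl | rfl
    · refine ⟨?_, by simp [hU2]⟩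
      rintro rfl; exact g3 hp2U
    · refine ⟨?_, by simp [hU2]⟩
      rintro rfl; exact g3 hp2U'
    · exact ⟨fun hx => hc3.2 hx.symm, fun hx => g2 (u2 hx)⟩
  have k4 := k1.union (by norm_num) k2 d1
  have d2 : Disjoint (insert c3 U2 ∪ {p2, p2', c2}) {p1, p1', c1} := by
    rw [Finset.disjoint_right]
    intro x hx hx'
    have hx'' : x = c3 ∨ x ∈ U1 ∨ x = c2 := by
      simp only [Finset.mem_insert, Finset.mem_union, Finset.mem_singleton] at hx'
      rcases hx' with (rfl | hx') | rfl | rfl | rfl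
      · exact Or.inl rfl
      · exact Or.inr (Or.inl (Finset.sdiff_subset hx'))
      · exact Or.inr (Or.inl hp2)
      · exact Or.inr (Or.inl hp2')
      · exact Or.inr (Or.inr rfl)
    simp only [Finset.mem_insert, Finset.mem_singleton] at hx
    rcases hx'' with rfl | hy | rfl
    · rcases hx with rfl | rfl | rfl
      · exact g3 hp1
      · exact g3 hp1'
      · exact hc3.1.2 rfl
    · rcases hx with rfl | rfl | rfl
      · simp [hU1] at hy
      · simp [hU1] at hy
      · exact g1 (u1 hy)
    · rcases hx with rfl | rfl | rfl
      · exact g2 hp1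
      · exact g2 hp1'
      · exact hc2.2 rfl
  have k5 := k4.union (by norm_num) k3 d2
  refine hno _ ?_ k5
  intro x hx
  simp only [Finset.mem_insert, Finset.mem_union, Finset.mem_singleton] at hx
  rw [Finset.mem_union]
  rcases hx with ((rfl | hx) | rfl | rfl | rfl) | rfl | rfl | rfl
  · exact Or.inr (hXR hc3.1.1)
  · exact Or.inl (u2 hx)
  · exact Or.inl hp2U
  · exact Or.inl hp2U'
  · exact Or.inr (hXR hc2.1)
  · exact Or.inl hp1
  · exact Or.inl hp1'
  · exact Or.inr (hXR hc1)

end cfg3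

def IsA {V : Type} (G : SimpleGraph V) (M : Finset (Finset V)) (T : Finset V) : Prop :=
  ∃ y ∈ T, Head G M y

open Classical in
noncomputable def hd {V : Type} (G : SimpleGraph V) (M : Finset (Finset V)) (v : V)
    (T : Finset V) : V := if h : IsA G M T then h.choose else v

open Classical in
noncomputable def ms {V : Type} (G : SimpleGraph V) (M : Finset (Finset V)) (v : V)
    (T T' : Finset V) : ℤ := if IsA G M T then 3 - E G {hd G M v T} T' else 0

noncomputable def phi {V : Type} (G : SimpleGraph V) (M : Finset (Finset V)) (v : V)
    (T T' : Finset V) : ℤ := E G T T' + ms G M v T T' + ms G M v T' T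

section cfg4
variable {V : Type} [DecidableEq V] {G : SimpleGraph V} {W : Finset V}
  {P M : Finset (Finset V)} {v : V}

noncomputable def miss (G : SimpleGraph V) (P M : Finset (Finset V)) (v : V)
    (T : Finset V) : ℤ := ∑ T' ∈ P.erase T, ms G M v T T'

noncomputable def lam (G : SimpleGraph V) (W : Finset V) (P M : Finset (Finset V)) (v : V)
    (T : Finset V) : ℤ :=
  3 * M.card + 2 * ((W \ P.biUnion id) \ M.biUnion id).card + 4
    - (E G T (W \ P.biUnion id) - miss G P M v T)

lemma hd_mem {T : Finset V} (h : IsA G M T) : hd G M v T ∈ T := by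
  unfold hd; rw [dif_pos h]; exact h.choose_spec.1

lemma hd_head {T : Finset V} (h : IsA G M T) : Head G M (hd G M v T) := by
  unfold hd; rw [dif_pos h]; exact h.choose_spec.2

lemma miss_B {T : Finset V} (h : ¬ IsA G M T) : miss G P M v T = 0 := by
  unfold miss ms; simp [h]

lemma phi_comm (T T' : Finset V) : phi G M v T T' = phi G M v T' T := by
  unfold phi; rw [E_comm]; ring

lemma Cfg.BU (h : Cfg G W P M v) {Q : Finset (Finset V)} (hQ : Q ⊆ P)
    (hC : G.IsClique (Q.biUnion id : Finset V)) {k : ℕ} (hk : Q.card = k + 1)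
    (hB : ∀ T ∈ Q, ¬ IsA G M T) :
    E G (Q.biUnion id) (W \ P.biUnion id) ≤
      3 * M.card + 2 * ((W \ P.biUnion id) \ M.biUnion id).card + 6 * k + 3 ∨
    (E G (Q.biUnion id) (W \ P.biUnion id) ≤
      3 * (k + 1) * M.card + 2 * ((W \ P.biUnion id) \ M.biUnion id).card + 3 * k + 1 ∧
      (k = 2 → E G (Q.biUnion id) (W \ P.biUnion id) ≤
      6 * M.card + 2 * ((W \ P.biUnion id) \ M.biUnion id).card + 15)) := by
  by_cases hf : ∃ u ∈ Q.biUnion id, ∃ e ∈ M, Full G u e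
  · left
    obtain ⟨u, hu, e, he, hf⟩ := hf
    refine h.L5 hQ hC hk hu ?_ he hf
    intro hH
    obtain ⟨T, hT, hu⟩ := Finset.mem_biUnion.1 hu
    exact hB T hT ⟨u, hu, hH⟩
  · right
    push Not at hf
    have a1 := h.L6 hQ hC hk
    have a2 := h.nofullM hf
    have a3 := E_split_right (G := G) h.hM.biUnion_subset (Q.biUnion id)
    rw [h.cardU hQ, hk] at a2
    constructor
    · rw [a3]; push_cast at a2; linarith
    · rintro rfl
      have a4 := h.L7 hQ hC hk hf
      rw [a3]; push_cast at a1; linarith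

lemma Cfg.vcard (h : Cfg G W P M v) :
    E G {v} (W \ P.biUnion id) ≤ M.card + ((W \ P.biUnion id) \ M.biUnion id).card :=
  mant_v h.hM h.noR h.vR

lemma Cfg.cT (h : Cfg G W P M v) {T : Finset V} (hT : T ∈ P) : T.card = 3 := (h.hP.1 T hT).1.2

lemma Cfg.clT (h : Cfg G W P M v) {T : Finset V} (hT : T ∈ P) : G.IsClique T := (h.hP.1 T hT).1.1

lemma Cfg.cT' (h : Cfg G W P M v) {T : Finset V} (hT : T ∈ P) (hA : IsA G M T) :
    (T.erase (hd G M v T)).card = 2 := by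
  rw [Finset.card_erase_of_mem (hd_mem hA), h.cT hT]

lemma Cfg.clT' (h : Cfg G W P M v) {T : Finset V} (hT : T ∈ P) (y : V) :
    G.IsClique (T.erase y : Finset V) :=
  (h.clT hT).subset (by exact_mod_cast Finset.erase_subset _ _)

lemma E_erase {T : Finset V} {y : V} (hy : y ∈ T) (X : Finset V) :
    E G T X = E G {y} X + E G (T.erase y) X := by
  rw [← Finset.sdiff_singleton_eq_erase]
  exact E_split_left (by simpa using hy) X

lemma Cfg.degA (h : Cfg G W P M v) {T : Finset V} (hT : T ∈ P) (hA : IsA G M T) :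
    E G {hd G M v T} (W \ P.biUnion id) - miss G P M v T ≤ E G {v} (W \ P.biUnion id) + 1 := by
  have hmem := hd_mem (v := v) hA
  set y := hd G M v T with hy
  have d := h.hdeg y ((h.hP.1 T hT).2 hmem)
  have e1 := E_split_right (G := G) h.hP.biUnion_subset {y}
  have e2 := E_split_right (G := G) h.hP.biUnion_subset {v}
  have e3 := E_le (G := G) {v} (P.biUnion id)
  rw [h.hP.card_biUnion, Finset.card_singleton] at e3
  rw [E_biUnion_right P h.hP.2 {y}, ← Finset.add_sum_erase _ _ hT] at e1
  have e4 : E G {y} T = 2 := by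
    rw [E_comm, E_erase hmem, E_single, ad_self]
    unfold E
    rw [Finset.sum_congr rfl (g := fun _ => (1 : ℤ))]
    · have := h.cT' hT hA
      rw [← hy] at this
      simp [this]
    · intro x hx
      rw [Finset.mem_erase] at hx
      simp only [Finset.sum_singleton]
      exact ad_adj (h.clT hT hx.2 hmem hx.1)
  have e5 : miss G P M v T = 3 * (P.card - 1) - ∑ T' ∈ P.erase T, E G {y} T' := by
    unfold miss ms
    simp only [hA, if_true]
    rw [Finset.sum_sub_distrib, Finset.sum_const]
    have := Finset.card_erase_add_one hT
    have : ((P.erase T).card : ℤ) = P.card - 1 := by omega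
    rw [nsmul_eq_mul, this]; ring
  push_cast at e3
  linarith

lemma Cfg.lamA (h : Cfg G W P M v) {T : Finset V} (hT : T ∈ P) (hA : IsA G M T) :
    2 * M.card + ((W \ P.biUnion id) \ M.biUnion id).card + 3
      - E G (T.erase (hd G M v T)) (W \ P.biUnion id) ≤ lam G W P M v T := by
  have a1 := h.degA hT hA
  have a2 := h.vcard
  have a3 := E_erase (G := G) (hd_mem (v := v) hA) (W \ P.biUnion id)
  unfold lam
  linarith

lemma Cfg.lamB (_h : Cfg G W P M v) {T : Finset V} (hA : ¬ IsA G M T) :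
    lam G W P M v T = 3 * M.card + 2 * ((W \ P.biUnion id) \ M.biUnion id).card + 4
      - E G T (W \ P.biUnion id) := by
  unfold lam; rw [miss_B hA]; ring

lemma Cfg.lam_nonneg (h : Cfg G W P M v) {T : Finset V} (hT : T ∈ P) : 0 ≤ lam G W P M v T := by
  have hs : ({T} : Finset (Finset V)) ⊆ P := by simpa using hT
  have hu : ({T} : Finset (Finset V)).biUnion id = T := by simp
  by_cases hA : IsA G M T
  · have a1 := h.lamA hT hA
    have a2 := h.L4 hs (C := T.erase (hd G M v T)) (by rw [hu]; exact Finset.erase_subset _ _)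
      (h.clT' hT _) (y := hd G M v T) (by rw [hu]; exact hd_mem hA) (by simp) (k := 0)
      (by rw [h.cT' hT hA]) (by simp) (hd_head hA)
    have a3 := mant_card h.hM
    linarith
  · rw [h.lamB hA]
    have := h.BU hs (by rw [hu]; exact h.clT hT) (k := 0) (by simp) (by simpa using hA)
    rw [hu] at this
    push_cast at this
    rcases this with this | this
    · linarith
    · linarith [this.1]

lemma phi_AB {T T' : Finset V} (hA : IsA G M T) (hB : ¬ IsA G M T') :
    phi G M v T T' = 3 + E G (T.erase (hd G M v T)) T' := by
  unfold phi ms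
  rw [if_pos hA, if_neg hB, E_erase (hd_mem (v := v) hA)]; ring

lemma phi_BB {T T' : Finset V} (hA : ¬ IsA G M T) (hB : ¬ IsA G M T') :
    phi G M v T T' = E G T T' := by
  unfold phi ms
  rw [if_neg hA, if_neg hB]; ring

lemma Cfg.phi_AA (h : Cfg G W P M v) {T T' : Finset V} (hT : T ∈ P) (hT' : T' ∈ P) (hne : T ≠ T')
    (hA : IsA G M T) (hA' : IsA G M T') : phi G M v T T' ≤ 8 := by
  have m1 := hd_mem (v := v) hA
  have m2 := hd_mem (v := v) hA'
  have e0 : phi G M v T T' = E G (T.erase (hd G M v T)) (T'.erase (hd G M v T'))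
      + 6 - ad G (hd G M v T') (hd G M v T) := by
    unfold phi ms
    rw [if_pos hA, if_pos hA']
    have a1 := E_erase (G := G) m1 T'
    have a2 := E_erase (G := G) m2 (T.erase (hd G M v T))
    have a3 := E_erase (G := G) m1 {hd G M v T'}
    rw [E_single] at a3
    rw [E_comm, E_comm _ (T.erase (hd G M v T))] at a2
    rw [E_comm (T'.erase (hd G M v T'))] at a2
    rw [E_comm {hd G M v T'} T, a1, a2, a3, ad_comm]; ring
  have hd' := h.hP.2 T hT T' hT' hne
  have hs : ({T, T'} : Finset (Finset V)) ⊆ P := by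
    intro x hx
    simp only [Finset.mem_insert, Finset.mem_singleton] at hx
    rcases hx with rfl | rfl <;> assumption
  have hu : ({T, T'} : Finset (Finset V)).biUnion id = T ∪ T' := by simp
  have hno := fun (Y : Finset V) hY => h.L0 hs (X := Y) hY (k := 3) (by rw [Finset.card_pair hne])
  have e1 : E G (T.erase (hd G M v T)) (T'.erase (hd G M v T')) ≤
      (T'.erase (hd G M v T')).card := by
    apply E_disj
    intro c hc p hp p' hp' hpp h1 h2
    obtain ⟨e, he, _, _, _, hf, _⟩ := hd_head (v := v) hA
    have : ∃ e' ∈ M, e ≠ e' ∧ Full G (hd G M v T') e' := by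
      obtain ⟨e1, he1, e2, he2, hne', hf1, hf2⟩ := hd_head (v := v) hA'
      by_cases hh : e = e1
      · exact ⟨e2, he2, by rw [hh]; exact hne', hf2⟩
      · exact ⟨e1, he1, hh, hf1⟩
    obtain ⟨e', he', hee, hf'⟩ := this
    set y := hd G M v T
    set y' := hd G M v T'
    rw [Finset.mem_erase] at hc hp hp'
    have t1 := full_tri (h.hM.1 e he).1 hf
    have t2 := full_tri (h.hM.1 e' he').1 hf'
    have t3 : HasPack G 3 {p, p', c} 1 := HasPack.tri (h.clT hT hp.2 hp'.2 hpp) h1 h2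
    have R1 : ∀ x, x ∈ e → x ∉ P.biUnion id := fun x hx =>
      (Finset.mem_sdiff.1 ((h.hM.1 e he).2 hx)).2
    have R2 : ∀ x, x ∈ e' → x ∉ P.biUnion id := fun x hx =>
      (Finset.mem_sdiff.1 ((h.hM.1 e' he').2 hx)).2
    have S1 : ∀ x, x ∈ T → x ∈ P.biUnion id := fun x hx => Finset.mem_biUnion.2 ⟨T, hT, hx⟩
    have S2 : ∀ x, x ∈ T' → x ∈ P.biUnion id := fun x hx => Finset.mem_biUnion.2 ⟨T', hT', hx⟩
    have D := fun (x : V) (hx : x ∈ T) => Finset.disjoint_left.1 hd' hx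
    have De := fun (x : V) (hx : x ∈ e) => Finset.disjoint_left.1 (h.hM.2 e he e' he' hee) hx
    have d12 : Disjoint (insert y e) (insert y' e') := by
      rw [Finset.disjoint_left]
      intro x hx hx'
      rcases Finset.mem_insert.1 hx with hx | hx <;> rcases Finset.mem_insert.1 hx' with hx' | hx'
      · exact D x (hx ▸ m1) (hx' ▸ m2)
      · exact R2 x hx' (S1 x (hx ▸ m1))
      · exact R1 x hx (S2 x (hx' ▸ m2))
      · exact De x hx hx'
    have t4 := t1.union (by norm_num) t2 d12
    have d3 : Disjoint (insert y e ∪ insert y' e') {p, p', c} := by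
      rw [Finset.disjoint_right]
      intro x hx hx'
      have hxT : (x ∈ T ∧ x ≠ y) ∨ (x ∈ T' ∧ x ≠ y') := by
        simp only [Finset.mem_insert, Finset.mem_singleton] at hx
        rcases hx with rfl | rfl | rfl
        · exact Or.inl ⟨hp.2, hp.1⟩
        · exact Or.inl ⟨hp'.2, hp'.1⟩
        · exact Or.inr ⟨hc.2, hc.1⟩
      have hxP : x ∈ P.biUnion id := by
        rcases hxT with hx | hx
        · exact S1 x hx.1
        · exact S2 x hx.1
      simp only [Finset.mem_union, Finset.mem_insert] at hx'
      rcases hx' with (hx' | hx') | hx' | hx'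
      · rcases hxT with hx | hx
        · exact hx.2 hx'
        · exact D x (hx' ▸ m1) hx.1
      · exact R1 x hx' hxP
      · rcases hxT with hx | hx
        · exact D x hx.1 (hx' ▸ m2)
        · exact hx.2 hx'
      · exact R2 x hx' hxP
    refine hno _ ?_ (t4.union (by norm_num) t3 d3)
    rw [hu]
    intro x hx
    simp only [Finset.mem_union, Finset.mem_insert, Finset.mem_singleton] at hx ⊢
    rcases hx with ((rfl | hx) | rfl | hx) | rfl | rfl | rfl
    · exact Or.inl (Or.inl m1)
    · exact Or.inr ((h.hM.1 e he).2 hx)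
    · exact Or.inl (Or.inr m2)
    · exact Or.inr ((h.hM.1 e' he').2 hx)
    · exact Or.inl (Or.inl hp.2)
    · exact Or.inl (Or.inl hp'.2)
    · exact Or.inl (Or.inr hc.2)
  rw [h.cT' hT' hA'] at e1
  have := ad_nonneg (G := G) (hd G M v T') (hd G M v T)
  push_cast at e1
  omega

lemma Cfg.phi_le (h : Cfg G W P M v) {T T' : Finset V} (hT : T ∈ P) (hT' : T' ∈ P) (hne : T ≠ T') :
    phi G M v T T' ≤ 9 := by
  by_cases hA : IsA G M T <;> by_cases hA' : IsA G M T'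
  · linarith [h.phi_AA hT hT' hne hA hA']
  · rw [phi_AB hA hA']
    have := E_le (G := G) (T.erase (hd G M v T)) T'
    rw [h.cT' hT hA, h.cT hT'] at this
    push_cast at this; linarith
  · rw [phi_comm, phi_AB hA' hA]
    have := E_le (G := G) (T'.erase (hd G M v T')) T
    rw [h.cT' hT' hA', h.cT hT] at this
    push_cast at this; linarith
  · rw [phi_BB hA hA']
    have := E_le (G := G) T T'
    rw [h.cT hT, h.cT hT'] at this
    push_cast at this; linarith

lemma Cfg.K_AB (h : Cfg G W P M v) {T T' : Finset V} (hT : T ∈ P) (hT' : T' ∈ P)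
    (hA : IsA G M T) (hB : ¬ IsA G M T') (hK : 9 ≤ phi G M v T T') :
    ∀ x ∈ T.erase (hd G M v T), ∀ y ∈ T', G.Adj x y := by
  intro x hx y hy
  by_contra hn
  have := E_full_lt hx hy hn
  rw [phi_AB hA hB] at hK
  rw [h.cT' hT hA, h.cT hT'] at this
  push_cast at this; linarith

lemma Cfg.K_BB (h : Cfg G W P M v) {T T' : Finset V} (hT : T ∈ P) (hT' : T' ∈ P)
    (hA : ¬ IsA G M T) (hB : ¬ IsA G M T') (hK : 9 ≤ phi G M v T T') :
    ∀ x ∈ T, ∀ y ∈ T', G.Adj x y := by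
  intro x hx y hy
  by_contra hn
  have := E_full_lt hx hy hn
  rw [phi_BB hA hB] at hK
  rw [h.cT hT, h.cT hT'] at this
  push_cast at this; linarith

lemma clique_join {S T : Finset V} (hS : G.IsClique S) (hT : G.IsClique T)
    (key : ∀ x ∈ S, ∀ y ∈ T, G.Adj x y) : G.IsClique (S ∪ T : Finset V) := by
  intro x hx y hy hne
  rcases Finset.mem_union.1 (Finset.mem_coe.1 hx) with hx | hx <;>
    rcases Finset.mem_union.1 (Finset.mem_coe.1 hy) with hy | hy
  · exact hS hx hy hne
  · exact key x hx y hy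
  · exact (key y hy x hx).symm
  · exact hT hx hy hne

lemma Cfg.edge_AB (h : Cfg G W P M v) {T T' : Finset V} (hT : T ∈ P) (hT' : T' ∈ P) (hne : T ≠ T')
    (hA : IsA G M T) (hB : ¬ IsA G M T') (hK : 9 ≤ phi G M v T T') :
    (((W \ P.biUnion id) \ M.biUnion id).card : ℤ) ≤ lam G W P M v T + lam G W P M v T' := by
  have hs : ({T, T'} : Finset (Finset V)) ⊆ P := by
    intro x hx
    simp only [Finset.mem_insert, Finset.mem_singleton] at hx
    rcases hx with rfl | rfl <;> assumption
  have hu : ({T, T'} : Finset (Finset V)).biUnion id = T ∪ T' := by simp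
  have hdT := h.hP.2 T hT T' hT' hne
  have hdT' : Disjoint (T.erase (hd G M v T)) T' :=
    Finset.disjoint_of_subset_left (Finset.erase_subset _ _) hdT
  have m1 := hd_mem (v := v) hA
  have a1 := h.lamA hT hA
  have a2 := h.L4 hs (C := T.erase (hd G M v T) ∪ T')
    (by rw [hu]; exact Finset.union_subset_union_left (Finset.erase_subset _ _))
    (clique_join (h.clT' hT _) (h.clT hT') (h.K_AB hT hT' hA hB hK)) (y := hd G M v T)
    (by rw [hu]; exact Finset.mem_union_left _ m1)
    (by rw [Finset.mem_union, not_or]; exact ⟨by simp, Finset.disjoint_left.1 hdT m1⟩) (k := 1)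
    (by rw [Finset.card_union_of_disjoint hdT', h.cT' hT hA, h.cT hT'])
    (by rw [Finset.card_pair hne]) (hd_head hA)
  rw [E_union_left hdT'] at a2
  have a3 := mant_card h.hM
  rw [h.lamB hB]
  linarith

lemma Cfg.edge_BB (h : Cfg G W P M v) {T T' : Finset V} (hT : T ∈ P) (hT' : T' ∈ P) (hne : T ≠ T')
    (hA : ¬ IsA G M T) (hB : ¬ IsA G M T') (hK : 9 ≤ phi G M v T T')
    (hr : 9 ≤ (W \ P.biUnion id).card) :
    (((W \ P.biUnion id) \ M.biUnion id).card : ℤ) ≤ lam G W P M v T + lam G W P M v T' := by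
  have hs : ({T, T'} : Finset (Finset V)) ⊆ P := by
    intro x hx
    simp only [Finset.mem_insert, Finset.mem_singleton] at hx
    rcases hx with rfl | rfl <;> assumption
  have hu : ({T, T'} : Finset (Finset V)).biUnion id = T ∪ T' := by simp
  have hdT := h.hP.2 T hT T' hT' hne
  have := h.BU hs (by rw [hu]; exact clique_join (h.clT hT) (h.clT hT') (h.K_BB hT hT' hA hB hK))
    (k := 1) (by rw [Finset.card_pair hne]) (by
      intro x hx
      simp only [Finset.mem_insert, Finset.mem_singleton] at hx
      rcases hx with rfl | rfl <;> assumption)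
  rw [hu, E_union_left hdT] at this
  have a3 := mant_card h.hM
  rw [h.lamB hB, h.lamB hA]
  push_cast at this
  rcases this with this | ⟨this, -⟩ <;> omega

lemma Cfg.edge (h : Cfg G W P M v) (hr : 9 ≤ (W \ P.biUnion id).card)
    {T T' : Finset V} (hT : T ∈ P) (hT' : T' ∈ P) (hne : T ≠ T') (hK : 9 ≤ phi G M v T T') :
    (((W \ P.biUnion id) \ M.biUnion id).card : ℤ) ≤ lam G W P M v T + lam G W P M v T' := by
  by_cases hA : IsA G M T <;> by_cases hA' : IsA G M T'
  · linarith [h.phi_AA hT hT' hne hA hA']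
  · exact h.edge_AB hT hT' hne hA hA' hK
  · rw [add_comm]; exact h.edge_AB hT' hT hne.symm hA' hA (by rw [phi_comm]; exact hK)
  · exact h.edge_BB hT hT' hne hA hA' hK hr

lemma Cfg.tri_A (h : Cfg G W P M v) {T T' T'' : Finset V} (hT : T ∈ P) (hT' : T' ∈ P)
    (hT'' : T'' ∈ P) (h1 : T ≠ T') (h2 : T ≠ T'') (h3 : T' ≠ T'')
    (hA : IsA G M T) (hB : ¬ IsA G M T') (hB' : ¬ IsA G M T'') (k1 : 9 ≤ phi G M v T T')
    (k2 : 9 ≤ phi G M v T T'') (k3 : 9 ≤ phi G M v T' T'') :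
    6 * (M.card : ℤ) + 4 * ((W \ P.biUnion id) \ M.biUnion id).card + 11 ≤
      lam G W P M v T + lam G W P M v T' + lam G W P M v T'' := by
  have hs : ({T, T', T''} : Finset (Finset V)) ⊆ P := by
    intro x hx
    simp only [Finset.mem_insert, Finset.mem_singleton] at hx
    rcases hx with rfl | rfl | rfl <;> assumption
  have hu : ({T, T', T''} : Finset (Finset V)).biUnion id = T ∪ (T' ∪ T'') := by simp
  have hc : ({T, T', T''} : Finset (Finset V)).card = 3 :=
    Finset.card_eq_three.2 ⟨T, T', T'', h1, h2, h3, rfl⟩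
  have d1 := h.hP.2 T hT T' hT' h1
  have d2 := h.hP.2 T hT T'' hT'' h2
  have d3 := h.hP.2 T' hT' T'' hT'' h3
  have d4 : Disjoint T (T' ∪ T'') := Finset.disjoint_union_right.2 ⟨d1, d2⟩
  have d5 : Disjoint (T.erase (hd G M v T)) (T' ∪ T'') :=
    Finset.disjoint_of_subset_left (Finset.erase_subset _ _) d4
  have m1 := hd_mem (v := v) hA
  have a1 := h.lamA hT hA
  have a2 := h.L4 hs (C := T.erase (hd G M v T) ∪ (T' ∪ T''))
    (by rw [hu]; exact Finset.union_subset_union_left (Finset.erase_subset _ _))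
    (clique_join (h.clT' hT _) (clique_join (h.clT hT') (h.clT hT'') (h.K_BB hT' hT'' hB hB' k3))
      (by
        intro x hx y hy
        rcases Finset.mem_union.1 hy with hy | hy
        · exact h.K_AB hT hT' hA hB k1 x hx y hy
        · exact h.K_AB hT hT'' hA hB' k2 x hx y hy)) (y := hd G M v T)
    (by rw [hu]; exact Finset.mem_union_left _ m1)
    (by rw [Finset.mem_union, not_or]; exact ⟨by simp, Finset.disjoint_left.1 d4 m1⟩) (k := 2)
    (by rw [Finset.card_union_of_disjoint d5, Finset.card_union_of_disjoint d3,
          h.cT' hT hA, h.cT hT', h.cT hT''])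
    hc (hd_head hA)
  rw [E_union_left d5, E_union_left d3] at a2
  have a3 := mant_card h.hM
  rw [h.lamB hB, h.lamB hB']
  linarith

lemma Cfg.tri_B (h : Cfg G W P M v) {T T' T'' : Finset V} (hT : T ∈ P) (hT' : T' ∈ P)
    (hT'' : T'' ∈ P) (h1 : T ≠ T') (h2 : T ≠ T'') (h3 : T' ≠ T'')
    (hA : ¬ IsA G M T) (hB : ¬ IsA G M T') (hB' : ¬ IsA G M T'') (k1 : 9 ≤ phi G M v T T')
    (k2 : 9 ≤ phi G M v T T'') (k3 : 9 ≤ phi G M v T' T'') :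
    3 * (M.card : ℤ) + 4 * ((W \ P.biUnion id) \ M.biUnion id).card - 3 ≤
      lam G W P M v T + lam G W P M v T' + lam G W P M v T'' := by
  have hs : ({T, T', T''} : Finset (Finset V)) ⊆ P := by
    intro x hx
    simp only [Finset.mem_insert, Finset.mem_singleton] at hx
    rcases hx with rfl | rfl | rfl <;> assumption
  have hu : ({T, T', T''} : Finset (Finset V)).biUnion id = T ∪ (T' ∪ T'') := by simp
  have hc : ({T, T', T''} : Finset (Finset V)).card = 3 :=
    Finset.card_eq_three.2 ⟨T, T', T'', h1, h2, h3, rfl⟩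
  have d1 := h.hP.2 T hT T' hT' h1
  have d2 := h.hP.2 T hT T'' hT'' h2
  have d3 := h.hP.2 T' hT' T'' hT'' h3
  have d4 : Disjoint T (T' ∪ T'') := Finset.disjoint_union_right.2 ⟨d1, d2⟩
  have := h.BU hs (by
      rw [hu]
      apply clique_join (h.clT hT)
        (clique_join (h.clT hT') (h.clT hT'') (h.K_BB hT' hT'' hB hB' k3))
      intro x hx y hy
      rcases Finset.mem_union.1 hy with hy | hy
      · exact h.K_BB hT hT' hA hB k1 x hx y hy
      · exact h.K_BB hT hT'' hA hB' k2 x hx y hy)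
    (k := 2) hc (by
      intro x hx
      simp only [Finset.mem_insert, Finset.mem_singleton] at hx
      rcases hx with rfl | rfl | rfl <;> assumption)
  rw [hu, E_union_left d4, E_union_left d3] at this
  rw [h.lamB hB, h.lamB hA, h.lamB hB']
  push_cast at this
  rcases this with this | ⟨-, this⟩
  · linarith [Int.natCast_nonneg M.card]
  · have := this trivial
    linarith

lemma Cfg.tri (h : Cfg G W P M v) (hr : 3 * P.card + 18 ≤ 2 * (W \ P.biUnion id).card)
    {T T' T'' : Finset V} (hT : T ∈ P) (hT' : T' ∈ P)
    (hT'' : T'' ∈ P) (h1 : T ≠ T') (h2 : T ≠ T'') (h3 : T' ≠ T'') (k1 : 9 ≤ phi G M v T T')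
    (k2 : 9 ≤ phi G M v T T'') (k3 : 9 ≤ phi G M v T' T'') :
    3 * (P.card : ℤ) + 3 * ((W \ P.biUnion id) \ M.biUnion id).card ≤
      2 * (lam G W P M v T + lam G W P M v T' + lam G W P M v T'') := by
  have a3 := mant_card h.hM
  by_cases hA : IsA G M T <;> by_cases hA' : IsA G M T' <;> by_cases hA'' : IsA G M T''
  · linarith [h.phi_AA hT hT' h1 hA hA']
  · linarith [h.phi_AA hT hT' h1 hA hA']
  · linarith [h.phi_AA hT hT'' h2 hA hA'']
  · have := h.tri_A hT hT' hT'' h1 h2 h3 hA hA' hA'' k1 k2 k3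
    omega
  · linarith [h.phi_AA hT' hT'' h3 hA' hA'']
  · have := h.tri_A hT' hT hT'' h1.symm h3 h2 hA' hA hA'' (by rw [phi_comm]; exact k1) k3 k2
    omega
  · have := h.tri_A hT'' hT hT' h2.symm h3.symm h1 hA'' hA hA' (by rw [phi_comm]; exact k2)
      (by rw [phi_comm]; exact k3) k1
    omega
  · have := h.tri_B hT hT' hT'' h1 h2 h3 hA hA' hA'' k1 k2 k3
    omega

end cfg4

def F (n s : ℕ) : ℕ := s.choose 2 + s * (n - s) + (n - s) ^ 2 / 4

lemma ch2 (s : ℕ) : 2 * (s.choose 2 : ℤ) = s * (s - 1) := by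
  induction s with
  | zero => simp
  | succ k ih =>
    rw [Nat.choose_succ_succ' k 1, Nat.choose_one_right]
    push_cast at ih ⊢
    linarith

lemma F_succ {n s : ℕ} (h : s ≤ n) : F (n + 1) (s + 1) = F n s + n := by
  unfold F
  rw [Nat.choose_succ_succ' s 1, Nat.choose_one_right, Nat.add_sub_add_right, Nat.add_mul,
    show 1 + 1 = 2 from rfl]
  omega

lemma F_low {n s : ℕ} (h : s ≤ n) :
    2 * (s : ℤ) * (s - 1) + 4 * s * (n - s) + (n - s) ^ 2 - 1 ≤ 4 * F n s := by
  obtain ⟨d, rfl⟩ := Nat.exists_eq_add_of_le h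
  unfold F
  rw [Nat.add_sub_cancel_left]
  have h1 := ch2 s
  have h2 : d ^ 2 ≤ 4 * (d ^ 2 / 4) + 1 := by
    rcases Nat.even_or_odd' d with ⟨c, rfl | rfl⟩
    · have : (2 * c) ^ 2 = 4 * (c ^ 2) := by ring
      omega
    · have : (2 * c + 1) ^ 2 = 4 * (c ^ 2 + c) + 1 := by ring
      omega
  have h3 : (d : ℤ) ^ 2 ≤ 4 * ((d ^ 2 / 4 : ℕ) : ℤ) + 1 := by exact_mod_cast h2
  push_cast at h3 ⊢
  nlinarith

section fin
variable {V : Type} [DecidableEq V] {G : SimpleGraph V} {W : Finset V}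
  {P M : Finset (Finset V)} {v : V}

lemma swap_sum (P : Finset (Finset V)) (g : Finset V → Finset V → ℤ) :
    ∑ T ∈ P, ∑ T' ∈ P.erase T, g T' T = ∑ T ∈ P, ∑ T' ∈ P.erase T, g T T' := by
  apply Finset.sum_comm'
  intro x y
  simp only [Finset.mem_erase]
  constructor
  · rintro ⟨a, b, c⟩; exact ⟨⟨Ne.symm b, a⟩, c⟩
  · rintro ⟨⟨a, b⟩, c⟩; exact ⟨b, Ne.symm a, c⟩

lemma Cfg.ETT (h : Cfg G W P M v) {T : Finset V} (hT : T ∈ P) : E G T T ≤ 6 := by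
  rw [E_sum_left]
  calc _ ≤ ∑ x ∈ T, (2 : ℤ) := by
        apply Finset.sum_le_sum
        intro x hx
        rw [E_comm, E_erase hx, E_single, ad_self]
        have := E_le (G := G) (T.erase x) {x}
        rw [Finset.card_erase_of_mem hx, h.cT hT] at this
        simpa using this
    _ = _ := by rw [Finset.sum_const, h.cT hT]; norm_num

open Classical in
lemma Cfg.final (h : Cfg G W P M v) (hn : 9 * P.card + 18 ≤ 2 * W.card) (hs : 1 ≤ P.card) :
    E G W W ≤ 2 * F W.card P.card := by
  have hWc : W.card = 3 * P.card + (W \ P.biUnion id).card := by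
    have := Finset.card_sdiff_add_card_eq_card h.hP.biUnion_subset
    rw [h.hP.card_biUnion] at this; omega
  have hRc := mant_card h.hM
  have hRR := mant_RR h.hM h.noR h.hmx
  have e1 := E_split_left (G := G) h.hP.biUnion_subset W
  have e2 := E_split_right (G := G) h.hP.biUnion_subset (P.biUnion id)
  have e3 := E_split_right (G := G) h.hP.biUnion_subset (W \ P.biUnion id)
  rw [E_comm _ (P.biUnion id)] at e3
  have e4 : E G (P.biUnion id) (W \ P.biUnion id) = ∑ T ∈ P, E G T (W \ P.biUnion id) :=
    E_biUnion_left P h.hP.2 _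
  have e5 : E G (P.biUnion id) (P.biUnion id) =
      ∑ T ∈ P, (E G T T + ∑ T' ∈ P.erase T, E G T T') := by
    rw [E_biUnion_left P h.hP.2]
    apply Finset.sum_congr rfl
    intro T hT
    rw [E_biUnion_right P h.hP.2, Finset.add_sum_erase P (fun T' => E G T T') hT]
  rw [Finset.sum_add_distrib] at e5
  have e6 : ∑ T ∈ P, E G T T ≤ 6 * P.card := by
    calc _ ≤ ∑ T ∈ P, (6 : ℤ) := Finset.sum_le_sum fun T hT => h.ETT hT
      _ = _ := by rw [Finset.sum_const, nsmul_eq_mul]; ring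
  have e7 : ∑ T ∈ P, ∑ T' ∈ P.erase T, E G T T' =
      ∑ T ∈ P, ∑ T' ∈ P.erase T, phi G M v T T' - 2 * ∑ T ∈ P, miss G P M v T := by
    have a := swap_sum P (fun T T' => ms G M v T T')
    have b : ∑ T ∈ P, miss G P M v T = ∑ T ∈ P, ∑ T' ∈ P.erase T, ms G M v T T' := rfl
    have c : ∑ T ∈ P, ∑ T' ∈ P.erase T, phi G M v T T' =
        ∑ T ∈ P, ∑ T' ∈ P.erase T, E G T T' + ∑ T ∈ P, ∑ T' ∈ P.erase T, ms G M v T T'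
          + ∑ T ∈ P, ∑ T' ∈ P.erase T, ms G M v T' T := by
      simp only [phi, Finset.sum_add_distrib]
    rw [a] at c
    linarith
  let K : Finset V → Finset V → Prop := fun T T' => T ≠ T' ∧ 9 ≤ phi G M v T T'
  have e8 : ∑ T ∈ P, ∑ T' ∈ P.erase T, phi G M v T T' ≤
      8 * P.card * (P.card - 1) + ∑ T ∈ P, ∑ T' ∈ P, (if K T T' then (1 : ℤ) else 0) := by
    have : ∀ T ∈ P, ∑ T' ∈ P.erase T, phi G M v T T' ≤
        8 * ((P.card : ℤ) - 1) + ∑ T' ∈ P, (if K T T' then (1 : ℤ) else 0) := by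
      intro T hT
      rw [← Finset.add_sum_erase P _ hT]
      have z : (if K T T then (1 : ℤ) else 0) = 0 := if_neg fun hk => hk.1 rfl
      rw [z]
      have cc := Finset.card_erase_add_one hT
      have cc' : ((P.erase T).card : ℤ) = P.card - 1 := by omega
      rw [zero_add, ← cc']
      calc _ ≤ ∑ T' ∈ P.erase T, (8 + (if K T T' then (1 : ℤ) else 0)) := by
            apply Finset.sum_le_sum
            intro T' hT'
            rw [Finset.mem_erase] at hT'
            by_cases hk : K T T'
            · rw [if_pos hk]; linarith [h.phi_le hT hT'.2 (Ne.symm hT'.1)]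
            · rw [if_neg hk]
              by_contra hcon
              exact hk ⟨Ne.symm hT'.1, by omega⟩
        _ = _ := by rw [Finset.sum_add_distrib, Finset.sum_const, nsmul_eq_mul]; ring
    calc _ ≤ _ := Finset.sum_le_sum this
      _ = _ := by rw [Finset.sum_add_distrib, Finset.sum_const, nsmul_eq_mul]; ring
  have e9 := weights K (fun x y hk => ⟨hk.1.symm, by rw [phi_comm]; exact hk.2⟩)
    (fun x hk => hk.1 rfl) P (lam G W P M v) (((W \ P.biUnion id) \ M.biUnion id).card) P.card
    (fun x hx => h.lam_nonneg hx)
    (fun x hx y hy hk => h.edge (by omega) hx hy hk.1 hk.2)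
    (fun x hx y hy z hz k1 k2 k3 => h.tri (by omega) hx hy hz k1.1 k3.1 k2.1 k1.2 k3.2 k2.2)
    P (Finset.Subset.refl _) le_rfl
  have e10 : ∑ T ∈ P, lam G W P M v T =
      P.card * (3 * M.card + 2 * ((W \ P.biUnion id) \ M.biUnion id).card + 4)
      - (∑ T ∈ P, E G T (W \ P.biUnion id) - ∑ T ∈ P, miss G P M v T) := by
    unfold lam
    rw [Finset.sum_sub_distrib, Finset.sum_sub_distrib, Finset.sum_const, nsmul_eq_mul]
  have e11 := F_low (show P.card ≤ W.card by omega)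
  have hWz : (W.card : ℤ) = 3 * P.card + (2 * M.card + ((W \ P.biUnion id) \ M.biUnion id).card) := by
    rw [← hRc]; exact_mod_cast hWc
  have hnz : 3 * (P.card : ℤ) + 18 ≤
      2 * (2 * M.card + ((W \ P.biUnion id) \ M.biUnion id).card) := by
    rw [← hRc]; omega
  have hsz : (1 : ℤ) ≤ P.card := by exact_mod_cast hs
  rw [hWz] at e11
  have key : 2 * E G W W ≤ 12 * P.card + 16 * P.card * (P.card - 1)
      + 4 * P.card * (3 * M.card + 2 * ((W \ P.biUnion id) \ M.biUnion id).card + 4)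
      + (P.card - ((W \ P.biUnion id) \ M.biUnion id).card) ^ 2
      + 4 * M.card * (M.card + ((W \ P.biUnion id) \ M.biUnion id).card) := by
    linarith
  generalize ((W \ P.biUnion id) \ M.biUnion id).card = i at *
  generalize P.card = s at *
  generalize M.card = m at *
  clear e9 e8 e10
  have hpos : 0 ≤ (s : ℤ) * (2 * (2 * m + i) - 3 * s - 18) :=
    mul_nonneg (by linarith) (by linarith)
  have : 2 * E G W W ≤ 4 * (F W.card s : ℤ) := by nlinarith
  linarith

lemma exists_max_matching (G : SimpleGraph V) (R : Finset V) (p : ℕ → Prop) (hp : ∃ m, p m)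
    (hb : ∀ m, p m → HasPack G 2 R m) : ∃ m, p m ∧ ¬ p (m + 1) := by
  have hbd : ∀ m, p m → m ≤ R.card := by
    intro m hm
    obtain ⟨M, hM, rfl⟩ := hb m hm
    have := Finset.card_le_card hM.biUnion_subset
    rw [hM.card_biUnion] at this; omega
  by_contra hcon
  push Not at hcon
  obtain ⟨m, hm⟩ := hp
  have : ∀ d, p (m + d) := by
    intro d
    induction d with
    | zero => exact hm
    | succ d ih => exact hcon _ ih
  have := hbd _ (this (R.card + 1))
  omega

lemma main (G : SimpleGraph V) (s : ℕ) : ∀ W : Finset V, 9 * s + 18 ≤ 2 * W.card →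
    ¬ HasPack G 3 W (s + 1) → E G W W ≤ 2 * F W.card s := by
  induction s with
  | zero =>
    intro W hW hno
    obtain ⟨m, ⟨M, hM, rfl⟩, hmx⟩ := exists_max_matching G W (HasPack G 2 W) ⟨0, HasPack.zero _⟩
      fun m hm => hm
    have h1 := mant_RR hM hno hmx
    have h2 := mant_card hM
    have h3 := F_low (Nat.zero_le W.card)
    rw [h2] at h3
    push_cast at h3
    have : 2 * E G W W ≤ 4 * (F W.card 0 : ℤ) + 1 := by
      nlinarith [sq_nonneg (((W \ M.biUnion id).card : ℤ))]
    omega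
  | succ s ih =>
    intro W hW hno
    have hne : W.Nonempty := by
      rw [← Finset.card_pos]; omega
    obtain ⟨v, hv, hdeg⟩ := Finset.exists_max_image W (fun u => E G {u} W) hne
    by_cases hp : HasPack G 3 (W.erase v) (s + 1)
    · obtain ⟨m, ⟨X, hX, hXp, hvX, hXm⟩, hmx⟩ := exists_max_matching G W
        (fun m => ∃ X ⊆ W, HasPack G 3 X (s + 1) ∧ v ∉ X ∧ HasPack G 2 (W \ X) m)
        ⟨0, W.erase v, Finset.erase_subset _ _, hp, by simp, HasPack.zero _⟩
        (fun m ⟨X, hX, _, _, hm⟩ => hm.mono Finset.sdiff_subset)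
      obtain ⟨P, hP, hPc⟩ := hXp
      have hPX := hP.biUnion_subset
      obtain ⟨M, hM, rfl⟩ := hXm.mono (Finset.sdiff_subset_sdiff (Finset.Subset.refl W) hPX)
      have hcfg : Cfg G W P M v :=
        { hP := ⟨fun t ht => ⟨(hP.1 t ht).1, (hP.1 t ht).2.trans hX⟩, hP.2⟩
          hM := hM
          hv := hv
          hvP := fun hx => hvX (hPX hx)
          nop := by rw [hPc]; exact hno
          hmax := fun X' hX' hX'p hvX' hm => hmx ⟨X', hX', by rw [← hPc]; exact hX'p, hvX', hm⟩
          hdeg := hdeg }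
      have := hcfg.final (by rw [hPc]; exact hW) (by omega)
      rwa [hPc] at this
    · have hc := Finset.card_erase_add_one hv
      have h1 := ih (W.erase v) (by omega) hp
      have h2 := F_succ (n := (W.erase v).card) (s := s) (by omega)
      rw [hc] at h2
      rw [h2]
      have h3 := E_erase (G := G) hv W
      have h4 := E_erase (G := G) hv (W.erase v)
      rw [E_comm] at h4
      have h5 := E_le (G := G) {v} (W.erase v)
      have h6 := E_erase (G := G) hv {v}
      rw [E_single, ad_self, E_comm W] at h6
      rw [E_comm (W.erase v) {v}] at h6
      rw [Finset.card_singleton] at h5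
      push_cast at h5 ⊢
      linarith

end fin

lemma hasCopy_of_pack {n k : ℕ} {H : SimpleGraph (Fin n)} (h : HasPack H 3 Finset.univ k) :
    HasCopy H (kCliques k 3) := by
  obtain ⟨P, hP, hc⟩ := h
  let e := P.equivFinOfCardEq hc
  have ht : ∀ i : Fin k, ((e.symm i : Finset (Fin n))).card = 3 := fun i =>
    (hP.1 _ (e.symm i).2).1.2
  let g := fun i : Fin k => (e.symm i : Finset (Fin n)).equivFinOfCardEq (ht i)
  have gm : ∀ i j, ((g i).symm j : Fin n) ∈ (e.symm i : Finset (Fin n)) := fun i j =>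
    ((g i).symm j).2
  have ginj : ∀ i j j', ((g i).symm j : Fin n) = (g i).symm j' → j = j' := by
    intro i j j' hj
    exact (g i).symm.injective (Subtype.ext hj)
  refine ⟨fun p => (g p.1).symm p.2, ?_, ?_⟩
  · rintro ⟨i, j⟩ ⟨i', j'⟩ hh
    simp only at hh
    by_cases hi : i = i'
    · subst hi
      rw [ginj i j j' hh]
    · exfalso
      have hne : (e.symm i : Finset (Fin n)) ≠ e.symm i' := fun hx =>
        hi (e.symm.injective (Subtype.ext hx))
      have := hP.2 _ (e.symm i).2 _ (e.symm i').2 hne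
      exact Finset.disjoint_left.1 this (gm i j) (hh ▸ gm i' j')
  · rintro ⟨i, j⟩ ⟨i', j'⟩ hab
    unfold kCliques at hab
    rw [SimpleGraph.fromRel_adj] at hab
    obtain ⟨hne, hab⟩ := hab
    have hi : i = i' := by rcases hab with hab | hab; exact hab; exact hab.symm
    subst hi
    refine (hP.1 _ (e.symm i).2).1.1 (gm i j) (gm i j') ?_
    intro hx
    exact hne (by rw [ginj i j j' hx])

lemma edges_E {n : ℕ} (H : SimpleGraph (Fin n)) :
    2 * (H.edgeSet.ncard : ℤ) = E H Finset.univ Finset.univ := by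
  classical
  have h1 := H.sum_degrees_eq_twice_card_edges
  have h2 : H.edgeSet.ncard = H.edgeFinset.card := by
    rw [Set.ncard_eq_toFinset_card']; rfl
  rw [h2]
  have h3 : ∀ x, ∑ y, ad H x y = (H.degree x : ℤ) := by
    intro x
    unfold ad
    rw [Finset.sum_boole, ← SimpleGraph.card_neighborFinset_eq_degree,
      SimpleGraph.neighborFinset_eq_filter]
  unfold E
  simp only [h3]
  exact_mod_cast h1.symm

def adN (s a b : ℕ) : Prop := a ≠ b ∧ (a < s ∨ b < s ∨ (a - s) % 2 ≠ (b - s) % 2)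

instance (s a b : ℕ) : Decidable (adN s a b) := by unfold adN; infer_instance

lemma adN_comm (s a b : ℕ) : adN s a b ↔ adN s b a := by unfold adN; omega

def LG (n s : ℕ) : SimpleGraph (Fin n) where
  Adj a b := adN s a b
  symm := ⟨fun a b h => (adN_comm s a b).1 h⟩
  loopless := ⟨fun _ h => h.1 rfl⟩

lemma par_sum (d p : ℕ) : ∑ j ∈ Finset.range d, (if p % 2 ≠ j % 2 then 1 else 0) =
    if p % 2 = 1 then (d + 1) / 2 else d / 2 := by
  induction d with
  | zero => simp
  | succ d ih =>
    rw [Finset.sum_range_succ, ih]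
    split_ifs <;> omega

lemma deg_lt {s n : ℕ} (h : n < s) :
    ∑ b ∈ Finset.range n, (if adN s n b then 1 else 0) = n := by
  rw [Finset.sum_congr rfl (g := fun _ => 1)]
  · simp
  · intro b hb
    rw [Finset.mem_range] at hb
    rw [if_pos]; unfold adN; omega

lemma deg_ge (s d : ℕ) :
    ∑ b ∈ Finset.range (s + d), (if adN s (s + d) b then 1 else 0) = s + (d + 1) / 2 := by
  rw [Finset.sum_range_add]
  congr 1
  · rw [Finset.sum_congr rfl (g := fun _ => 1)]
    · simp
    · intro b hb
      rw [Finset.mem_range] at hb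
      rw [if_pos]; unfold adN; omega
  · rw [Finset.sum_congr rfl (g := fun j => if d % 2 ≠ j % 2 then 1 else 0)]
    · rw [par_sum]; split_ifs <;> omega
    · intro b hb
      rw [Finset.mem_range] at hb
      congr 1
      unfold adN
      simp only [eq_iff_iff]
      omega

def tot (s n : ℕ) : ℕ := ∑ a ∈ Finset.range n, ∑ b ∈ Finset.range n, (if adN s a b then 1 else 0)

lemma tot_succ (s n : ℕ) :
    tot s (n + 1) = tot s n + 2 * ∑ b ∈ Finset.range n, (if adN s n b then 1 else 0) := by
  unfold tot
  simp only [Finset.sum_range_succ, Finset.sum_add_distrib]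
  have h0 : ¬ adN s n n := fun h => h.1 rfl
  simp only [h0, if_false, adN_comm s _ n]
  ring

lemma tot_le (s n : ℕ) (h : n ≤ s) : (tot s n : ℤ) = n * (n - 1) := by
  induction n with
  | zero => simp [tot]
  | succ n ih =>
    rw [tot_succ, deg_lt (by omega)]
    have := ih (by omega)
    push_cast
    rw [this]; ring

lemma sq4 (d : ℕ) : (d + 1) ^ 2 / 4 = d ^ 2 / 4 + (d + 1) / 2 := by
  rcases Nat.even_or_odd' d with ⟨c, rfl | rfl⟩
  · have h1 : (2 * c + 1) ^ 2 = 4 * (c ^ 2 + c) + 1 := by ring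
    have h2 : (2 * c) ^ 2 = 4 * (c ^ 2) := by ring
    omega
  · have h1 : (2 * c + 1 + 1) ^ 2 = 4 * (c ^ 2 + 2 * c + 1) := by ring
    have h2 : (2 * c + 1) ^ 2 = 4 * (c ^ 2 + c) + 1 := by ring
    omega

lemma tot_eq (s d : ℕ) : tot s (s + d) = 2 * F (s + d) s := by
  induction d with
  | zero =>
    have h1 := tot_le s s le_rfl
    have h2 := ch2 s
    rw [← h2] at h1
    unfold F
    simp
    exact_mod_cast h1
  | succ d ih =>
    rw [← Nat.add_assoc, tot_succ, deg_ge, ih]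
    unfold F
    rw [show s + d - s = d by omega, show s + d + 1 - s = d + 1 by omega, sq4]
    ring

lemma E_LG {n s : ℕ} (h : s ≤ n) : E (LG n s) Finset.univ Finset.univ = 2 * F n s := by
  obtain ⟨d, rfl⟩ := Nat.exists_eq_add_of_le h
  have h1 := tot_eq s d
  have h2 : (tot s (s + d) : ℤ) = 2 * (F (s + d) s : ℤ) := by exact_mod_cast h1
  rw [← h2]
  unfold tot E
  push_cast
  rw [Finset.sum_range]
  apply Finset.sum_congr rfl
  intro x _
  rw [Finset.sum_range]
  apply Finset.sum_congr rfl
  intro y _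
  by_cases hxy : adN s x y
  · rw [if_pos hxy, ad_adj (show (LG (s + d) s).Adj x y from hxy)]
  · rw [if_neg hxy, ad_not (show ¬ (LG (s + d) s).Adj x y from hxy)]

lemma LG_free {n k : ℕ} (hk : 1 ≤ k) : ¬ HasCopy (LG n (k - 1)) (kCliques k 3) := by
  rintro ⟨f, hf, hadj⟩
  have key : ∀ i : Fin k, ∃ j : Fin 3, (f (i, j)).val < k - 1 := by
    intro i
    by_contra hcon
    push Not at hcon
    have ha : ∀ j j' : Fin 3, j ≠ j' → adN (k - 1) (f (i, j)) (f (i, j')) := by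
      intro j j' hne
      have : (kCliques k 3).Adj (i, j) (i, j') := by
        unfold kCliques
        rw [SimpleGraph.fromRel_adj]
        exact ⟨by simpa using hne, Or.inl rfl⟩
      exact hadj this
    have h01 := ha 0 1 (by decide)
    have h02 := ha 0 2 (by decide)
    have h12 := ha 1 2 (by decide)
    have c0 := hcon 0
    have c1 := hcon 1
    have c2 := hcon 2
    unfold adN at h01 h02 h12
    omega
  choose j hj using key
  have hinj : Function.Injective (fun i : Fin k => (⟨(f (i, j i)).val, hj i⟩ : Fin (k - 1))) := by
    intro a b hab
    simp only [Fin.mk.injEq] at hab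
    have := hf (Fin.ext hab)
    exact (Prod.mk.inj this).1
  have := Fintype.card_le_of_injective _ hinj
  simp at this
  omega

lemma final_eq (k n : ℕ) (hk : 1 ≤ k) (hn : 9 * k + 8 < 2 * n) :
    exNum (⊤ : SimpleGraph (Fin n)) (kCliques k 3) = F n (k - 1) := by
  unfold exNum
  apply IsGreatest.csSup_eq
  constructor
  · refine ⟨LG n (k - 1), le_top, LG_free hk, ?_⟩
    have h1 := edges_E (LG n (k - 1))
    rw [E_LG (by omega)] at h1
    omega
  · rintro m ⟨H, -, hH, rfl⟩
    have h1 := edges_E H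
    have h2 := main H (k - 1) Finset.univ (by rw [Finset.card_univ, Fintype.card_fin]; omega) (by
      rw [show k - 1 + 1 = k by omega]
      exact fun h => hH (hasCopy_of_pack h))
    rw [Finset.card_univ, Fintype.card_fin] at h2
    omega

end Moon

/-- Erdős/Moon: for `n > 9k/2 + 4`,
`ex(K_n, kK_3) = C(k−1,2) + (k−1)(n−k+1) + ⌊(n−k+1)²/4⌋`, the number of edges of
`K_{k−1} ∨ T_2(n−k+1)`. -/
theorem stmt_14 (k n : ℕ) (hk : 1 ≤ k) (hn : 9 * k + 8 < 2 * n) :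
    exNum (⊤ : SimpleGraph (Fin n)) (kCliques k 3) =
      (k - 1).choose 2 + (k - 1) * (n - k + 1) + (n - k + 1) ^ 2 / 4 := by
  rw [Moon.final_eq k n hk hn, Moon.F, show n - (k - 1) = n - k + 1 by omega]
end
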